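/- In the standing setup of degree 2, with f₁ = id_H, f₂ = 0, f_p (p ≥ 3) defined recursively on (H^1)^{⊙p} by (f_p(ξ₁,…,ξ_p), ξ_{p+1}) = (1/2) Σ_{j=2}^{p-1} Σ_{σ∈S(j,p-j)} (I^{p+1}_j − F^{p+1}_j)(ξ_{σ(1)},…,ξ_{σ(p)}, ξ_{p+1}) and extended by zero on inputs not all of degree 1, the following holds: for every p ≥ 2 and all ξ₁,…,ξ_{p+1} ∈ H^1, {ξ₁,…,ξ_{p+1}}_{p+1} = (1/2) Σ_{j=1}^{p} Σ_{σ∈S(j,p+1-j)} { f_j(ξ_{σ(1)},…,ξ_{σ(j)}), f_{p+1-j}(ξ_{σ(j+1)},…,ξ_{σ(p+1)}) }₂. Consequently the collection (f₁, f₂ = 0, f₃, f₄, …) is an L∞ isomorphism from the transferred minimal L∞ algebra (H, 0, {·,·}₂, {⋯}₃, {⋯}₄, …) to the graded Lie algebra H*(L) with the induced bracket, and therefore L is formal. -/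

import Mathlib

/-!
Core definitions: differential graded Lie algebras (DGLAs) over a field `K`,
their cohomology, morphisms, quasi-isomorphisms, zigzags and formality.

A ℤ-graded vector space is encoded as a module `carrier` together with an internal
direct sum decomposition `grading : ℤ → Submodule K carrier`.
-/

/-- A differential graded Lie algebra over `K`.  The differential `d` has degree `+1`,
the bracket `br` is graded skew-symmetric, satisfies the graded Jacobi identity and
`d` is a graded derivation with respect to it. -/
structure DGLA (K : Type) [Field K] : Type 1 where
  carrier : Type
  [acg : AddCommGroup carrier]
  [mod : Module K carrier]
  grading : ℤ → Submodule K carrier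
  internal : DirectSum.IsInternal grading
  d : carrier → carrier
  d_lin : IsLinearMap K d
  d_mem : ∀ i : ℤ, ∀ x ∈ grading i, d x ∈ grading (i + 1)
  d_sq : ∀ x, d (d x) = 0
  br : carrier → carrier → carrier
  br_lin₁ : ∀ y, IsLinearMap K fun x => br x y
  br_lin₂ : ∀ x, IsLinearMap K (br x)
  br_mem : ∀ i j : ℤ, ∀ x ∈ grading i, ∀ y ∈ grading j, br x y ∈ grading (i + j)
  skew : ∀ i j : ℤ, ∀ x ∈ grading i, ∀ y ∈ grading j,
      br x y = -((-1 : K) ^ (i * j) • br y x)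
  jacobi : ∀ i j : ℤ, ∀ x ∈ grading i, ∀ y ∈ grading j, ∀ z : carrier,
      br x (br y z) = br (br x y) z + (-1 : K) ^ (i * j) • br y (br x z)
  leibniz : ∀ i : ℤ, ∀ x ∈ grading i, ∀ y : carrier,
      d (br x y) = br (d x) y + (-1 : K) ^ i • br x (d y)

attribute [instance] DGLA.acg DGLA.mod

variable {K : Type} [Field K]

/-- The differential bundled as a linear map. -/
def DGLA.dHom (A : DGLA K) : A.carrier →ₗ[K] A.carrier := IsLinearMap.mk' A.d A.d_lin

/-- Degree `i` cocycles. -/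
def DGLA.cocycles (A : DGLA K) (i : ℤ) : Submodule K A.carrier :=
  A.grading i ⊓ LinearMap.ker A.dHom

/-- Degree `i` coboundaries. -/
def DGLA.coboundaries (A : DGLA K) (i : ℤ) : Submodule K A.carrier :=
  A.grading i ⊓ LinearMap.range A.dHom

/-- Degree `i` cohomology `H^i(L)` as a quotient vector space. -/
abbrev DGLA.cohomology (A : DGLA K) (i : ℤ) :=
  A.cocycles i ⧸ ((A.coboundaries i).comap (A.cocycles i).subtype)

/-- A morphism of DGLAs. -/
structure DGLAHom (A B : DGLA K) where
  toFun : A.carrier → B.carrier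
  lin : IsLinearMap K toFun
  map_grading : ∀ i : ℤ, ∀ x ∈ A.grading i, toFun x ∈ B.grading i
  map_d : ∀ x, toFun (A.d x) = B.d (toFun x)
  map_br : ∀ x y, toFun (A.br x y) = B.br (toFun x) (toFun y)

/-- `f` is a quasi-isomorphism: it induces bijections on cohomology in every degree. -/
def DGLAHom.IsQuasiIso {A B : DGLA K} (f : DGLAHom A B) : Prop :=
  ∀ i : ℤ,
    (∀ x ∈ A.cocycles i, f.toFun x ∈ B.coboundaries i → x ∈ A.coboundaries i) ∧
    (∀ y ∈ B.cocycles i, ∃ x ∈ A.cocycles i, f.toFun x - y ∈ B.coboundaries i)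

/-- There exists a quasi-isomorphism `A → B`. -/
def QIso (A B : DGLA K) : Prop := ∃ f : DGLAHom A B, f.IsQuasiIso

/-- Two DGLAs are connected by a zigzag of quasi-isomorphisms. -/
inductive ZigzagQIso : DGLA K → DGLA K → Prop
  | of {A B : DGLA K} : QIso A B → ZigzagQIso A B
  | refl (A : DGLA K) : ZigzagQIso A A
  | symm {A B : DGLA K} : ZigzagQIso A B → ZigzagQIso B A
  | trans {A B C : DGLA K} : ZigzagQIso A B → ZigzagQIso B C → ZigzagQIso A C

/-- A DGLA is formal if it is connected by a zigzag of quasi-isomorphisms to a DGLA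
with zero differential.  (This is equivalent to being connected by a zigzag of
quasi-isomorphisms to its cohomology `H^*(L)` endowed with the zero differential and
the induced bracket: any zero-differential DGLA quasi-isomorphic to `L` is isomorphic,
as a graded Lie algebra, to `H^*(L)` with the induced bracket.) -/
def DGLA.IsFormal (A : DGLA K) : Prop :=
  ∃ M : DGLA K, (∀ x, M.d x = 0) ∧ ZigzagQIso A M

/-- A quasi-cyclic DGLA of degree `n`: a DGLA with finite dimensional cohomology
equipped with a graded symmetric bilinear form of degree `-n`, compatible with `d`
and cyclic with respect to the bracket, whose induced pairing on cohomology is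
non-degenerate. -/
structure QCyclicDGLA (K : Type) [Field K] (n : ℤ) extends DGLA K where
  form : carrier → carrier → K
  form_lin₁ : ∀ y, IsLinearMap K fun x => form x y
  form_lin₂ : ∀ x, IsLinearMap K (form x)
  findim : ∀ i : ℤ, FiniteDimensional K (toDGLA.cohomology i)
  form_degree : ∀ i j : ℤ, i + j ≠ n → ∀ x ∈ grading i, ∀ y ∈ grading j, form x y = 0
  form_symm : ∀ i j : ℤ, ∀ x ∈ grading i, ∀ y ∈ grading j,
      form x y = (-1 : K) ^ (i * j) * form y x
  form_d : ∀ i : ℤ, ∀ x ∈ grading i, ∀ y,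
      form (d x) y = (-1 : K) ^ (i + 1) * form x (d y)
  form_cyclic : ∀ x y z, form (br x y) z = form x (br y z)
  nondeg : ∀ i : ℤ, ∀ x ∈ toDGLA.cocycles i,
      (∀ y ∈ toDGLA.cocycles (n - i), form x y = 0) → x ∈ toDGLA.coboundaries i

/-- A splitting `L = H ⊕ d(K) ⊕ K` of the complex `(L, d)` into graded subspaces:
`d` vanishes on `H`, is injective on `K = Kc`, and in every degree `i` one has the
internal direct sum `L^i = H^i ⊕ d(K^{i-1}) ⊕ K^i`. -/
structure GradedSplitting (A : DGLA K) where
  H : ℤ → Submodule K A.carrier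
  Kc : ℤ → Submodule K A.carrier
  H_le : ∀ i, H i ≤ A.grading i
  Kc_le : ∀ i, Kc i ≤ A.grading i
  d_H : ∀ i, ∀ x ∈ H i, A.d x = 0
  d_Kc_inj : ∀ i, ∀ x ∈ Kc i, A.d x = 0 → x = 0
  decomp : ∀ i, H i ⊔ ((Kc (i - 1)).map A.dHom ⊔ Kc i) = A.grading i
  disj₁ : ∀ i, Disjoint (H i) ((Kc (i - 1)).map A.dHom ⊔ Kc i)
  disj₂ : ∀ i, Disjoint ((Kc (i - 1)).map A.dHom) (Kc i)

/-- The contraction data `(π, h)` determined by a splitting `L = H ⊕ d(K) ⊕ K`: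
`pr` is the projection onto `H`, and `h` the degree `-1` homotopy given by projecting
onto `d(K)`, applying `-d⁻¹` and including `K` into `L`.  The listed identities
determine `pr` and `h` uniquely. -/
structure ContractionData (A : DGLA K) (S : GradedSplitting A) where
  pr : A.carrier → A.carrier
  h : A.carrier → A.carrier
  pr_lin : IsLinearMap K pr
  h_lin : IsLinearMap K h
  pr_H : ∀ i : ℤ, ∀ x ∈ S.H i, pr x = x
  pr_dK : ∀ i : ℤ, ∀ x ∈ S.Kc i, pr (A.d x) = 0
  pr_K : ∀ i : ℤ, ∀ x ∈ S.Kc i, pr x = 0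
  h_H : ∀ i : ℤ, ∀ x ∈ S.H i, h x = 0
  h_dK : ∀ i : ℤ, ∀ x ∈ S.Kc i, h (A.d x) = -x
  h_K : ∀ i : ℤ, ∀ x ∈ S.Kc i, h x = 0
/-!  Homotopy transfer: Koszul signs, shuffles, and the recursively defined
Taylor coefficients `ι_p` and transferred brackets `{⋯}_p`. -/

/-- `(-1)^m` in `K` for an integer `m`. -/
def negOnePowK (K : Type) [Field K] (m : ℤ) : K := (-1 : K) ^ m.natAbs

/-- The antisymmetric Koszul sign `χ(σ)` of a permutation `σ` acting on homogeneous
elements of degrees `dg 0, …, dg (P-1)`: a product over the inversions of `σ` of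
`-(-1)^{|ξ_a||ξ_b|}`. -/
def koszulSign (K : Type) [Field K] {P : ℕ} (dg : Fin P → ℤ) (σ : Equiv.Perm (Fin P)) : K :=
  ∏ q ∈ Finset.univ.filter
      (fun q : Fin P × Fin P => q.1 < q.2 ∧ σ q.2 < σ q.1),
    -negOnePowK K (dg (σ q.1) * dg (σ q.2))

/-- The sign `(-1)^{α(σ)}` with `α(σ) = (1-P+k)(k + Σ_{i<k} |ξ_{σ(i)}|)`. -/
def alphaSign (K : Type) [Field K] {P : ℕ} (k : ℕ) (dg : Fin P → ℤ) (σ : Equiv.Perm (Fin P)) : K :=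
  negOnePowK K ((1 - (P : ℤ) + (k : ℤ)) *
    ((k : ℤ) + ∑ i ∈ Finset.univ.filter (fun i : Fin P => (i : ℕ) < k), dg (σ i)))

/-- The set of `(k, P-k)`-shuffles in the symmetric group of `Fin P`. -/
def shuffles (P k : ℕ) : Finset (Equiv.Perm (Fin P)) :=
  Finset.univ.filter fun σ =>
    ∀ i j : Fin P, i < j → ((j : ℕ) < k ∨ k ≤ (i : ℕ)) → σ i < σ j

/-- Auxiliary total indexing function `ℕ → Fin (p+2)` (reduction mod `p+2`);
on the ranges actually used in the transfer formulas it is the obvious inclusion. -/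
def finIdx (p : ℕ) (m : ℕ) : Fin (p + 2) := ⟨m % (p + 2), Nat.mod_lt m (by omega)⟩

/-- The first `j` entries of a `p`-tuple. -/
def tupleTake {M : Type} (p j : ℕ) (h : j ≤ p) (v : Fin p → M) : Fin j → M :=
  fun i => v (Fin.castLE h i)

/-- The last `p - j` entries of a `p`-tuple. -/
def tupleDrop {M : Type} (p j : ℕ) (h : j ≤ p) (v : Fin p → M) : Fin (p - j) → M :=
  fun i => v ⟨j + (i : ℕ), by have := i.isLt; omega⟩

variable {K : Type} [Field K]

/-- The homotopy transfer family associated to a splitting with contraction data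
`(pr, h)`: `ι p` are the Taylor coefficients of the induced `L∞` quasi-isomorphism
`H → L` and `bh p` the transferred higher brackets on `H ≅ H^*(L)`, characterized
(on tuples of homogeneous elements of `H`) by `ι 1 = inclusion` together with the
standard recursive shuffle formulas. -/
structure IsTransfer (A : DGLA K) (S : GradedSplitting A) (C : ContractionData A S)
    (ι : (p : ℕ) → (Fin p → A.carrier) → A.carrier)
    (bh : (p : ℕ) → (Fin p → A.carrier) → A.carrier) : Prop where
  iota_one : ∀ v : Fin 1 → A.carrier, ι 1 v = v 0
  iota_rec : ∀ (p : ℕ) (dg : Fin (p + 2) → ℤ) (v : Fin (p + 2) → A.carrier),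
      (∀ i, v i ∈ S.H (dg i)) →
      ι (p + 2) v = (2 : K)⁻¹ •
        ∑ k ∈ Finset.Ioo 0 (p + 2), ∑ σ ∈ shuffles (p + 2) k,
          (koszulSign K dg σ * alphaSign K k dg σ) •
            C.h (A.br (ι k fun i => v (σ (finIdx p (i : ℕ))))
                 (ι (p + 2 - k) fun i => v (σ (finIdx p (k + (i : ℕ))))))
  bracket_rec : ∀ (p : ℕ) (dg : Fin (p + 2) → ℤ) (v : Fin (p + 2) → A.carrier),
      (∀ i, v i ∈ S.H (dg i)) →
      bh (p + 2) v = (2 : K)⁻¹ •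
        ∑ k ∈ Finset.Ioo 0 (p + 2), ∑ σ ∈ shuffles (p + 2) k,
          (koszulSign K dg σ * alphaSign K k dg σ) •
            C.pr (A.br (ι k fun i => v (σ (finIdx p (i : ℕ))))
                  (ι (p + 2 - k) fun i => v (σ (finIdx p (k + (i : ℕ))))))

/-- The scalar `I_j^p(ξ₁, …, ξ_p) = (ι_j(ξ₁, …, ξ_j), ι_{p-j}(ξ_{j+1}, …, ξ_p))`. -/
def Ipair {K : Type} [Field K] {n : ℤ} (A : QCyclicDGLA K n)
    (ι : (p : ℕ) → (Fin p → A.carrier) → A.carrier)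
    (p j : ℕ) (h : j ≤ p) (v : Fin p → A.carrier) : K :=
  A.form (ι j (tupleTake p j h v)) (ι (p - j) (tupleDrop p j h v))

/-- The scalar `F_j^p(ξ₁, …, ξ_p) = (f_j(ξ₁, …, ξ_j), f_{p-j}(ξ_{j+1}, …, ξ_p))`. -/
def Fpair {K : Type} [Field K] {n : ℤ} (A : QCyclicDGLA K n)
    (f : (p : ℕ) → (Fin p → A.carrier) → A.carrier)
    (p j : ℕ) (h : j ≤ p) (v : Fin p → A.carrier) : K :=
  A.form (f j (tupleTake p j h v)) (f (p - j) (tupleDrop p j h v))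

/-- The family `f₁ = id`, `f₂ = 0`, `f_p` (`p ≥ 3`) recursively determined by
`(f_p(ξ₁,…,ξ_p), ξ_{p+1}) = (1/2) Σ_{j=2}^{p-1} Σ_{σ ∈ S(j,p-j)}
  (I^{p+1}_j − F^{p+1}_j)(ξ_{σ(1)},…,ξ_{σ(p)}, ξ_{p+1})` on `(H^1)^{⊙p}`,
extended by zero on homogeneous inputs not all of degree `1`. -/
structure IsFFamily {K : Type} [Field K] {n : ℤ}
    (A : QCyclicDGLA K n) (S : GradedSplitting A.toDGLA)
    (ι : (p : ℕ) → (Fin p → A.carrier) → A.carrier)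
    (f : (p : ℕ) → (Fin p → A.carrier) → A.carrier) : Prop where
  f_one : ∀ v : Fin 1 → A.carrier, f 1 v = v 0
  f_two : ∀ v : Fin 2 → A.carrier, f 2 v = 0
  f_mem : ∀ p : ℕ, 3 ≤ p → ∀ v : Fin p → A.carrier,
      (∀ i, v i ∈ S.H 1) → f p v ∈ S.H 1
  f_rec : ∀ p : ℕ, 3 ≤ p → ∀ v : Fin p → A.carrier, (∀ i, v i ∈ S.H 1) →
      ∀ ξ ∈ S.H 1,
      A.form (f p v) ξ = (2 : K)⁻¹ *
        ∑ j ∈ (Finset.Ico 2 p).attach, ∑ σ ∈ shuffles p j.1,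
          (Ipair A ι (p + 1) j.1
              (by have := (Finset.mem_Ico.mp j.2).2; omega)
              (Fin.snoc (fun i => v (σ i)) ξ)
            - Fpair A f (p + 1) j.1
              (by have := (Finset.mem_Ico.mp j.2).2; omega)
              (Fin.snoc (fun i => v (σ i)) ξ))
  f_zero : ∀ p : ℕ, 3 ≤ p → ∀ (dg : Fin p → ℤ) (v : Fin p → A.carrier),
      (∀ i, v i ∈ S.H (dg i)) → (∃ i, dg i ≠ 1) → f p v = 0

/-! ### The polynomial bialgebra of a vector space with a basis -/

namespace PolyCoalg

open MvPolynomial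
open scoped TensorProduct

variable {X σ : Type} [AddCommGroup X] [Module K X]

/-- The inclusion of a vector space as the linear forms of the polynomial algebra on a basis. -/
noncomputable def lin (b : Module.Basis σ K X) : X →ₗ[K] MvPolynomial σ K :=
  b.constr K fun i => (MvPolynomial.X i : MvPolynomial σ K)

@[simp] lemma lin_basis (b : Module.Basis σ K X) (i : σ) :
    lin b (b i) = (MvPolynomial.X i : MvPolynomial σ K) := by
  simp [lin]

/-- The augmentation of the polynomial algebra, as a linear form. -/
noncomputable def aug (σ K : Type) [Field K] : MvPolynomial σ K →ₗ[K] K :=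
  (aeval (fun _ => (0 : K))).toLinearMap

@[simp] lemma aug_one : aug σ K 1 = 1 := by simp [aug]
@[simp] lemma aug_mul (s t : MvPolynomial σ K) : aug σ K (s * t) = aug σ K s * aug σ K t := by
  simp [aug]
@[simp] lemma aug_X (i : σ) : aug σ K (MvPolynomial.X i) = 0 := by simp [aug]
@[simp] lemma aug_lin (b : Module.Basis σ K X) (x : X) : aug σ K (lin b x) = 0 := by
  have : aug σ K ∘ₗ lin b = 0 := b.ext fun i => by simp
  exact LinearMap.congr_fun this x

/-- The linear part of a polynomial. -/
noncomputable def linPart [Fintype σ] (b : Module.Basis σ K X) : MvPolynomial σ K →ₗ[K] X :=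
  ∑ i, (aug σ K ∘ₗ (pderiv i).toLinearMap).smulRight (b i)

variable (b : Module.Basis σ K X)

section

variable [Fintype σ]

lemma linPart_apply (s : MvPolynomial σ K) :
    linPart b s = ∑ i, aug σ K (pderiv i s) • b i := by
  simp [linPart, LinearMap.sum_apply]

@[simp] lemma linPart_one : linPart b 1 = 0 := by
  simp [linPart_apply]

@[simp] lemma linPart_C (c : K) : linPart b (C c) = 0 := by
  simp [linPart_apply]

@[simp] lemma linPart_X (i : σ) : linPart b (MvPolynomial.X i) = b i := by
  classical
  rw [linPart_apply, Finset.sum_eq_single i]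
  · simp
  · intro j _ hj
    simp [pderiv_X_of_ne hj.symm]
  · simp

lemma linPart_mul (s t : MvPolynomial σ K) :
    linPart b (s * t) = aug σ K s • linPart b t + aug σ K t • linPart b s := by
  simp only [linPart_apply, Derivation.leibniz, map_add, smul_eq_mul, aug_mul, add_smul,
    Finset.sum_add_distrib, Finset.smul_sum, smul_smul]

@[simp] lemma linPart_lin (x : X) : linPart b (lin b x) = x := by
  have : linPart b ∘ₗ lin b = LinearMap.id := b.ext fun i => by simp
  exact LinearMap.congr_fun this x

/-- The derivation of the polynomial algebra extending an endomorphism of the linear forms. -/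
noncomputable def der (f : X →ₗ[K] X) :
    Derivation K (MvPolynomial σ K) (MvPolynomial σ K) :=
  mkDerivation K fun i => lin b (f (b i))

end

@[simp] lemma der_X (f : X →ₗ[K] X) (i : σ) :
    der b f (MvPolynomial.X i) = lin b (f (b i)) := mkDerivation_X K _ i

@[simp] lemma der_lin (f : X →ₗ[K] X) (x : X) : der b f (lin b x) = lin b (f x) := by
  have : (der b f).toLinearMap ∘ₗ lin b = lin b ∘ₗ f := b.ext fun i => by simp
  exact LinearMap.congr_fun this x

@[simp] lemma der_one (f : X →ₗ[K] X) : der b f 1 = 0 := (der b f).map_one_eq_zero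

lemma der_add (f g : X →ₗ[K] X) (s : MvPolynomial σ K) :
    der b (f + g) s = der b f s + der b g s := by
  have : der b (f + g) = der b f + der b g := derivation_ext fun i => by simp
  rw [this]; rfl

lemma der_smul (c : K) (f : X →ₗ[K] X) (s : MvPolynomial σ K) :
    der b (c • f) s = c • der b f s := by
  have : der b (c • f) = c • der b f := derivation_ext fun i => by simp
  rw [this]; rfl

lemma der_commutator (f g : X →ₗ[K] X) (s : MvPolynomial σ K) :
    der b (f ∘ₗ g - g ∘ₗ f) s = der b f (der b g s) - der b g (der b f s) := by
  have : der b (f ∘ₗ g - g ∘ₗ f) = ⁅der b f, der b g⁆ :=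
    derivation_ext fun i => by simp [Derivation.commutator_apply]
  rw [this, Derivation.commutator_apply]

@[simp] lemma aug_der (f : X →ₗ[K] X) (s : MvPolynomial σ K) : aug σ K (der b f s) = 0 := by
  induction s using MvPolynomial.induction_on with
  | C a => simp
  | add p q hp hq => simp [hp, hq]
  | mul_X p i hp => simp [hp]

section

variable [Fintype σ]

lemma linPart_der (f : X →ₗ[K] X) (s : MvPolynomial σ K) :
    linPart b (der b f s) = f (linPart b s) := by
  induction s using MvPolynomial.induction_on with
  | C a => simp
  | add p q hp hq => simp [hp, hq]
  | mul_X p i hp => simp [hp, linPart_mul]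

end

/-- The coproduct of the polynomial algebra making linear forms primitive. -/
noncomputable def coprod (σ K : Type) [Field K] :
    MvPolynomial σ K →ₐ[K] MvPolynomial σ K ⊗[K] MvPolynomial σ K :=
  aeval fun i => MvPolynomial.X i ⊗ₜ 1 + 1 ⊗ₜ MvPolynomial.X i

@[simp] lemma coprod_X (i : σ) : coprod σ K (MvPolynomial.X i) =
    MvPolynomial.X i ⊗ₜ 1 + 1 ⊗ₜ MvPolynomial.X i := by simp [coprod]

lemma coprod_lin (x : X) : coprod σ K (lin b x) = lin b x ⊗ₜ 1 + 1 ⊗ₜ lin b x := by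
  have : (coprod σ K).toLinearMap ∘ₗ lin b =
      (TensorProduct.mk K _ _).flip 1 ∘ₗ lin b + TensorProduct.mk K _ _ 1 ∘ₗ lin b :=
    b.ext fun i => by simp
  exact LinearMap.congr_fun this x

/-- `a ⊗ b ↦ ε(a) b`. -/
noncomputable def counitL (σ K : Type) [Field K] :
    MvPolynomial σ K ⊗[K] MvPolynomial σ K →ₗ[K] MvPolynomial σ K :=
  TensorProduct.lift (LinearMap.lsmul K _ ∘ₗ aug σ K)

/-- `a ⊗ b ↦ ε(b) a`. -/
noncomputable def counitR (σ K : Type) [Field K] :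
    MvPolynomial σ K ⊗[K] MvPolynomial σ K →ₗ[K] MvPolynomial σ K :=
  TensorProduct.lift (LinearMap.lsmul K _ ∘ₗ aug σ K).flip

@[simp] lemma counitL_tmul (s t : MvPolynomial σ K) :
    counitL σ K (s ⊗ₜ t) = aug σ K s • t := by simp [counitL]
@[simp] lemma counitR_tmul (s t : MvPolynomial σ K) :
    counitR σ K (s ⊗ₜ t) = aug σ K t • s := by simp [counitR]

lemma counitL_mul (u v : MvPolynomial σ K ⊗[K] MvPolynomial σ K) :
    counitL σ K (u * v) = counitL σ K u * counitL σ K v := by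
  induction u using TensorProduct.induction_on with
  | zero => simp
  | add x y hx hy => simp [add_mul, hx, hy]
  | tmul a c =>
    induction v using TensorProduct.induction_on with
    | zero => simp
    | add x y hx hy => simp [mul_add, hx, hy]
    | tmul a' c' => simp [mul_smul]; rw [smul_comm]

lemma counitR_mul (u v : MvPolynomial σ K ⊗[K] MvPolynomial σ K) :
    counitR σ K (u * v) = counitR σ K u * counitR σ K v := by
  induction u using TensorProduct.induction_on with
  | zero => simp
  | add x y hx hy => simp [add_mul, hx, hy]
  | tmul a c =>
    induction v using TensorProduct.induction_on with
    | zero => simp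
    | add x y hx hy => simp [mul_add, hx, hy]
    | tmul a' c' => simp [mul_smul]; rw [smul_comm]

@[simp] lemma counitL_coprod (s : MvPolynomial σ K) : counitL σ K (coprod σ K s) = s := by
  induction s using MvPolynomial.induction_on with
  | C a => simp [Algebra.TensorProduct.one_def, C_eq_smul_one]
  | add p q hp hq => simp [hp, hq]
  | mul_X p i hp => simp [hp, counitL_mul]

@[simp] lemma counitR_coprod (s : MvPolynomial σ K) : counitR σ K (coprod σ K s) = s := by
  induction s using MvPolynomial.induction_on with
  | C a => simp [Algebra.TensorProduct.one_def, C_eq_smul_one]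
  | add p q hp hq => simp [hp, hq]
  | mul_X p i hp => simp [hp, counitR_mul]

lemma comm_coprod (s : MvPolynomial σ K) :
    TensorProduct.comm K _ _ (coprod σ K s) = coprod σ K s := by
  have : (Algebra.TensorProduct.comm K (MvPolynomial σ K) (MvPolynomial σ K)).toAlgHom.comp
      (coprod σ K) = coprod σ K := by
    ext i
    simp [add_comm]
  exact DFunLike.congr_fun this s

/-- The extension of the derivation `der b f` to the tensor square. -/
noncomputable def der₂ (f : X →ₗ[K] X) :
    MvPolynomial σ K ⊗[K] MvPolynomial σ K →ₗ[K] MvPolynomial σ K ⊗[K] MvPolynomial σ K :=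
  TensorProduct.map (der b f).toLinearMap LinearMap.id +
    TensorProduct.map LinearMap.id (der b f).toLinearMap

@[simp] lemma der₂_tmul (f : X →ₗ[K] X) (s t : MvPolynomial σ K) :
    der₂ b f (s ⊗ₜ t) = der b f s ⊗ₜ t + s ⊗ₜ der b f t := by simp [der₂]

lemma der₂_mul (f : X →ₗ[K] X) (u v : MvPolynomial σ K ⊗[K] MvPolynomial σ K) :
    der₂ b f (u * v) = der₂ b f u * v + u * der₂ b f v := by
  induction u using TensorProduct.induction_on with
  | zero => simp
  | add x y hx hy => simp only [add_mul, map_add, hx, hy]; abel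
  | tmul a c =>
    induction v using TensorProduct.induction_on with
    | zero => simp
    | add x y hx hy => simp only [mul_add, map_add, hx, hy]; abel
    | tmul a' c' =>
      simp [TensorProduct.tmul_add, TensorProduct.add_tmul, mul_add, mul_comm]
      abel

lemma coprod_der (f : X →ₗ[K] X) (s : MvPolynomial σ K) :
    coprod σ K (der b f s) = der₂ b f (coprod σ K s) := by
  induction s using MvPolynomial.induction_on with
  | C a => simp
  | add p q hp hq => simp [hp, hq]
  | mul_X p i hp =>
    simp only [Derivation.leibniz, map_add, smul_eq_mul, map_mul, hp, der₂_mul, coprod_X, der_X,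
      coprod_lin, der₂_tmul, der_one, TensorProduct.tmul_zero, TensorProduct.zero_tmul, add_zero,
      zero_add]
    ring

section

variable [Fintype σ]

/-- `a ⊗ c ↦ f(linear part of a) * c`. -/
noncomputable def contract (f : X →ₗ[K] X) :
    MvPolynomial σ K ⊗[K] MvPolynomial σ K →ₗ[K] MvPolynomial σ K :=
  TensorProduct.lift (LinearMap.mul K _ ∘ₗ lin b ∘ₗ f ∘ₗ linPart b)

@[simp] lemma contract_tmul (f : X →ₗ[K] X) (s t : MvPolynomial σ K) :
    contract b f (s ⊗ₜ t) = lin b (f (linPart b s)) * t := by simp [contract]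

lemma contract_coprod (f : X →ₗ[K] X) (s : MvPolynomial σ K) :
    contract b f (coprod σ K s) = der b f s := by
  have key : ∀ (u : MvPolynomial σ K ⊗[K] MvPolynomial σ K) (i : σ),
      contract b f (u * (MvPolynomial.X i ⊗ₜ 1 + 1 ⊗ₜ MvPolynomial.X i)) =
        counitL σ K u * lin b (f (b i)) + MvPolynomial.X i * contract b f u := by
    intro u i
    induction u using TensorProduct.induction_on with
    | zero => simp
    | add x y hx hy => rw [add_mul, map_add, hx, hy]; simp only [map_add]; ring
    | tmul a c => simp [mul_add, linPart_mul, smul_eq_C_mul]; ring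
  induction s using MvPolynomial.induction_on with
  | C a => simp
  | add p q hp hq => simp [hp, hq]
  | mul_X p i hp => simp [hp, key]

/-- `a ⊗ c ↦ Δ(a) (1 ⊗ f(linear part of c))`. -/
noncomputable def spread (f : X →ₗ[K] X) :
    MvPolynomial σ K ⊗[K] MvPolynomial σ K →ₗ[K] MvPolynomial σ K ⊗[K] MvPolynomial σ K :=
  TensorProduct.lift ((LinearMap.mul K _ ∘ₗ (coprod σ K).toLinearMap).compl₂
    (TensorProduct.mk K _ _ 1 ∘ₗ lin b ∘ₗ f ∘ₗ linPart b))

@[simp] lemma spread_tmul (f : X →ₗ[K] X) (s t : MvPolynomial σ K) :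
    spread b f (s ⊗ₜ t) = coprod σ K s * (1 ⊗ₜ lin b (f (linPart b t))) := by simp [spread]

lemma spread_coprod (f : X →ₗ[K] X) (s : MvPolynomial σ K) :
    spread b f (coprod σ K s) =
      TensorProduct.map LinearMap.id (der b f).toLinearMap (coprod σ K s) := by
  have key : ∀ (u : MvPolynomial σ K ⊗[K] MvPolynomial σ K) (i : σ),
      spread b f (u * (MvPolynomial.X i ⊗ₜ 1 + 1 ⊗ₜ MvPolynomial.X i)) =
        coprod σ K (counitR σ K u) * (1 ⊗ₜ lin b (f (b i))) +
          spread b f u * (MvPolynomial.X i ⊗ₜ 1 + 1 ⊗ₜ MvPolynomial.X i) := by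
    intro u i
    induction u using TensorProduct.induction_on with
    | zero => simp
    | add x y hx hy => simp only [add_mul, map_add, hx, hy]; ring
    | tmul a c =>
      simp only [mul_add, Algebra.TensorProduct.tmul_mul_tmul, mul_one, map_add, spread_tmul,
        map_mul, coprod_X, linPart_mul, linPart_X, aug_X, counitR_tmul, map_smul,
        zero_smul, add_zero, TensorProduct.tmul_smul, mul_smul_comm, smul_mul_assoc]
      ring
  have key' : ∀ (u : MvPolynomial σ K ⊗[K] MvPolynomial σ K) (i : σ),
      TensorProduct.map LinearMap.id (der b f).toLinearMap
          (u * (MvPolynomial.X i ⊗ₜ 1 + 1 ⊗ₜ MvPolynomial.X i)) =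
        u * (1 ⊗ₜ lin b (f (b i))) +
          TensorProduct.map LinearMap.id (der b f).toLinearMap u *
            (MvPolynomial.X i ⊗ₜ 1 + 1 ⊗ₜ MvPolynomial.X i) := by
    intro u i
    induction u using TensorProduct.induction_on with
    | zero => simp
    | add x y hx hy => simp only [add_mul, map_add, hx, hy]; ring
    | tmul a c =>
      simp only [mul_add, Algebra.TensorProduct.tmul_mul_tmul, mul_one, map_add,
        TensorProduct.map_tmul, LinearMap.id_apply, Derivation.coeFn_coe, Derivation.leibniz,
        der_X, smul_eq_mul, TensorProduct.tmul_add]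
      rw [mul_comm (MvPolynomial.X i) (der b f c)]; abel
  induction s using MvPolynomial.induction_on with
  | C a => simp
  | add p q hp hq => simp [hp, hq]
  | mul_X p i hp => simp [hp, key, key']

/-! ### Products of linear forms -/

end

/-- The product of a multiset of vectors in the polynomial algebra. -/
noncomputable def vprod (s : Multiset X) : MvPolynomial σ K := (s.map (lin b)).prod

@[simp] lemma vprod_zero : vprod b 0 = 1 := by simp [vprod]
@[simp] lemma vprod_cons (x : X) (s : Multiset X) : vprod b (x ::ₘ s) = lin b x * vprod b s := by
  simp [vprod]

lemma coprod_vprod (s : Multiset X) : coprod σ K (vprod b s) =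
    (s.antidiagonal.map fun p => vprod b p.1 ⊗ₜ[K] vprod b p.2).sum := by
  have h : coprod σ K (vprod b s) =
      (s.map fun x => lin b x ⊗ₜ[K] (1 : MvPolynomial σ K) + 1 ⊗ₜ lin b x).prod := by
    rw [vprod, map_multiset_prod, Multiset.map_map]
    simp only [Function.comp_def, coprod_lin]
  rw [h, Multiset.prod_map_add]
  congr 1
  refine Multiset.map_congr rfl fun p _ => ?_
  have hl : (p.1.map fun x => lin b x ⊗ₜ[K] (1 : MvPolynomial σ K)).prod = vprod b p.1 ⊗ₜ 1 := by
    induction p.1 using Multiset.induction_on with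
    | empty => simp [Algebra.TensorProduct.one_def]
    | cons x s ih => simp [ih]
  have hr : (p.2.map fun x => (1 : MvPolynomial σ K) ⊗ₜ[K] lin b x).prod = 1 ⊗ₜ vprod b p.2 := by
    induction p.2 using Multiset.induction_on with
    | empty => simp [Algebra.TensorProduct.one_def]
    | cons x s ih => simp [ih]
  rw [hl, hr]
  simp

lemma aug_vprod {s : Multiset X} (hs : 0 < s.card) : aug σ K (vprod b s) = 0 := by
  induction s using Multiset.induction_on with
  | empty => simp at hs
  | cons x s ih => simp

lemma monomial_eq_vprod (m : σ →₀ ℕ) :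
    monomial m (1 : K) = vprod b (m.toMultiset.map b) := by
  rw [vprod, Multiset.map_map, monomial_eq, Finsupp.prod, C_1, one_mul]
  have h := (Finsupp.toMultiset_map m fun i => (MvPolynomial.X i : MvPolynomial σ K))
  simp only [Function.comp_def, lin_basis]
  rw [h, Finsupp.prod_toMultiset, Finsupp.prod_mapDomain_index (by simp) (by intros; rw [pow_add]),
    Finsupp.prod]

lemma vprod_isHomogeneous (s : Multiset X) : (vprod b s).IsHomogeneous s.card := by
  induction s using Multiset.induction_on with
  | empty => simpa using isHomogeneous_one σ K
  | cons x s ih =>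
    have hx : (lin b x).IsHomogeneous 1 := by
      have : lin b x ∈ homogeneousSubmodule σ K 1 := by
        rw [lin, Module.Basis.constr_apply]
        exact Submodule.sum_mem _ fun i _ => Submodule.smul_mem _ _ (isHomogeneous_X K i)
      exact this
    rw [vprod_cons, Multiset.card_cons, add_comm]
    exact hx.mul ih

lemma eq_on_vprod {M : Type} [AddCommGroup M] [Module K M] {φ ψ : MvPolynomial σ K →ₗ[K] M}
    {n : ℕ} (h : ∀ m : σ →₀ ℕ, m.degree = n → φ (monomial m 1) = ψ (monomial m 1))
    {s : Multiset X} (hs : s.card = n) : φ (vprod b s) = ψ (vprod b s) := by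
  rw [(vprod b s).as_sum, map_sum, map_sum]
  refine Finset.sum_congr rfl fun m hm => ?_
  have hdeg : m.degree = n := by
    have := vprod_isHomogeneous b s (mem_support_iff.mp hm)
    rw [← hs, ← this, Finsupp.degree_eq_weight_one]
    rfl
  have : monomial m (coeff m (vprod b s)) = coeff m (vprod b s) • monomial m (1 : K) := by
    simp [smul_monomial]
  rw [this, map_smul, map_smul, h m hdeg]

lemma ext_vprod {M : Type} [AddCommGroup M] [Module K M] {φ ψ : MvPolynomial σ K →ₗ[K] M}
    (h : ∀ s : Multiset X, φ (vprod b s) = ψ (vprod b s)) : φ = ψ := by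
  refine (basisMonomials σ K).ext fun m => ?_
  rw [coe_basisMonomials]
  show φ (monomial m 1) = ψ (monomial m 1)
  rw [monomial_eq_vprod b, h]

/-- A map on linear maps out of the polynomial algebra, whose values on products of at most `n`
vectors are determined by the values of the argument on products of less than `n` vectors, has
a fixed point. -/
lemma exists_fixed_point {M : Type} [AddCommGroup M] [Module K M]
    (Φ : (MvPolynomial σ K →ₗ[K] M) → (MvPolynomial σ K →ₗ[K] M))
    (hΦ : ∀ (n : ℕ) (φ ψ : MvPolynomial σ K →ₗ[K] M),
      (∀ s : Multiset X, s.card < n → φ (vprod b s) = ψ (vprod b s)) →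
      ∀ s : Multiset X, s.card < n + 1 → Φ φ (vprod b s) = Φ ψ (vprod b s)) :
    ∃ φ, Φ φ = φ := by
  let φ : MvPolynomial σ K →ₗ[K] M :=
    (basisMonomials σ K).constr K fun m => Φ^[m.degree + 1] 0 (monomial m 1)
  have hcard : ∀ m : σ →₀ ℕ, (m.toMultiset.map b).card = m.degree := fun m => by
    rw [Multiset.card_map, Finsupp.card_toMultiset]; rfl
  have hstep : ∀ n, ∀ s : Multiset X, s.card < n →
      Φ^[n] 0 (vprod b s) = Φ^[n + 1] 0 (vprod b s) := by
    intro n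
    induction n with
    | zero => simp
    | succ n ih =>
      rw [Function.iterate_succ_apply', Function.iterate_succ_apply' Φ (n + 1)]
      exact hΦ n _ _ ih
  have hstab : ∀ n k, ∀ s : Multiset X, s.card < n →
      Φ^[n] 0 (vprod b s) = Φ^[n + k] 0 (vprod b s) := by
    intro n k s hs
    induction k with
    | zero => rfl
    | succ k ih => rw [ih, ← add_assoc, hstep _ s (by omega)]
  have hφ : ∀ n, ∀ s : Multiset X, s.card < n → φ (vprod b s) = Φ^[n] 0 (vprod b s) := by
    intro n s hs
    refine eq_on_vprod b (n := s.card) (fun m hm => ?_) rfl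
    have : φ (monomial m 1) = Φ^[m.degree + 1] 0 (monomial m 1) := by
      have := (basisMonomials σ K).constr_basis K
        (fun m => Φ^[m.degree + 1] 0 (monomial m 1)) m
      rwa [coe_basisMonomials] at this
    rw [this, monomial_eq_vprod b]
    obtain ⟨k, rfl⟩ : ∃ k, n = m.degree + 1 + k := ⟨n - (m.degree + 1), by omega⟩
    exact hstab _ k _ (by rw [hcard]; omega)
  refine ⟨φ, ext_vprod b fun s => ?_⟩
  rw [hΦ s.card φ _ (hφ s.card) s (Nat.lt_succ_self _), ← Function.iterate_succ_apply' Φ,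
    hφ (s.card + 1) s (Nat.lt_succ_self _)]

end PolyCoalg

namespace PolyCoalg

open MvPolynomial
open scoped TensorProduct

variable {X σ : Type} [AddCommGroup X] [Module K X]

/-- The projection `s ↦ s - ε(s)` onto the augmentation ideal. -/
noncomputable def red (σ K : Type) [Field K] : MvPolynomial σ K →ₗ[K] MvPolynomial σ K :=
  LinearMap.id - (aug σ K).smulRight 1

lemma red_apply (s : MvPolynomial σ K) : red σ K s = s - aug σ K s • 1 := rfl

@[simp] lemma red_one : red σ K 1 = 0 := by simp [red_apply]
@[simp] lemma red_lin (b : Module.Basis σ K X) (x : X) : red σ K (lin b x) = lin b x := by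
  simp [red_apply]
@[simp] lemma aug_red (s : MvPolynomial σ K) : aug σ K (red σ K s) = 0 := by simp [red_apply]
lemma red_eq_self {s : MvPolynomial σ K} (hs : aug σ K s = 0) : red σ K s = s := by
  simp [red_apply, hs]
lemma red_vprod (b : Module.Basis σ K X) {s : Multiset X} (hs : 0 < s.card) :
    red σ K (vprod b s) = vprod b s := red_eq_self (aug_vprod b hs)
@[simp] lemma der_red (b : Module.Basis σ K X) (f : X →ₗ[K] X) (s : MvPolynomial σ K) :
    der b f (red σ K s) = der b f s := by simp [red_apply]
@[simp] lemma red_der (b : Module.Basis σ K X) (f : X →ₗ[K] X) (s : MvPolynomial σ K) :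
    red σ K (der b f s) = der b f s := red_eq_self (aug_der b f s)

variable (b : Module.Basis σ K X)

section

variable [Fintype σ]

@[simp] lemma linPart_red (s : MvPolynomial σ K) : linPart b (red σ K s) = linPart b s := by
  simp [red_apply]

lemma linPart_vprod {s : Multiset X} (hs : 1 < s.card) : linPart b (vprod b s) = 0 := by
  induction s using Multiset.induction_on with
  | empty => simp at hs
  | cons x s _ =>
    rw [Multiset.card_cons] at hs
    rw [vprod_cons, linPart_mul, aug_lin, zero_smul, aug_vprod b (by omega), zero_smul, add_zero]

/-- The projection of a polynomial onto its part of degree at least two. -/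
noncomputable def high : MvPolynomial σ K →ₗ[K] MvPolynomial σ K :=
  red σ K - lin b ∘ₗ linPart b

lemma high_apply (s : MvPolynomial σ K) : high b s = red σ K s - lin b (linPart b s) := rfl

@[simp] lemma high_one : high b (1 : MvPolynomial σ K) = 0 := by simp [high_apply]
@[simp] lemma high_lin (x : X) : high b (lin b x) = 0 := by simp [high_apply]
@[simp] lemma linPart_high (s : MvPolynomial σ K) : linPart b (high b s) = 0 := by
  simp [high_apply]
@[simp] lemma aug_high (s : MvPolynomial σ K) : aug σ K (high b s) = 0 := by simp [high_apply]
@[simp] lemma high_high (s : MvPolynomial σ K) : high b (high b s) = high b s := by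
  rw [high_apply b (high b s)]; simp [red_eq_self]
lemma high_vprod {s : Multiset X} (hs : 1 < s.card) : high b (vprod b s) = vprod b s := by
  rw [high_apply, red_vprod b (by omega), linPart_vprod b hs]; simp
lemma high_vprod_eq_zero {s : Multiset X} (hs : s.card ≤ 1) : high b (vprod b s) = 0 := by
  rcases Nat.le_one_iff_eq_zero_or_eq_one.mp hs with h | h
  · rw [Multiset.card_eq_zero.mp h]; simp
  · obtain ⟨x, rfl⟩ := Multiset.card_eq_one.mp h
    simp [vprod]
lemma high_der (f : X →ₗ[K] X) (s : MvPolynomial σ K) :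
    high b (der b f s) = der b f (high b s) := by
  simp [high_apply, linPart_der]

end

lemma lift_coprod_congr {M : Type} [AddCommGroup M] [Module K M]
    {β β' : MvPolynomial σ K →ₗ[K] MvPolynomial σ K →ₗ[K] M} {s : Multiset X}
    (h : ∀ u v, u + v = s → β (vprod b u) (vprod b v) = β' (vprod b u) (vprod b v)) :
    TensorProduct.lift β (coprod σ K (vprod b s)) =
      TensorProduct.lift β' (coprod σ K (vprod b s)) := by
  rw [coprod_vprod, map_multiset_sum, map_multiset_sum, Multiset.map_map, Multiset.map_map]
  congr 1
  refine Multiset.map_congr rfl fun p hp => ?_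
  simpa using h p.1 p.2 (Multiset.mem_antidiagonal.mp hp)

lemma lift_neg {P Q M : Type} [AddCommGroup P] [Module K P] [AddCommGroup Q] [Module K Q]
    [AddCommGroup M] [Module K M] (β : P →ₗ[K] Q →ₗ[K] M) (u : P ⊗[K] Q) :
    TensorProduct.lift (-β) u = -TensorProduct.lift β u := by
  induction u using TensorProduct.induction_on with
  | zero => simp
  | add x y hx hy => rw [map_add, map_add, hx, hy, neg_add]
  | tmul a c => simp

lemma lift_add {P Q M : Type} [AddCommGroup P] [Module K P] [AddCommGroup Q] [Module K Q]
    [AddCommGroup M] [Module K M] (β γ : P →ₗ[K] Q →ₗ[K] M) (u : P ⊗[K] Q) :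
    TensorProduct.lift (β + γ) u = TensorProduct.lift β u + TensorProduct.lift γ u := by
  induction u using TensorProduct.induction_on with
  | zero => simp
  | add x y hx hy => rw [map_add, map_add, map_add, hx, hy]; abel
  | tmul a c => simp

lemma lift_coprod_swap {M : Type} [AddCommGroup M] [Module K M]
    (β : MvPolynomial σ K →ₗ[K] MvPolynomial σ K →ₗ[K] M) (s : MvPolynomial σ K) :
    TensorProduct.lift β.flip (coprod σ K s) = TensorProduct.lift β (coprod σ K s) := by
  conv_rhs => rw [← comm_coprod]
  generalize coprod σ K s = u
  induction u using TensorProduct.induction_on with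
  | zero => simp
  | add x y hx hy => simp [hx, hy]
  | tmul a c => simp

lemma lift_coprod_der {M : Type} [AddCommGroup M] [Module K M]
    (β : MvPolynomial σ K →ₗ[K] MvPolynomial σ K →ₗ[K] M) (f : X →ₗ[K] X)
    (s : MvPolynomial σ K) :
    TensorProduct.lift β (coprod σ K (der b f s)) =
      TensorProduct.lift (β ∘ₗ (der b f).toLinearMap + β.compl₂ (der b f).toLinearMap)
        (coprod σ K s) := by
  rw [coprod_der]
  generalize coprod σ K s = u
  induction u using TensorProduct.induction_on with
  | zero => simp
  | add x y hx hy => simp only [map_add, hx, hy]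
  | tmul a c => simp

end PolyCoalg

/-! ### Kuranishi maps of cyclic data -/

/-- The part of the homotopy transfer structure of a quasi-cyclic DG-Lie algebra of degree two
that concerns elements of degree one: `X` is the first cohomology, `V` a space of degree one
elements containing it, `hbr` and `pbr` the bracket followed by the homotopy, respectively by
the projection to the second cohomology `W`, and `g` the cohomology of degree zero. -/
structure CyclicData (K X V W g : Type) [Field K] [AddCommGroup X] [Module K X]
    [AddCommGroup V] [Module K V] [AddCommGroup W] [Module K W] where
  inc : X →ₗ[K] V
  hbr : V →ₗ[K] V →ₗ[K] V
  pbr : V →ₗ[K] V →ₗ[K] W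
  form : V →ₗ[K] V →ₗ[K] K
  adX : g → X →ₗ[K] X
  adV : g → V →ₗ[K] V
  pair : g → W →ₗ[K] K
  form_antisymm : ∀ y z, form y z = -form z y
  form_nondeg : ∀ x, (∀ x', form (inc x) (inc x') = 0) → x = 0
  form_hbr : ∀ x y z, form (inc x) (hbr y z) = 0
  inc_ad : ∀ a x, inc (adX a x) = adV a (inc x)
  hbr_ad : ∀ a y z, adV a (hbr y z) = hbr (adV a y) z + hbr y (adV a z)
  form_ad : ∀ a y z, form (adV a y) z = -form y (adV a z)
  pair_nondeg : ∀ w, (∀ a, pair a w = 0) → w = 0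
  pair_pbr : ∀ a y z, pair a (pbr y z) = form (adV a y) z

namespace CyclicData

open PolyCoalg MvPolynomial
open scoped TensorProduct

variable {X V W g σ : Type} [AddCommGroup X] [Module K X]
  [AddCommGroup V] [Module K V] [AddCommGroup W] [Module K W]
  (D : CyclicData K X V W g) [Fintype σ] (b : Module.Basis σ K X)

lemma exists_phi : ∃ φ : MvPolynomial σ K →ₗ[K] V, φ 1 = 0 ∧
    φ = D.inc ∘ₗ linPart b +
      (2 : K)⁻¹ • TensorProduct.lift (D.hbr.compl₁₂ φ φ) ∘ₗ (coprod σ K).toLinearMap := by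
  obtain ⟨φ, hφ⟩ := exists_fixed_point b (fun φ : MvPolynomial σ K →ₗ[K] V =>
    D.inc ∘ₗ linPart b + (2 : K)⁻¹ • TensorProduct.lift
      (D.hbr.compl₁₂ (φ ∘ₗ red σ K) (φ ∘ₗ red σ K)) ∘ₗ (coprod σ K).toLinearMap) (by
    intro n φ ψ h s hs
    simp only [LinearMap.add_apply, LinearMap.smul_apply, LinearMap.comp_apply,
      AlgHom.toLinearMap_apply]
    congr 2
    refine lift_coprod_congr b fun u v huv => ?_
    subst huv
    rw [Multiset.card_add] at hs
    rcases Nat.eq_zero_or_pos u.card with hu | hu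
    · rw [Multiset.card_eq_zero.mp hu]; simp
    rcases Nat.eq_zero_or_pos v.card with hv | hv
    · rw [Multiset.card_eq_zero.mp hv]; simp
    simp [red_vprod b hu, red_vprod b hv, h u (by omega), h v (by omega)])
  have h1 : φ 1 = 0 := by rw [← hφ]; simp [Algebra.TensorProduct.one_def]
  have hred : φ ∘ₗ red σ K = φ := LinearMap.ext fun s => by simp [red_apply, h1]
  rw [hred] at hφ
  exact ⟨φ, h1, hφ.symm⟩

/-- The generating function of the Taylor coefficients `ι_p`. -/
noncomputable def phi : MvPolynomial σ K →ₗ[K] V := (D.exists_phi b).choose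

@[simp] lemma phi_one : D.phi b 1 = 0 := (D.exists_phi b).choose_spec.1

lemma phi_rec (s : MvPolynomial σ K) : D.phi b s = D.inc (linPart b s) +
    (2 : K)⁻¹ • TensorProduct.lift (D.hbr.compl₁₂ (D.phi b) (D.phi b)) (coprod σ K s) :=
  LinearMap.congr_fun (D.exists_phi b).choose_spec.2 s

@[simp] lemma phi_red (s : MvPolynomial σ K) : D.phi b (red σ K s) = D.phi b s := by
  simp [red_apply]

@[simp] lemma phi_lin (x : X) : D.phi b (lin b x) = D.inc x := by
  rw [phi_rec]; simp [coprod_lin]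

lemma form_inc_phi (x : X) (s : MvPolynomial σ K) :
    D.form (D.inc x) (D.phi b s) = D.form (D.inc x) (D.inc (linPart b s)) := by
  rw [phi_rec, map_add, map_smul, add_eq_left]
  generalize coprod σ K s = u
  induction u using TensorProduct.induction_on with
  | zero => simp
  | add y z hy hz => rw [map_add, map_add, smul_add, hy, hz, add_zero]
  | tmul y z => simp [D.form_hbr]

lemma phi_der (a : g) (s : MvPolynomial σ K) :
    D.phi b (der b (D.adX a) s) = D.adV a (D.phi b s) := by
  suffices h : D.phi b ∘ₗ (der b (D.adX a)).toLinearMap = D.adV a ∘ₗ D.phi b from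
    LinearMap.congr_fun h s
  refine ext_vprod b fun s => ?_
  induction hn : s.card using Nat.strong_induction_on generalizing s with
  | _ n ih =>
    simp only [LinearMap.comp_apply, Derivation.coeFn_coe] at ih ⊢
    rw [phi_rec, lift_coprod_der, linPart_der, D.inc_ad]
    conv_rhs => rw [phi_rec, map_add, map_smul]
    congr 2
    rw [show ∀ u : MvPolynomial σ K ⊗[K] MvPolynomial σ K, D.adV a (TensorProduct.lift
        (D.hbr.compl₁₂ (D.phi b) (D.phi b)) u) = TensorProduct.lift
        ((D.hbr.compl₁₂ (D.phi b) (D.phi b)).compr₂ (D.adV a)) u by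
      intro u; rw [TensorProduct.lift_compr₂]; rfl]
    refine lift_coprod_congr b fun u v huv => ?_
    subst huv
    rw [Multiset.card_add] at hn
    rcases Nat.eq_zero_or_pos u.card with hu | hu
    · rw [Multiset.card_eq_zero.mp hu]; simp
    rcases Nat.eq_zero_or_pos v.card with hv | hv
    · rw [Multiset.card_eq_zero.mp hv]; simp
    simp [ih u.card (by omega) u rfl, ih v.card (by omega) v rfl, D.hbr_ad]

/-- The difference of the pairings of the values of `phi` and of `F`. -/
noncomputable def defect (F : MvPolynomial σ K →ₗ[K] X) :
    MvPolynomial σ K →ₗ[K] MvPolynomial σ K →ₗ[K] K :=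
  D.form.compl₁₂ (D.phi b) (D.phi b) - D.form.compl₁₂ (D.inc ∘ₗ F) (D.inc ∘ₗ F)

lemma defect_apply (F : MvPolynomial σ K →ₗ[K] X) (s t : MvPolynomial σ K) :
    D.defect b F s t =
      D.form (D.phi b s) (D.phi b t) - D.form (D.inc (F s)) (D.inc (F t)) := rfl

/-- The correction term in the recursion defining `F`. -/
noncomputable def correction (F : MvPolynomial σ K →ₗ[K] X) (ξ : X) :
    MvPolynomial σ K →ₗ[K] K :=
  TensorProduct.lift ((D.defect b F).compl₁₂ (high b)
    (LinearMap.mulLeft K (lin b ξ) ∘ₗ red σ K)) ∘ₗ (coprod σ K).toLinearMap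

lemma correction_congr {F F' : MvPolynomial σ K →ₗ[K] X} (ξ : X) (s : Multiset X)
    (h : ∀ u, u.card < s.card → F (vprod b u) = F' (vprod b u)) :
    D.correction b F ξ (vprod b s) = D.correction b F' ξ (vprod b s) := by
  refine lift_coprod_congr b fun u v huv => ?_
  subst huv
  simp only [LinearMap.compl₁₂_apply, LinearMap.comp_apply, LinearMap.mulLeft_apply]
  rw [Multiset.card_add] at h
  rcases Nat.lt_or_ge 1 u.card with hu | hu
  · rcases Nat.eq_zero_or_pos v.card with hv | hv
    · rw [Multiset.card_eq_zero.mp hv]; simp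
    · rw [high_vprod b hu, red_vprod b hv, ← vprod_cons, defect_apply, defect_apply,
        h u (by omega), h (ξ ::ₘ v) (by rw [Multiset.card_cons]; omega)]
  · simp [high_vprod_eq_zero b hu]

lemma exists_dual [FiniteDimensional K X] (D : CyclicData K X V W g) :
    ∃ e : (X →ₗ[K] K) →ₗ[K] X, ∀ l x, D.form (D.inc (e l)) (D.inc x) = l x := by
  have hinj : Function.Injective (D.form.compl₁₂ D.inc D.inc) := by
    rw [injective_iff_map_eq_zero]
    intro x hx
    exact D.form_nondeg x fun x' => LinearMap.congr_fun hx x'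
  let E := LinearEquiv.ofInjectiveOfFinrankEq (D.form.compl₁₂ D.inc D.inc) hinj
    (Subspace.dual_finrank_eq (K := K) (V := X)).symm
  refine ⟨E.symm.toLinearMap, fun l x => ?_⟩
  exact LinearMap.congr_fun (E.apply_symm_apply l) x

lemma form_inc_injective {x y : X}
    (h : ∀ ξ, D.form (D.inc x) (D.inc ξ) = D.form (D.inc y) (D.inc ξ)) : x = y :=
  sub_eq_zero.mp (D.form_nondeg _ fun ξ => by simp [h])

lemma exists_F : ∃ F : MvPolynomial σ K →ₗ[K] X, ∀ s ξ,
    D.form (D.inc (F s)) (D.inc ξ) = D.form (D.inc (linPart b s)) (D.inc ξ) +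
      (2 : K)⁻¹ * D.correction b F ξ s := by
  have : FiniteDimensional K X := Module.Finite.of_basis b
  obtain ⟨e, he⟩ := D.exists_dual
  have hadd : ∀ (F : MvPolynomial σ K →ₗ[K] X) (ξ ξ' : X), D.correction b F (ξ + ξ') =
      D.correction b F ξ + D.correction b F ξ' := by
    intro F ξ ξ'
    refine LinearMap.ext fun s => ?_
    simp only [correction, LinearMap.comp_apply, LinearMap.add_apply]
    generalize (coprod σ K).toLinearMap s = u
    induction u using TensorProduct.induction_on with
    | zero => simp
    | add y z hy hz => rw [map_add, hy, hz, map_add, map_add]; ring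
    | tmul y z => simp [add_mul]
  have hsmul : ∀ (F : MvPolynomial σ K →ₗ[K] X) (c : K) (ξ : X), D.correction b F (c • ξ) =
      c • D.correction b F ξ := by
    intro F c ξ
    refine LinearMap.ext fun s => ?_
    simp only [correction, LinearMap.comp_apply, LinearMap.smul_apply]
    generalize (coprod σ K).toLinearMap s = u
    induction u using TensorProduct.induction_on with
    | zero => simp
    | add y z hy hz => simp only [map_add, hy, hz, smul_add]
    | tmul y z => simp
  let corr (F : MvPolynomial σ K →ₗ[K] X) : MvPolynomial σ K →ₗ[K] (X →ₗ[K] K) :=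
    LinearMap.flip
      { toFun := D.correction b F, map_add' := hadd F, map_smul' := hsmul F }
  obtain ⟨F, hF⟩ := exists_fixed_point b (fun F : MvPolynomial σ K →ₗ[K] X =>
    linPart b + (2 : K)⁻¹ • e ∘ₗ corr F) (by
    intro n F F' h s hs
    simp only [LinearMap.add_apply, LinearMap.smul_apply, LinearMap.comp_apply]
    congr 3
    ext1 ξ
    exact D.correction_congr b ξ s fun u hu => h u (by omega))
  refine ⟨F, fun s ξ => ?_⟩
  conv_lhs => rw [← hF]
  simp only [LinearMap.add_apply, LinearMap.smul_apply, LinearMap.comp_apply, map_add, map_smul,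
    he, smul_eq_mul]
  rfl

/-- The generating function of the Taylor coefficients `f_p`. -/
noncomputable def F : MvPolynomial σ K →ₗ[K] X := (D.exists_F b).choose

lemma form_F (s : MvPolynomial σ K) (ξ : X) :
    D.form (D.inc (D.F b s)) (D.inc ξ) = D.form (D.inc (linPart b s)) (D.inc ξ) +
      (2 : K)⁻¹ * D.correction b (D.F b) ξ s :=
  (D.exists_F b).choose_spec s ξ

@[simp] lemma F_one : D.F b 1 = 0 := D.form_inc_injective fun ξ => by
  rw [form_F]; simp [correction, Algebra.TensorProduct.one_def]

@[simp] lemma F_lin (x : X) : D.F b (lin b x) = x := D.form_inc_injective fun ξ => by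
  rw [form_F]; simp [correction, coprod_lin]

@[simp] lemma F_red (s : MvPolynomial σ K) : D.F b (red σ K s) = D.F b s := by
  simp [red_apply]

lemma F_der (a : g) (s : MvPolynomial σ K) :
    D.F b (der b (D.adX a) s) = D.adX a (D.F b s) := by
  suffices h : D.F b ∘ₗ (der b (D.adX a)).toLinearMap = D.adX a ∘ₗ D.F b from
    LinearMap.congr_fun h s
  refine ext_vprod b fun s => ?_
  induction hn : s.card using Nat.strong_induction_on generalizing s with
  | _ n ih =>
    simp only [LinearMap.comp_apply, Derivation.coeFn_coe] at ih ⊢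
    refine D.form_inc_injective fun ξ => ?_
    rw [form_F, D.inc_ad, D.form_ad, ← D.inc_ad, form_F, linPart_der, D.inc_ad, D.form_ad,
      ← D.inc_ad, neg_add, ← mul_neg]
    congr 2
    simp only [correction, LinearMap.comp_apply, AlgHom.toLinearMap_apply]
    rw [lift_coprod_der, ← lift_neg]
    refine lift_coprod_congr b fun u v huv => ?_
    subst huv
    rw [Multiset.card_add] at hn
    simp only [LinearMap.add_apply, LinearMap.comp_apply, LinearMap.compl₂_apply,
      LinearMap.compl₁₂_apply, LinearMap.mulLeft_apply, LinearMap.neg_apply, Derivation.coeFn_coe,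
      red_der]
    rcases Nat.lt_or_ge 1 u.card with hu | hu
    · rcases Nat.eq_zero_or_pos v.card with hv | hv
      · rw [Multiset.card_eq_zero.mp hv]; simp
      · have hinv : D.defect b (D.F b) (der b (D.adX a) (vprod b u)) (vprod b (ξ ::ₘ v)) =
            -D.defect b (D.F b) (vprod b u) (der b (D.adX a) (vprod b (ξ ::ₘ v))) := by
          simp only [defect_apply, phi_der]
          rw [ih _ (by omega) u rfl,
            ih (ξ ::ₘ v).card (by rw [Multiset.card_cons]; omega) _ rfl,
            D.inc_ad, D.inc_ad, D.form_ad, D.form_ad]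
          ring
        rw [high_der, high_vprod b hu, red_vprod b hv, ← vprod_cons, hinv]
        simp only [vprod_cons, Derivation.leibniz, der_lin, map_add, smul_eq_mul,
          mul_comm (vprod b v)]
        ring
    · simp [high_der, high_vprod_eq_zero b hu]

lemma defect_antisymm (F : MvPolynomial σ K →ₗ[K] X) (s t : MvPolynomial σ K) :
    D.defect b F s t = -D.defect b F t s := by
  rw [defect_apply, defect_apply, D.form_antisymm, D.form_antisymm (D.inc _)]
  ring

lemma defect_der (a : g) (s t : MvPolynomial σ K) :
    D.defect b (D.F b) (der b (D.adX a) s) t =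
      -D.defect b (D.F b) s (der b (D.adX a) t) := by
  simp only [defect_apply, phi_der, F_der, D.inc_ad, D.form_ad]
  ring

@[simp] lemma defect_red (s t : MvPolynomial σ K) :
    D.defect b (D.F b) (red σ K s) t = D.defect b (D.F b) s t := by
  simp [defect_apply]

lemma defect_eq_high_add (s t : MvPolynomial σ K) : D.defect b (D.F b) s t =
    D.defect b (D.F b) (high b s) t + D.defect b (D.F b) (lin b (linPart b s)) t := by
  simp [high_apply]

lemma defect_lin (x : X) (s : MvPolynomial σ K) : D.defect b (D.F b) (lin b x) s =
    -D.form (D.inc x) (D.inc (D.F b (high b s))) := by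
  simp [defect_apply, high_apply, form_inc_phi]

lemma defect_high_lin (x : X) (s : MvPolynomial σ K) :
    D.defect b (D.F b) (high b s) (lin b x) =
      -D.form (D.inc (D.F b (high b s))) (D.inc x) := by
  rw [defect_antisymm, defect_lin, high_high, D.form_antisymm, neg_neg]

lemma form_F_high [CharZero K] (s : MvPolynomial σ K) (ξ : X) :
    D.form (D.inc (D.F b (high b s))) (D.inc ξ) =
      TensorProduct.lift ((D.defect b (D.F b)).compl₁₂ (high b) (LinearMap.mulLeft K (lin b ξ)))
        (coprod σ K s) := by
  have h : ∀ u : MvPolynomial σ K ⊗[K] MvPolynomial σ K,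
      TensorProduct.lift ((D.defect b (D.F b)).compl₁₂ (high b)
        (LinearMap.mulLeft K (lin b ξ) ∘ₗ red σ K)) u =
      TensorProduct.lift ((D.defect b (D.F b)).compl₁₂ (high b)
        (LinearMap.mulLeft K (lin b ξ))) u -
      D.defect b (D.F b) (high b (counitR σ K u)) (lin b ξ) := by
    intro u
    induction u using TensorProduct.induction_on with
    | zero => simp
    | add x y hx hy => simp only [map_add, hx, hy, LinearMap.add_apply]; ring
    | tmul x y => simp [red_apply, mul_sub]
  have h1 := D.form_F b s ξ
  rw [correction, LinearMap.comp_apply, AlgHom.toLinearMap_apply, h, counitR_coprod,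
    defect_high_lin] at h1
  have h2 : D.form (D.inc (D.F b (high b s))) (D.inc ξ) =
      D.form (D.inc (D.F b s)) (D.inc ξ) - D.form (D.inc (linPart b s)) (D.inc ξ) := by
    simp [high_apply]
  rw [h1] at h2
  linear_combination 2 * h2

lemma sum_defect_high_der [CharZero K] (a : g) (s : MvPolynomial σ K) :
    TensorProduct.lift ((D.defect b (D.F b)).compl₁₂ (high b)
      (der b (D.adX a)).toLinearMap) (coprod σ K s) =
    TensorProduct.lift ((D.form.compl₁₂ D.inc D.inc).compl₁₂ (D.F b ∘ₗ high b)
      (D.adX a ∘ₗ linPart b)) (coprod σ K s) := by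
  have h : ∀ u : MvPolynomial σ K ⊗[K] MvPolynomial σ K,
      TensorProduct.lift ((D.form.compl₁₂ D.inc D.inc).compl₁₂ (D.F b ∘ₗ high b)
        (D.adX a ∘ₗ linPart b)) u =
      TensorProduct.lift ((D.defect b (D.F b)).compl₁₂ (high b) LinearMap.id)
        (spread b (D.adX a) u) := by
    intro u
    induction u using TensorProduct.induction_on with
    | zero => simp
    | add x y hx hy => simp only [map_add, hx, hy]
    | tmul x y =>
      simp only [TensorProduct.lift.tmul, LinearMap.compl₁₂_apply, LinearMap.comp_apply,
        form_F_high, spread_tmul]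
      generalize coprod σ K x = v
      induction v using TensorProduct.induction_on with
      | zero => simp
      | add x y hx hy => simp only [map_add, hx, hy, add_mul]
      | tmul x y => simp [mul_comm]
  rw [h, spread_coprod]
  generalize coprod σ K s = u
  induction u using TensorProduct.induction_on with
  | zero => simp
  | add x y hx hy => simp only [map_add, hx, hy]
  | tmul x y => simp

lemma sum_defect_der [CharZero K] (a : g) (s : MvPolynomial σ K) :
    TensorProduct.lift ((D.defect b (D.F b)).compl₂ (der b (D.adX a)).toLinearMap)
      (coprod σ K s) = 0 := by
  have h : (D.defect b (D.F b)).compl₂ (der b (D.adX a)).toLinearMap =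
      (D.defect b (D.F b)).compl₁₂ (high b) (der b (D.adX a)).toLinearMap +
      ((D.defect b (D.F b)).compl₁₂ LinearMap.id (lin b ∘ₗ D.adX a ∘ₗ linPart b)).flip := by
    refine LinearMap.ext₂ fun s t => ?_
    simp only [LinearMap.compl₂_apply, LinearMap.add_apply, LinearMap.compl₁₂_apply,
      LinearMap.flip_apply, LinearMap.comp_apply, LinearMap.id_apply, Derivation.coeFn_coe]
    rw [defect_eq_high_add, ← neg_neg (D.defect b (D.F b) (lin b _) _), ← defect_der, der_lin,
      ← defect_antisymm]
  have h' : (D.defect b (D.F b)).compl₁₂ LinearMap.id (lin b ∘ₗ D.adX a ∘ₗ linPart b) =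
      -(D.form.compl₁₂ D.inc D.inc).compl₁₂ (D.F b ∘ₗ high b) (D.adX a ∘ₗ linPart b) := by
    refine LinearMap.ext₂ fun s t => ?_
    simp only [LinearMap.neg_apply, LinearMap.compl₁₂_apply, LinearMap.comp_apply,
      LinearMap.id_apply]
    rw [defect_eq_high_add, defect_high_lin, defect_lin, high_lin]
    simp
  rw [h, lift_add, lift_coprod_swap, h', lift_neg, sum_defect_high_der, add_neg_cancel]

/-- The Kuranishi map, in terms of the Taylor coefficients `ι_p`, equals its quadratic
counterpart composed with `F`. -/
theorem pbr_phi [CharZero K] (s : MvPolynomial σ K) :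
    TensorProduct.lift (D.pbr.compl₁₂ (D.phi b) (D.phi b)) (coprod σ K s) =
      TensorProduct.lift (D.pbr.compl₁₂ (D.inc ∘ₗ D.F b) (D.inc ∘ₗ D.F b)) (coprod σ K s) := by
  rw [← sub_eq_zero]
  refine D.pair_nondeg _ fun a => ?_
  rw [← neg_eq_zero, ← D.sum_defect_der b a s]
  generalize coprod σ K s = u
  induction u using TensorProduct.induction_on with
  | zero => simp
  | add x y hx hy =>
    simp only [map_add, map_sub] at hx hy ⊢
    linear_combination hx + hy
  | tmul x y =>
    simp only [TensorProduct.lift.tmul, LinearMap.compl₁₂_apply, LinearMap.comp_apply, map_sub,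
      D.pair_pbr, LinearMap.compl₂_apply, Derivation.coeFn_coe, defect_apply, phi_der, F_der,
      D.inc_ad, D.form_ad]
    ring

end CyclicData

lemma DGLA.hom_ext {A : DGLA K} {M : Type} [AddCommGroup M] [Module K M]
    {f g : A.carrier →ₗ[K] M} (hfg : ∀ i, ∀ x ∈ A.grading i, f x = g x) : f = g := by
  have : LinearMap.eqLocus f g = ⊤ := by
    rw [← top_le_iff, ← A.internal.submodule_iSup_eq_top, iSup_le_iff]
    exact fun i x hx => hfg i x hx
  exact LinearMap.ext fun x => by
    have hx : x ∈ LinearMap.eqLocus f g := this ▸ Submodule.mem_top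
    exact hx

/-! ### Split quasi-cyclic DG-Lie algebras -/

/-- A quasi-cyclic DG-Lie algebra of degree two with a splitting as in the standing setup. -/
structure SplitQCyclic (K : Type) [Field K] where
  A : QCyclicDGLA K 2
  S : GradedSplitting A.toDGLA
  C : ContractionData A.toDGLA S
  H_neg : ∀ i : ℤ, i < 0 → S.H i = ⊥
  br_mem_H₀ : ∀ x ∈ S.H 0, ∀ y ∈ S.H 0, A.br x y ∈ S.H 0
  br_mem_H : ∀ i : ℤ, ∀ g ∈ S.H 0, ∀ x ∈ S.H i, A.br g x ∈ S.H i
  br_mem_Kc : ∀ i : ℤ, ∀ g ∈ S.H 0, ∀ x ∈ S.Kc i, A.br g x ∈ S.Kc i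
  perp : ∀ i j : ℤ, ∀ x ∈ S.H i, ∀ y ∈ S.Kc j, A.form x y = 0

namespace SplitQCyclic

variable (T : SplitQCyclic K)

/-- The underlying vector space. -/
abbrev L : Type := T.A.carrier

/-- The projection onto cohomology as a linear map. -/
def pr : T.L →ₗ[K] T.L := IsLinearMap.mk' T.C.pr T.C.pr_lin

/-- The homotopy as a linear map. -/
def h : T.L →ₗ[K] T.L := IsLinearMap.mk' T.C.h T.C.h_lin

/-- The differential as a linear map. -/
abbrev d : T.L →ₗ[K] T.L := T.A.toDGLA.dHom

/-- The bracket as a bilinear map. -/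
def br : T.L →ₗ[K] T.L →ₗ[K] T.L :=
  LinearMap.mk₂ K T.A.br (fun x y z => (T.A.br_lin₁ z).map_add x y)
    (fun c x y => (T.A.br_lin₁ y).map_smul c x) (fun x y z => (T.A.br_lin₂ x).map_add y z)
    (fun c x y => (T.A.br_lin₂ x).map_smul c y)

/-- The pairing as a bilinear map. -/
def form : T.L →ₗ[K] T.L →ₗ[K] K :=
  LinearMap.mk₂ K T.A.form (fun x y z => (T.A.form_lin₁ z).map_add x y)
    (fun c x y => (T.A.form_lin₁ y).map_smul c x) (fun x y z => (T.A.form_lin₂ x).map_add y z)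
    (fun c x y => (T.A.form_lin₂ x).map_smul c y)

lemma br_apply (x y : T.L) : T.br x y = T.A.br x y := rfl
lemma form_apply (x y : T.L) : T.form x y = T.A.form x y := rfl
lemma d_apply (x : T.L) : T.d x = T.A.d x := rfl
lemma h_apply (x : T.L) : T.h x = T.C.h x := rfl

@[simp] lemma d_d (x : T.L) : T.d (T.d x) = 0 := T.A.d_sq x

lemma d_mem {i : ℤ} {x : T.L} (hx : x ∈ T.A.grading i) : T.d x ∈ T.A.grading (i + 1) :=
  T.A.d_mem i x hx

lemma br_mem {i j : ℤ} {x y : T.L} (hx : x ∈ T.A.grading i) (hy : y ∈ T.A.grading j) :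
    T.br x y ∈ T.A.grading (i + j) := T.A.br_mem i j x hx y hy

variable {T}

lemma H_le {i : ℤ} {x : T.L} (hx : x ∈ T.S.H i) : x ∈ T.A.grading i := T.S.H_le i hx
lemma Kc_le {i : ℤ} {x : T.L} (hx : x ∈ T.S.Kc i) : x ∈ T.A.grading i := T.S.Kc_le i hx
lemma d_H {i : ℤ} {x : T.L} (hx : x ∈ T.S.H i) : T.d x = 0 := T.S.d_H i x hx
lemma pr_H {i : ℤ} {x : T.L} (hx : x ∈ T.S.H i) : T.pr x = x := T.C.pr_H i x hx
lemma pr_K {i : ℤ} {x : T.L} (hx : x ∈ T.S.Kc i) : T.pr x = 0 := T.C.pr_K i x hx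
lemma pr_dK {i : ℤ} {x : T.L} (hx : x ∈ T.S.Kc i) : T.pr (T.d x) = 0 := T.C.pr_dK i x hx
lemma h_H {i : ℤ} {x : T.L} (hx : x ∈ T.S.H i) : T.h x = 0 := T.C.h_H i x hx
lemma h_K {i : ℤ} {x : T.L} (hx : x ∈ T.S.Kc i) : T.h x = 0 := T.C.h_K i x hx
lemma h_dK {i : ℤ} {x : T.L} (hx : x ∈ T.S.Kc i) : T.h (T.d x) = -x := T.C.h_dK i x hx
lemma form_H_K {i j : ℤ} {x y : T.L} (hx : x ∈ T.S.H i) (hy : y ∈ T.S.Kc j) :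
    T.form x y = 0 := T.perp i j x hx y hy

lemma form_d {i : ℤ} {x : T.L} (hx : x ∈ T.A.grading i) (y : T.L) :
    T.form (T.d x) y = (-1 : K) ^ (i + 1) * T.form x (T.d y) := T.A.form_d i x hx y

lemma form_br (x y z : T.L) : T.form (T.br x y) z = T.form x (T.br y z) := T.A.form_cyclic x y z

lemma exists_decomp {i : ℤ} {x : T.L} (hx : x ∈ T.A.grading i) :
    ∃ a ∈ T.S.H i, ∃ k ∈ T.S.Kc (i - 1), ∃ k' ∈ T.S.Kc i, x = a + (T.d k + k') := by
  rw [← T.S.decomp i] at hx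
  obtain ⟨a, ha, y, hy, rfl⟩ := Submodule.mem_sup.mp hx
  obtain ⟨z, hz, k', hk', rfl⟩ := Submodule.mem_sup.mp hy
  obtain ⟨k, hk, rfl⟩ := Submodule.mem_map.mp hz
  exact ⟨a, ha, k, hk, k', hk', rfl⟩

lemma exists_decomp' {i : ℤ} {x : T.L} (hx : x ∈ T.A.grading i) :
    T.pr x ∈ T.S.H i ∧ T.h x ∈ T.S.Kc (i - 1) ∧ ∃ k ∈ T.S.Kc i,
      x = T.pr x - T.d (T.h x) + k := by
  obtain ⟨a, ha, k, hk, k', hk', rfl⟩ := exists_decomp hx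
  have hpr : T.pr (a + (T.d k + k')) = a := by simp [pr_H ha, pr_dK hk, pr_K hk']
  have hh : T.h (a + (T.d k + k')) = -k := by simp [h_H ha, h_dK hk, h_K hk']
  rw [hpr, hh]
  exact ⟨ha, Submodule.neg_mem _ hk, k', hk', by rw [map_neg]; abel⟩

lemma pr_mem {i : ℤ} {x : T.L} (hx : x ∈ T.A.grading i) : T.pr x ∈ T.S.H i :=
  (exists_decomp' hx).1

lemma h_mem {i : ℤ} {x : T.L} (hx : x ∈ T.A.grading i) : T.h x ∈ T.S.Kc (i - 1) :=
  (exists_decomp' hx).2.1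

lemma eq_of_d_eq_zero {i : ℤ} {x : T.L} (hx : x ∈ T.A.grading i) (h : T.d x = 0) :
    x = T.pr x - T.d (T.h x) := by
  obtain ⟨hp, -, k, hk, hxk⟩ := exists_decomp' hx
  have hk0 : k = 0 := by
    refine T.S.d_Kc_inj i k hk ?_
    have := congrArg T.d hxk
    rw [h, map_add, map_sub, d_H hp, d_d] at this
    simpa [d_apply] using this.symm
  rw [hk0, add_zero] at hxk
  exact hxk

lemma hom_ext' {M : Type} [AddCommGroup M] [Module K M] {f g : T.L →ₗ[K] M}
    (hH : ∀ i, ∀ x ∈ T.S.H i, f x = g x) (hK : ∀ i, ∀ x ∈ T.S.Kc i, f x = g x)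
    (hdK : ∀ i, ∀ x ∈ T.S.Kc i, f (T.d x) = g (T.d x)) : f = g := DGLA.hom_ext fun i x hx => by
  obtain ⟨a, ha, k, hk, k', hk', rfl⟩ := exists_decomp hx
  simp only [map_add, hH i a ha, hK i k' hk', hdK _ k hk]

@[simp] lemma pr_d (x : T.L) : T.pr (T.d x) = 0 := by
  have : T.pr ∘ₗ T.d = 0 := hom_ext' (fun i x hx => by simp [d_H hx])
    (fun i x hx => by simp [pr_dK hx]) (fun i x hx => by simp)
  exact LinearMap.congr_fun this x

lemma br_symm {x y : T.L} (hx : x ∈ T.A.grading 1) (hy : y ∈ T.A.grading 1) :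
    T.br x y = T.br y x := by
  have := T.A.skew 1 1 x hx y hy
  simpa [br_apply] using this

lemma form_antisymm {x y : T.L} (hx : x ∈ T.A.grading 1) (hy : y ∈ T.A.grading 1) :
    T.form x y = -T.form y x := by
  have := T.A.form_symm 1 1 x hx y hy
  simpa [form_apply] using this

lemma br_skew_zero {i : ℤ} {a x : T.L} (ha : a ∈ T.A.grading 0) (hx : x ∈ T.A.grading i) :
    T.br a x = -T.br x a := by
  have := T.A.skew 0 i a ha x hx
  simpa [br_apply] using this

lemma ad_br {a : T.L} (ha : a ∈ T.A.grading 0) (y z : T.L) :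
    T.br a (T.br y z) = T.br (T.br a y) z + T.br y (T.br a z) := by
  have : (T.br.compr₂ (T.br a)).flip z = (T.br.flip z) ∘ₗ T.br a + T.br.flip (T.br a z) :=
    DGLA.hom_ext fun j y hy => by
      simpa [br_apply] using T.A.jacobi 0 j a ha y hy z
  exact LinearMap.congr_fun this y

lemma d_br_zero {a : T.L} (ha : a ∈ T.S.H 0) (x : T.L) : T.d (T.br a x) = T.br a (T.d x) := by
  have := T.A.leibniz 0 a (H_le ha) x
  have hz : T.br (T.d a) x = 0 := by rw [d_H ha]; simp
  rw [d_apply, br_apply, this, zpow_zero, one_smul]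
  exact add_eq_right.mpr hz

lemma pr_ad {a : T.L} (ha : a ∈ T.S.H 0) (x : T.L) : T.pr (T.br a x) = T.br a (T.pr x) := by
  have : T.pr ∘ₗ T.br a = T.br a ∘ₗ T.pr := hom_ext'
    (fun i x hx => by
      rw [LinearMap.comp_apply, LinearMap.comp_apply, pr_H hx]
      exact pr_H (T.br_mem_H i a ha x hx))
    (fun i x hx => by
      rw [LinearMap.comp_apply, LinearMap.comp_apply, pr_K hx, map_zero]
      exact pr_K (T.br_mem_Kc i a ha x hx))
    (fun i x hx => by simp [← d_br_zero ha])
  exact LinearMap.congr_fun this x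

lemma h_ad {a : T.L} (ha : a ∈ T.S.H 0) (x : T.L) : T.h (T.br a x) = T.br a (T.h x) := by
  have : T.h ∘ₗ T.br a = T.br a ∘ₗ T.h := hom_ext'
    (fun i x hx => by
      rw [LinearMap.comp_apply, LinearMap.comp_apply, h_H hx, map_zero]
      exact h_H (T.br_mem_H i a ha x hx))
    (fun i x hx => by
      rw [LinearMap.comp_apply, LinearMap.comp_apply, h_K hx, map_zero]
      exact h_K (T.br_mem_Kc i a ha x hx))
    (fun i x hx => by
      rw [LinearMap.comp_apply, LinearMap.comp_apply, h_dK hx, ← d_br_zero ha, map_neg]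
      exact h_dK (T.br_mem_Kc i a ha x hx))
  exact LinearMap.congr_fun this x

lemma form_H_d {i : ℤ} {x : T.L} (hx : x ∈ T.S.H i) (y : T.L) : T.form x (T.d y) = 0 := by
  have := form_d (H_le hx) y
  rw [d_H hx, map_zero, LinearMap.zero_apply, eq_comm, mul_eq_zero] at this
  exact this.resolve_left (zpow_ne_zero _ (by simp))

lemma H_nondeg {i : ℤ} {x : T.L} (hx : x ∈ T.S.H i) (h : ∀ y ∈ T.S.H (2 - i), T.form x y = 0) :
    x = 0 := by
  have hb : x ∈ T.A.toDGLA.coboundaries i := by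
    refine T.A.nondeg i x ⟨H_le hx, d_H hx⟩ fun y hy => ?_
    rw [← form_apply, eq_of_d_eq_zero hy.1 hy.2, map_sub, form_H_d hx, h _ (pr_mem hy.1), sub_zero]
  obtain ⟨-, z, rfl⟩ := hb
  rw [← pr_H hx]
  exact pr_d z

lemma H_eq_bot {i : ℤ} (hi : 3 ≤ i) : T.S.H i = ⊥ := by
  rw [eq_bot_iff]
  intro x hx
  refine H_nondeg hx fun y hy => ?_
  rw [T.H_neg _ (by omega), Submodule.mem_bot] at hy
  rw [hy, map_zero]

variable (T)

/-- The first cohomology. -/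
abbrev X : Type := ↥(T.S.H 1)

/-- The degree one part of the truncation of `L`. -/
abbrev V : Type := ↥(T.S.H 1 ⊔ T.S.Kc 1)

variable {T}

lemma V_le {x : T.L} (hx : x ∈ T.S.H 1 ⊔ T.S.Kc 1) : x ∈ T.A.grading 1 :=
  sup_le (T.S.H_le 1) (T.S.Kc_le 1) hx

lemma V_mem (y : T.V) : (y : T.L) ∈ T.A.grading 1 := V_le y.2

lemma V_br_mem (y z : T.V) : T.br (y : T.L) (z : T.L) ∈ T.A.grading 2 := by
  simpa using T.br_mem (V_mem y) (V_mem z)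

lemma ad_V_mem {a : T.L} (ha : a ∈ T.S.H 0) {x : T.L} (hx : x ∈ T.S.H 1 ⊔ T.S.Kc 1) :
    T.br a x ∈ T.S.H 1 ⊔ T.S.Kc 1 := by
  obtain ⟨y, hy, z, hz, rfl⟩ := Submodule.mem_sup.mp hx
  rw [map_add]
  exact Submodule.add_mem_sup (T.br_mem_H 1 a ha y hy) (T.br_mem_Kc 1 a ha z hz)

lemma form_pr {a x : T.L} (ha : a ∈ T.S.H 0) (hx : x ∈ T.A.grading 2) :
    T.form a (T.pr x) = T.form a x := by
  obtain ⟨-, -, k, hk, hxk⟩ := exists_decomp' hx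
  conv_rhs => rw [hxk, map_add, map_sub, form_H_d ha, form_H_K ha hk, sub_zero, add_zero]

instance : FiniteDimensional K T.X := by
  have := T.A.findim 1
  let f : T.X →ₗ[K] T.A.toDGLA.cohomology 1 :=
    Submodule.mkQ _ ∘ₗ Submodule.inclusion (show T.S.H 1 ≤ T.A.toDGLA.cocycles 1 from
      fun x hx => ⟨H_le hx, d_H hx⟩)
  refine FiniteDimensional.of_injective f ?_
  rw [injective_iff_map_eq_zero]
  intro x hx
  have hx' : (x : T.L) ∈ T.A.toDGLA.coboundaries 1 :=
    (Submodule.Quotient.mk_eq_zero ((T.A.toDGLA.coboundaries 1).comap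
      (T.A.toDGLA.cocycles 1).subtype)).mp hx
  obtain ⟨-, z, hz⟩ := hx'
  refine Subtype.ext ?_
  rw [← pr_H x.2, ← hz]
  exact pr_d z

variable (T)

/-- The cyclic data attached to a split quasi-cyclic DG-Lie algebra. -/
def cyclicData : CyclicData K T.X T.V ↥(T.S.H 2) ↥(T.S.H 0) where
  inc := Submodule.inclusion le_sup_left
  hbr := LinearMap.mk₂ K
    (fun y z => ⟨T.h (T.br y z), Submodule.mem_sup_right (by simpa using h_mem (V_br_mem y z))⟩)
    (fun x y z => Subtype.ext (by simp)) (fun c x y => Subtype.ext (by simp))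
    (fun x y z => Subtype.ext (by simp)) (fun c x y => Subtype.ext (by simp))
  pbr := LinearMap.mk₂ K
    (fun y z => ⟨T.pr (T.br y z), pr_mem (V_br_mem y z)⟩)
    (fun x y z => Subtype.ext (by simp)) (fun c x y => Subtype.ext (by simp))
    (fun x y z => Subtype.ext (by simp)) (fun c x y => Subtype.ext (by simp))
  form := T.form.compl₁₂ (Submodule.subtype _) (Submodule.subtype _)
  adX a := (T.br a).restrict fun x hx => T.br_mem_H 1 a a.2 x hx
  adV a := (T.br a).restrict fun x hx => ad_V_mem a.2 hx
  pair a := T.form a ∘ₗ Submodule.subtype _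
  form_antisymm y z := form_antisymm (V_mem y) (V_mem z)
  form_nondeg x hx := Subtype.ext (H_nondeg x.2 fun y hy => hx ⟨y, hy⟩)
  form_hbr x y z := form_H_K x.2 (h_mem (V_br_mem y z))
  inc_ad a x := rfl
  hbr_ad a y z := Subtype.ext <| by
    simp [← h_ad a.2, ad_br (H_le a.2), LinearMap.restrict_apply]
  form_ad a y z := by
    simp only [LinearMap.compl₁₂_apply, Submodule.subtype_apply, LinearMap.coe_restrict_apply]
    rw [form_br, br_symm (V_mem y) (V_mem z), ← form_br,
      form_antisymm (V_le (ad_V_mem a.2 z.2)) (V_mem y)]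
  pair_nondeg w hw := Subtype.ext <| H_nondeg w.2 fun y hy => by
    have := T.A.form_symm 2 0 w (H_le w.2) y (H_le hy)
    rw [form_apply, this]
    simpa [form_apply] using hw ⟨y, hy⟩
  pair_pbr a y z := by
    simp only [LinearMap.compl₁₂_apply, Submodule.subtype_apply, LinearMap.coe_restrict_apply,
      LinearMap.comp_apply, LinearMap.mk₂_apply]
    rw [form_pr a.2 (V_br_mem y z), form_br]

end SplitQCyclic

/-! ### Sums over shuffles -/

section Shuffles

lemma prod_lower {M : Type} [CommMonoid M] {n k : ℕ} (e : Fin k → Fin n)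
    (he : ∀ i, (e i : ℕ) = i) (g : Fin n → M) :
    ∏ i, g (e i) = ∏ i ∈ Finset.univ.filter (fun i : Fin n => (i : ℕ) < k), g i := by
  refine Finset.prod_nbij e (fun i _ => by simp [he]) (fun i _ j _ hij => ?_)
    (fun i hi => ?_) fun _ _ => rfl
  · exact Fin.ext (by rw [← he i, ← he j, hij])
  · have hi' : (i : ℕ) < k := by simpa using hi
    exact ⟨⟨i, hi'⟩, by simp, Fin.ext (he _)⟩

lemma prod_upper {M : Type} [CommMonoid M] {n k : ℕ} (e : Fin (n - k) → Fin n)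
    (he : ∀ i, (e i : ℕ) = k + i) (g : Fin n → M) :
    ∏ i, g (e i) = ∏ i ∈ Finset.univ.filter (fun i : Fin n => k ≤ (i : ℕ)), g i := by
  refine Finset.prod_nbij e (fun i _ => by simp [he]) (fun i _ j _ hij => ?_)
    (fun i hi => ?_) fun _ _ => rfl
  · exact Fin.ext (by have := congrArg Fin.val hij; rw [he, he] at this; omega)
  · have hi' : k ≤ (i : ℕ) := by simpa using hi
    exact ⟨⟨i - k, by have := i.2; omega⟩, by simp, Fin.ext (by rw [he]; simp; omega)⟩

/-- The image of the first `k` indices under a permutation. -/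
def lowerImage {n : ℕ} (k : ℕ) (σ : Equiv.Perm (Fin n)) : Finset (Fin n) :=
  (Finset.univ.filter fun i : Fin n => (i : ℕ) < k).map σ.toEmbedding

lemma card_lower {n k : ℕ} (hk : k ≤ n) :
    (Finset.univ.filter fun i : Fin n => (i : ℕ) < k).card = k := by
  have := prod_lower (M := Multiplicative ℕ) (Fin.castLE hk) (fun _ => rfl)
    (fun _ => Multiplicative.ofAdd 1)
  simpa [Finset.prod_const, ← ofAdd_nsmul] using this.symm

lemma compl_lowerImage {n : ℕ} (k : ℕ) (σ : Equiv.Perm (Fin n)) :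
    (lowerImage k σ)ᶜ = (Finset.univ.filter fun i : Fin n => k ≤ (i : ℕ)).map σ.toEmbedding := by
  ext i
  simp [lowerImage]

lemma mem_shuffles {n k : ℕ} {σ : Equiv.Perm (Fin n)} : σ ∈ shuffles n k ↔
    ∀ i j : Fin n, i < j → ((j : ℕ) < k ∨ k ≤ (i : ℕ)) → σ i < σ j := by
  simp [shuffles]

lemma shuffle_eq_orderEmb {n k : ℕ} (hk : k ≤ n) {σ : Equiv.Perm (Fin n)}
    (hσ : σ ∈ shuffles n k) (hA : (lowerImage k σ).card = k)
    (hB : (lowerImage k σ)ᶜ.card = n - k) (i : Fin n) :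
    σ i = if h : (i : ℕ) < k then (lowerImage k σ).orderEmbOfFin hA ⟨i, h⟩ else
      (lowerImage k σ)ᶜ.orderEmbOfFin hB ⟨i - k, by have := i.2; omega⟩ := by
  rw [mem_shuffles] at hσ
  split_ifs with h
  · have := Finset.orderEmbOfFin_unique hA (f := fun j : Fin k => σ (Fin.castLE hk j))
      (fun j => by simp [lowerImage]) (fun j j' hj => hσ _ _ hj (Or.inl j'.2))
    exact congrFun this ⟨i, h⟩
  · have := Finset.orderEmbOfFin_unique hB
      (f := fun j : Fin (n - k) => σ ⟨k + j, by have := j.2; omega⟩)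
      (fun j => by rw [compl_lowerImage]; simp)
      (fun j j' hj => hσ _ _ (Nat.add_lt_add_left hj k) (Or.inr (Nat.le_add_right _ _)))
    rw [← this]
    congr 1
    exact Fin.ext (by simp; omega)

lemma sum_shuffles {M : Type} [AddCommMonoid M] {n k : ℕ} (hk : k ≤ n)
    (g : Finset (Fin n) → M) :
    ∑ σ ∈ shuffles n k, g (lowerImage k σ) =
      ∑ A ∈ Finset.powersetCard k Finset.univ, g A := by
  have hcard : ∀ σ : Equiv.Perm (Fin n), (lowerImage k σ).card = k := fun σ => by
    rw [lowerImage, Finset.card_map, card_lower hk]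
  have hcard' : ∀ σ : Equiv.Perm (Fin n), (lowerImage k σ)ᶜ.card = n - k := fun σ => by
    rw [Finset.card_compl, hcard, Fintype.card_fin]
  refine Finset.sum_bij (fun σ _ => lowerImage k σ) (fun σ _ => ?_) (fun σ hσ τ hτ h => ?_)
    (fun A hA => ?_) fun _ _ => rfl
  · simp [Finset.mem_powersetCard, hcard]
  · refine Equiv.ext fun i => ?_
    rw [shuffle_eq_orderEmb hk hσ (hcard σ) (hcard' σ),
      shuffle_eq_orderEmb hk hτ (hcard τ) (hcard' τ)]
    simp only [h]
  · have hA1 : A.card = k := (Finset.mem_powersetCard.mp hA).2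
    have hA2 : Aᶜ.card = n - k := by rw [Finset.card_compl, hA1, Fintype.card_fin]
    let e : Fin n ≃ Fin n := (finCongr (by omega : n = k + (n - k))).trans
      (finSumFinEquiv.symm.trans (finSumEquivOfFinset hA1 hA2))
    have he1 : ∀ i : Fin n, ∀ h : (i : ℕ) < k, e i = A.orderEmbOfFin hA1 ⟨i, h⟩ := by
      intro i h
      have : finCongr (by omega : n = k + (n - k)) i = Fin.castAdd (n - k) ⟨i, h⟩ := rfl
      simp only [e, Equiv.trans_apply, this, finSumFinEquiv_symm_apply_castAdd,
        finSumEquivOfFinset_inl]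
    have he2 : ∀ i : Fin n, ∀ h : k ≤ (i : ℕ), e i = Aᶜ.orderEmbOfFin hA2
        ⟨i - k, by have := i.2; omega⟩ := by
      intro i h
      have : finCongr (by omega : n = k + (n - k)) i =
          Fin.natAdd k ⟨i - k, by have := i.2; omega⟩ := Fin.ext (by simp; omega)
      simp only [e, Equiv.trans_apply, this, finSumFinEquiv_symm_apply_natAdd,
        finSumEquivOfFinset_inr]
    refine ⟨e, mem_shuffles.mpr fun i j hij h => ?_, ?_⟩
    · have hij' : (i : ℕ) < j := hij
      rcases h with h | h
      · rw [he1 i (by omega), he1 j h]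
        exact (A.orderEmbOfFin hA1).strictMono hij'
      · rw [he2 i h, he2 j (by omega)]
        exact (Aᶜ.orderEmbOfFin hA2).strictMono (show (i : ℕ) - k < j - k by omega)
    · refine Finset.eq_of_subset_of_card_le (fun x hx => ?_) (by rw [hcard, hA1])
      obtain ⟨i, hi, rfl⟩ := Finset.mem_map.mp hx
      have hi' : (i : ℕ) < k := by simpa using hi
      rw [Equiv.coe_toEmbedding, he1 i hi']
      exact Finset.orderEmbOfFin_mem _ _ _

lemma koszulSign_one {P : ℕ} (σ : Equiv.Perm (Fin P)) : koszulSign K (fun _ => 1) σ = 1 := by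
  simp [koszulSign, negOnePowK]

lemma alphaSign_one {P k : ℕ} (hk : k ≤ P) (σ : Equiv.Perm (Fin P)) :
    alphaSign K k (fun _ => 1) σ = 1 := by
  rw [alphaSign, negOnePowK]
  refine Even.neg_one_pow ?_
  rw [Int.natAbs_even]
  refine Even.mul_left ?_ _
  rw [Finset.sum_const, card_lower hk]
  exact ⟨k, by simp⟩

end Shuffles

namespace PolyCoalg

open MvPolynomial
open scoped TensorProduct

variable {X σ : Type} [AddCommGroup X] [Module K X] (b : Module.Basis σ K X)

/-- The product of a finite family of vectors in the polynomial algebra. -/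
noncomputable def vecProd {n : ℕ} (v : Fin n → X) : MvPolynomial σ K := ∏ i, lin b (v i)

lemma vecProd_eq_vprod {n : ℕ} (v : Fin n → X) :
    vecProd b v = vprod b (Finset.univ.val.map v) := by
  rw [vecProd, vprod, Multiset.map_map]; rfl

@[simp] lemma vecProd_one (v : Fin 1 → X) : vecProd b v = lin b (v 0) := by simp [vecProd]

lemma prod_lin_eq_vprod {n : ℕ} (A : Finset (Fin n)) (v : Fin n → X) :
    ∏ i ∈ A, lin b (v i) = vprod b (A.val.map v) := by
  rw [vprod, Multiset.map_map]; rfl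

lemma linPart_vecProd [Fintype σ] {n : ℕ} (hn : 1 < n) (v : Fin n → X) :
    linPart b (vecProd b v) = 0 := by
  rw [vecProd_eq_vprod]; exact linPart_vprod b (by simpa using hn)

lemma lift_coprod_vecProd {M : Type} [AddCommGroup M] [Module K M]
    (β : MvPolynomial σ K →ₗ[K] MvPolynomial σ K →ₗ[K] M) {n : ℕ} (v : Fin n → X) :
    TensorProduct.lift β (coprod σ K (vecProd b v)) = ∑ k ∈ Finset.range (n + 1),
      ∑ A ∈ Finset.powersetCard k Finset.univ,
        β (∏ i ∈ A, lin b (v i)) (∏ i ∈ Aᶜ, lin b (v i)) := by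
  classical
  have hl : ∀ A : Finset (Fin n), ∏ i ∈ A, (lin b (v i) ⊗ₜ[K] (1 : MvPolynomial σ K)) =
      (∏ i ∈ A, lin b (v i)) ⊗ₜ 1 := fun A => by
    induction A using Finset.induction_on with
    | empty => simp [Algebra.TensorProduct.one_def]
    | insert i A hi ih => simp [Finset.prod_insert hi, ih]
  have hr : ∀ A : Finset (Fin n), ∏ i ∈ A, ((1 : MvPolynomial σ K) ⊗ₜ[K] lin b (v i)) =
      1 ⊗ₜ (∏ i ∈ A, lin b (v i)) := fun A => by
    induction A using Finset.induction_on with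
    | empty => simp [Algebra.TensorProduct.one_def]
    | insert i A hi ih => simp [Finset.prod_insert hi, ih]
  rw [vecProd, map_prod]
  simp only [coprod_lin]
  rw [Finset.prod_add, Finset.sum_powerset, map_sum]
  simp only [map_sum, hl, hr, Algebra.TensorProduct.tmul_mul_tmul, mul_one, one_mul,
    TensorProduct.lift.tmul, Finset.card_univ, Fintype.card_fin, Finset.compl_eq_univ_sdiff]

lemma sum_shuffles_vecProd {M : Type} [AddCommGroup M] [Module K M]
    (β : MvPolynomial σ K →ₗ[K] MvPolynomial σ K →ₗ[K] M) {n k : ℕ} (hk : k ≤ n)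
    (v : Fin n → X) :
    ∑ τ ∈ shuffles n k,
      β (∏ i ∈ Finset.univ.filter (fun i : Fin n => (i : ℕ) < k), lin b (v (τ i)))
        (∏ i ∈ Finset.univ.filter (fun i : Fin n => k ≤ (i : ℕ)), lin b (v (τ i))) =
    ∑ A ∈ Finset.powersetCard k Finset.univ,
      β (∏ i ∈ A, lin b (v i)) (∏ i ∈ Aᶜ, lin b (v i)) := by
  rw [← sum_shuffles hk]
  refine Finset.sum_congr rfl fun τ _ => ?_
  rw [compl_lowerImage, lowerImage, Finset.prod_map, Finset.prod_map]
  rfl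

lemma sum_powersetCard_zero {M : Type} [AddCommGroup M] [Module K M]
    (β : MvPolynomial σ K →ₗ[K] MvPolynomial σ K →ₗ[K] M) {n : ℕ} (v : Fin n → X)
    (h : ∀ t, β 1 t = 0) : ∑ A ∈ Finset.powersetCard 0 Finset.univ,
      β (∏ i ∈ A, lin b (v i)) (∏ i ∈ Aᶜ, lin b (v i)) = 0 := by
  simp [h]

lemma sum_powersetCard_self {M : Type} [AddCommGroup M] [Module K M]
    (β : MvPolynomial σ K →ₗ[K] MvPolynomial σ K →ₗ[K] M) {n : ℕ} (v : Fin n → X)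
    (h : ∀ t, β t 1 = 0) : ∑ A ∈ Finset.powersetCard n Finset.univ,
      β (∏ i ∈ A, lin b (v i)) (∏ i ∈ Aᶜ, lin b (v i)) = 0 := by
  have : Finset.powersetCard n (Finset.univ : Finset (Fin n)) = {Finset.univ} := by
    simpa using Finset.powersetCard_self (Finset.univ : Finset (Fin n))
  simp [this, h]

/-- The coproduct as a sum over proper shuffles, for bilinear maps vanishing on constants. -/
lemma lift_coprod_vecProd_shuffles {M : Type} [AddCommGroup M] [Module K M]
    (β : MvPolynomial σ K →ₗ[K] MvPolynomial σ K →ₗ[K] M) {n : ℕ} (v : Fin n → X) (hn : 0 < n)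
    (hl : ∀ t, β 1 t = 0) (hr : ∀ t, β t 1 = 0) :
    TensorProduct.lift β (coprod σ K (vecProd b v)) =
      ∑ k ∈ Finset.Ioo 0 n, ∑ τ ∈ shuffles n k,
        β (∏ i ∈ Finset.univ.filter (fun i : Fin n => (i : ℕ) < k), lin b (v (τ i)))
          (∏ i ∈ Finset.univ.filter (fun i : Fin n => k ≤ (i : ℕ)), lin b (v (τ i))) := by
  rw [lift_coprod_vecProd, eq_comm]
  have hsub : Finset.Ioo 0 n ⊆ Finset.range (n + 1) := fun k hk => by
    simp only [Finset.mem_Ioo, Finset.mem_range] at hk ⊢; omega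
  rw [← Finset.sum_subset hsub]
  · refine Finset.sum_congr rfl fun k hk => ?_
    exact sum_shuffles_vecProd b β (Finset.mem_Ioo.mp hk).2.le v
  · intro k hk hk'
    simp only [Finset.mem_Ioo, Finset.mem_range] at hk hk'
    obtain rfl | rfl : k = 0 ∨ k = n := by omega
    · exact sum_powersetCard_zero b β v hl
    · exact sum_powersetCard_self b β v hr

end PolyCoalg

/-! ### Identification of the recursive families with the generating maps -/

namespace SplitQCyclic

open PolyCoalg MvPolynomial
open scoped TensorProduct

variable {T : SplitQCyclic K}

/-- The standard basis of the first cohomology. -/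
noncomputable abbrev basis (T : SplitQCyclic K) : Module.Basis (Fin (Module.finrank K T.X)) K T.X :=
  Module.finBasis K T.X

/-- The polynomial algebra on the first cohomology. -/
abbrev Poly (T : SplitQCyclic K) : Type := MvPolynomial (Fin (Module.finrank K T.X)) K

/-- The generating map of the coefficients `ι_p` in degree one. -/
noncomputable def iotaMap (T : SplitQCyclic K) : T.Poly →ₗ[K] T.L :=
  Submodule.subtype _ ∘ₗ T.cyclicData.phi T.basis

/-- The generating map of the coefficients `f_p` in degree one. -/
noncomputable def fMap (T : SplitQCyclic K) : T.Poly →ₗ[K] T.L :=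
  Submodule.subtype _ ∘ₗ T.cyclicData.F T.basis

lemma iotaMap_lin (x : T.X) : T.iotaMap (lin T.basis x) = x := by
  rw [iotaMap, LinearMap.comp_apply, CyclicData.phi_lin]; rfl

lemma fMap_lin (x : T.X) : T.fMap (lin T.basis x) = x := by
  rw [fMap, LinearMap.comp_apply, CyclicData.F_lin]; rfl

lemma iotaMap_rec (s : T.Poly) : T.iotaMap s = linPart T.basis s + (2 : K)⁻¹ •
    T.h (TensorProduct.lift (T.br.compl₁₂ T.iotaMap T.iotaMap) (coprod _ K s)) := by
  rw [iotaMap, LinearMap.comp_apply, T.cyclicData.phi_rec, map_add, map_smul]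
  congr 2
  generalize coprod _ K s = u
  induction u using TensorProduct.induction_on with
  | zero => simp
  | add y z hy hz => rw [map_add, map_add, hy, hz, map_add, map_add]
  | tmul y z => rfl

lemma pr_iotaMap [CharZero K] (s : T.Poly) :
    T.pr (TensorProduct.lift (T.br.compl₁₂ T.iotaMap T.iotaMap) (coprod _ K s)) =
      T.pr (TensorProduct.lift (T.br.compl₁₂ T.fMap T.fMap) (coprod _ K s)) := by
  have h := congrArg (Submodule.subtype _) (T.cyclicData.pbr_phi T.basis s)
  have key : ∀ Ψ : T.Poly →ₗ[K] T.V, ∀ u, (Submodule.subtype _)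
      (TensorProduct.lift (T.cyclicData.pbr.compl₁₂ Ψ Ψ) u) =
      T.pr (TensorProduct.lift (T.br.compl₁₂ (Submodule.subtype _ ∘ₗ Ψ)
        (Submodule.subtype _ ∘ₗ Ψ)) u) := by
    intro Ψ u
    induction u using TensorProduct.induction_on with
    | zero => simp
    | add y z hy hz => rw [map_add, map_add, hy, hz, map_add, map_add]
    | tmul y z => rfl
  rw [key, key] at h
  exact h

section Families

variable {g : (p : ℕ) → (Fin p → T.L) → T.L} {Φ : T.Poly →ₗ[K] T.L}

lemma eval_lower {n k : ℕ} (hg : ∀ v : Fin k → T.X, g k (fun i => v i) = Φ (vecProd T.basis v))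
    (v : Fin n → T.X) (e : Fin k → Fin n) (he : ∀ i, (e i : ℕ) = i) (τ : Equiv.Perm (Fin n)) :
    g k (fun i => v (τ (e i))) = Φ (∏ i ∈ Finset.univ.filter (fun i : Fin n => (i : ℕ) < k),
      lin T.basis (v (τ i))) := by
  rw [hg fun i => v (τ (e i)), vecProd, prod_lower e he fun i => lin T.basis (v (τ i))]

lemma eval_upper {n k : ℕ}
    (hg : ∀ v : Fin (n - k) → T.X, g (n - k) (fun i => v i) = Φ (vecProd T.basis v))
    (v : Fin n → T.X) (e : Fin (n - k) → Fin n) (he : ∀ i, (e i : ℕ) = k + i)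
    (τ : Equiv.Perm (Fin n)) :
    g (n - k) (fun i => v (τ (e i))) =
      Φ (∏ i ∈ Finset.univ.filter (fun i : Fin n => k ≤ (i : ℕ)), lin T.basis (v (τ i))) := by
  rw [hg fun i => v (τ (e i)), vecProd, prod_upper e he fun i => lin T.basis (v (τ i))]

/-- A quadratic expression in a family, summed over all proper shuffles. -/
lemma sum_shuffles_eval {n : ℕ} (hn : 0 < n) (hΦ : Φ 1 = 0)
    (hg : ∀ q, 0 < q → q < n → ∀ v : Fin q → T.X, g q (fun i => v i) = Φ (vecProd T.basis v))
    (B : T.L →ₗ[K] T.L →ₗ[K] T.L) (v : Fin n → T.X)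
    (e : ∀ k, k ∈ Finset.Ioo 0 n → Fin k → Fin n)
    (e' : ∀ k, k ∈ Finset.Ioo 0 n → Fin (n - k) → Fin n)
    (he : ∀ k hk i, (e k hk i : ℕ) = i) (he' : ∀ k hk i, (e' k hk i : ℕ) = k + i) :
    ∑ k ∈ (Finset.Ioo 0 n).attach, ∑ τ ∈ shuffles n k.1,
      B (g k.1 fun i => v (τ (e k.1 k.2 i))) (g (n - k.1) fun i => v (τ (e' k.1 k.2 i))) =
    TensorProduct.lift (B.compl₁₂ Φ Φ) (coprod _ K (vecProd T.basis v)) := by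
  rw [lift_coprod_vecProd_shuffles T.basis _ v hn (by simp [hΦ]) (by simp [hΦ]),
    ← Finset.sum_attach (Finset.Ioo 0 n)]
  refine Finset.sum_congr rfl fun k _ => Finset.sum_congr rfl fun τ _ => ?_
  have hk := Finset.mem_Ioo.mp k.2
  rw [eval_lower (hg k.1 hk.1 hk.2) v _ (he _ k.2),
    eval_upper (hg (n - k.1) (by omega) (by omega)) v _ (he' _ k.2)]
  rfl

end Families

section Transfer

variable {ι bh f : (p : ℕ) → (Fin p → T.L) → T.L}

/-- The recursive transfer sum on degree one inputs. -/
lemma transfer_sum (q : T.L →ₗ[K] T.L) (p : ℕ)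
    (hι : ∀ m, 0 < m → m < p + 2 → ∀ v : Fin m → T.X,
      ι m (fun i => v i) = T.iotaMap (vecProd T.basis v)) (v : Fin (p + 2) → T.X) :
    ∑ k ∈ Finset.Ioo 0 (p + 2), ∑ σ ∈ shuffles (p + 2) k,
      (koszulSign K (fun _ => 1) σ * alphaSign K k (fun _ => 1) σ) •
        q (T.A.br (ι k fun i => v (σ (finIdx p (i : ℕ))))
          (ι (p + 2 - k) fun i => v (σ (finIdx p (k + (i : ℕ)))))) =
    q (TensorProduct.lift (T.br.compl₁₂ T.iotaMap T.iotaMap) (coprod _ K (vecProd T.basis v))) := by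
  rw [← sum_shuffles_eval (g := ι) (Nat.succ_pos _) (by simp [iotaMap]) hι T.br v
    (fun k _ i => finIdx p i) (fun k _ i => finIdx p (k + i)) (fun k hk i => ?_)
    (fun k hk i => ?_), ← Finset.sum_attach (Finset.Ioo 0 (p + 2)), map_sum]
  · refine Finset.sum_congr rfl fun k _ => ?_
    rw [map_sum]
    refine Finset.sum_congr rfl fun σ _ => ?_
    rw [koszulSign_one, alphaSign_one (Finset.mem_Ioo.mp k.2).2.le, one_mul, one_smul]
    rfl
  · have := (Finset.mem_Ioo.mp hk).2
    exact Nat.mod_eq_of_lt (by have := i.2; omega)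
  · have := (Finset.mem_Ioo.mp hk).2
    exact Nat.mod_eq_of_lt (by have := i.2; omega)

theorem iota_eq (hT : IsTransfer T.A.toDGLA T.S T.C ι bh) (p : ℕ) (hp : 0 < p)
    (v : Fin p → T.X) : ι p (fun i => v i) = T.iotaMap (vecProd T.basis v) := by
  induction p using Nat.strong_induction_on with
  | _ p ih =>
    rcases p with _ | _ | p
    · omega
    · rw [hT.iota_one]
      rw [show vecProd T.basis v = lin T.basis (v 0) from vecProd_one _ v, iotaMap_lin]
    · have h := hT.iota_rec p (fun _ => 1) (fun i => v i) fun i => (v i).2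
      rw [h, iotaMap_rec, linPart_vecProd _ (by omega)]
      have := transfer_sum T.h p (fun m hm hm' v => ih m hm' hm v) v
      rw [← this]
      simp [h_apply]

theorem bracket_eq (hT : IsTransfer T.A.toDGLA T.S T.C ι bh) (p : ℕ) (v : Fin (p + 2) → T.X) :
    bh (p + 2) (fun i => v i) = (2 : K)⁻¹ • T.pr
      (TensorProduct.lift (T.br.compl₁₂ T.iotaMap T.iotaMap) (coprod _ K (vecProd T.basis v))) := by
  rw [hT.bracket_rec p (fun _ => 1) (fun i => v i) fun i => (v i).2,
    ← transfer_sum T.pr p (fun m hm _ v => iota_eq hT m hm v) v]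
  rfl

lemma snoc_coe {p : ℕ} (v : Fin p → T.X) (ξ : T.X) :
    (Fin.snoc (fun i => (v i : T.L)) (ξ : T.L) : Fin (p + 1) → T.L) =
      fun i => ((Fin.snoc v ξ : Fin (p + 1) → T.X) i : T.L) := by
  refine funext fun i => ?_
  refine Fin.lastCases ?_ (fun i => ?_) i <;> simp

lemma prod_filter_snoc_lower {p j : ℕ} (hj : j ≤ p) (v : Fin p → T.X) (ξ : T.X) :
    ∏ i ∈ Finset.univ.filter (fun i : Fin (p + 1) => (i : ℕ) < j),
      lin T.basis ((Fin.snoc v ξ : Fin (p + 1) → T.X) i) =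
    ∏ i ∈ Finset.univ.filter (fun i : Fin p => (i : ℕ) < j), lin T.basis (v i) := by
  rw [Finset.prod_filter, Fin.prod_univ_castSucc, Finset.prod_filter]
  simp [hj.not_gt]

lemma prod_filter_snoc_upper {p j : ℕ} (hj : j ≤ p) (v : Fin p → T.X) (ξ : T.X) :
    ∏ i ∈ Finset.univ.filter (fun i : Fin (p + 1) => j ≤ (i : ℕ)),
      lin T.basis ((Fin.snoc v ξ : Fin (p + 1) → T.X) i) =
    lin T.basis ξ *
      ∏ i ∈ Finset.univ.filter (fun i : Fin p => j ≤ (i : ℕ)), lin T.basis (v i) := by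
  rw [Finset.prod_filter, Fin.prod_univ_castSucc, Finset.prod_filter]
  simp [hj, mul_comm]

lemma pair_snoc {g : (p : ℕ) → (Fin p → T.L) → T.L} {Φ : T.Poly →ₗ[K] T.L} {p j : ℕ}
    (hj : j ≤ p) (hg : ∀ v : Fin j → T.X, g j (fun i => v i) = Φ (vecProd T.basis v))
    (hg' : ∀ v : Fin (p + 1 - j) → T.X,
      g (p + 1 - j) (fun i => v i) = Φ (vecProd T.basis v))
    (h : j ≤ p + 1) (v : Fin p → T.X) (ξ : T.X) :
    T.A.form (g j (tupleTake (p + 1) j h (Fin.snoc (fun i => (v i : T.L)) (ξ : T.L))))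
      (g (p + 1 - j) (tupleDrop (p + 1) j h (Fin.snoc (fun i => (v i : T.L)) (ξ : T.L)))) =
    T.form (Φ (∏ i ∈ Finset.univ.filter (fun i : Fin p => (i : ℕ) < j), lin T.basis (v i)))
      (Φ (lin T.basis ξ *
        ∏ i ∈ Finset.univ.filter (fun i : Fin p => j ≤ (i : ℕ)), lin T.basis (v i))) := by
  rw [snoc_coe, ← prod_filter_snoc_lower hj v ξ, ← prod_filter_snoc_upper hj v ξ]
  have h₁ := eval_lower hg (Fin.snoc v ξ : Fin (p + 1) → T.X) (Fin.castLE h) (fun _ => rfl) 1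
  have h₂ := eval_upper hg' (Fin.snoc v ξ : Fin (p + 1) → T.X)
    (fun i => ⟨j + i, by have := i.2; omega⟩) (fun _ => rfl) 1
  simp only [Equiv.Perm.one_apply] at h₁ h₂
  rw [← h₁, ← h₂]
  rfl

/-- The correction term of the recursion for `F` as a sum over shuffles. -/
lemma correction_vecProd {p : ℕ} (hp : 0 < p) (v : Fin p → T.X) (ξ : T.X) :
    T.cyclicData.correction T.basis (T.cyclicData.F T.basis) ξ (vecProd T.basis v) =
    ∑ j ∈ Finset.Ico 2 p, ∑ τ ∈ shuffles p j,
      T.cyclicData.defect T.basis (T.cyclicData.F T.basis)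
        (∏ i ∈ Finset.univ.filter (fun i : Fin p => (i : ℕ) < j), lin T.basis (v (τ i)))
        (lin T.basis ξ *
          ∏ i ∈ Finset.univ.filter (fun i : Fin p => j ≤ (i : ℕ)), lin T.basis (v (τ i))) := by
  rw [CyclicData.correction, LinearMap.comp_apply, AlgHom.toLinearMap_apply,
    lift_coprod_vecProd_shuffles T.basis _ v hp (by simp) (by simp), eq_comm]
  have hsub : Finset.Ico 2 p ⊆ Finset.Ioo 0 p := fun k hk => by
    simp only [Finset.mem_Ioo, Finset.mem_Ico] at hk ⊢; omega
  rw [Finset.sum_subset_zero_on_sdiff hsub _ fun j hj => ?_]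
  · intro j hj
    obtain rfl : j = 1 := by
      simp only [Finset.mem_sdiff, Finset.mem_Ioo, Finset.mem_Ico] at hj; omega
    refine Finset.sum_eq_zero fun τ _ => ?_
    have hc := card_lower (n := p) (k := 1) (by omega)
    obtain ⟨i, hi⟩ := Finset.card_eq_one.mp hc
    rw [LinearMap.compl₁₂_apply, hi, Finset.prod_singleton, high_lin, map_zero,
      LinearMap.zero_apply]
  · have hj' := Finset.mem_Ico.mp hj
    refine Finset.sum_congr rfl fun τ _ => ?_
    have hc := card_lower (n := p) (k := j) (by omega)
    have hne : (Finset.univ.filter fun i : Fin p => j ≤ (i : ℕ)).Nonempty :=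
      ⟨⟨j, by omega⟩, by simp⟩
    simp only [LinearMap.compl₁₂_apply, LinearMap.comp_apply, LinearMap.mulLeft_apply]
    congr 2
    · rw [prod_lin_eq_vprod T.basis _ fun i => v (τ i), high_vprod]
      rw [Multiset.card_map, Finset.card_val, hc]; omega
    · rw [prod_lin_eq_vprod T.basis _ fun i => v (τ i), red_vprod]
      rwa [Multiset.card_map, Finset.card_val, Finset.card_pos]

theorem f_eq [CharZero K] (hT : IsTransfer T.A.toDGLA T.S T.C ι bh) (hf : IsFFamily T.A T.S ι f)
    (p : ℕ) (hp : 0 < p) (v : Fin p → T.X) :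
    f p (fun i => v i) = T.fMap (vecProd T.basis v) := by
  induction p using Nat.strong_induction_on with
  | _ p ih =>
    obtain rfl | rfl | hp3 : p = 1 ∨ p = 2 ∨ 3 ≤ p := by omega
    · rw [hf.f_one, vecProd_one, fMap_lin]
    · rw [hf.f_two, eq_comm, fMap, LinearMap.comp_apply]
      have : T.cyclicData.F T.basis (vecProd T.basis v) = 0 :=
        T.cyclicData.form_inc_injective fun ξ => by
          rw [T.cyclicData.form_F, correction_vecProd hp]
          simp [linPart_vecProd T.basis (by omega : 1 < 2) v]
      rw [this, map_zero]
    · have hmem := hf.f_mem p hp3 (fun i => v i) fun i => (v i).2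
      suffices h : (⟨_, hmem⟩ : T.X) = T.cyclicData.F T.basis (vecProd T.basis v) from
        congrArg Subtype.val h
      refine T.cyclicData.form_inc_injective fun ξ => ?_
      rw [T.cyclicData.form_F, correction_vecProd hp, linPart_vecProd T.basis (by omega),
        map_zero, map_zero, LinearMap.zero_apply, zero_add]
      refine (hf.f_rec p hp3 (fun i => v i) (fun i => (v i).2) ξ ξ.2).trans ?_
      congr 1
      rw [← Finset.sum_attach (Finset.Ico 2 p)]
      refine Finset.sum_congr rfl fun j _ => Finset.sum_congr rfl fun τ _ => ?_
      have hj := Finset.mem_Ico.mp j.2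
      rw [Ipair, Fpair, pair_snoc (Φ := T.iotaMap) (by omega)
          (fun w => iota_eq hT _ (by omega) w) (fun w => iota_eq hT _ (by omega) w) _
          (fun i => v (τ i)) ξ,
        pair_snoc (Φ := T.fMap) (by omega) (fun w => ih _ (by omega) (by omega) w)
          (fun w => ih _ (by omega) (by omega) w) _ (fun i => v (τ i)) ξ]
      rfl

lemma le_succ_of_mem_Icc {p : ℕ} (j : {k // k ∈ Finset.Icc 1 p}) : j.1 ≤ p + 1 :=
  (Finset.mem_Icc.mp j.2).2.trans p.le_succ

theorem bracket_eq_sum [CharZero K] (hT : IsTransfer T.A.toDGLA T.S T.C ι bh)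
    (hf : IsFFamily T.A T.S ι f) (p : ℕ) (hp : 2 ≤ p) (v : Fin (p + 1) → T.L)
    (hv : ∀ i, v i ∈ T.S.H 1) :
    bh (p + 1) v = (2 : K)⁻¹ •
      ∑ j ∈ (Finset.Icc 1 p).attach, ∑ σ ∈ shuffles (p + 1) j.1,
        T.C.pr (T.A.br
          (f j.1 (tupleTake (p + 1) j.1
            (le_succ_of_mem_Icc j) (fun i => v (σ i))))
          (f (p + 1 - j.1) (tupleDrop (p + 1) j.1
            (le_succ_of_mem_Icc j) (fun i => v (σ i))))) := by
  obtain ⟨p, rfl⟩ : ∃ q, p = q + 1 := ⟨p - 1, by omega⟩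
  let w : Fin (p + 2) → T.X := fun i => ⟨v i, hv i⟩
  refine (bracket_eq hT p w).trans ?_
  have hIcc : Finset.Icc 1 (p + 1) = Finset.Ioo 0 (p + 2) := by
    ext k; simp only [Finset.mem_Icc, Finset.mem_Ioo]; omega
  rw [pr_iotaMap, ← sum_shuffles_eval (g := f) (n := p + 2) (by omega) (by simp [fMap])
    (fun q hq _ u => f_eq hT hf q hq u) T.br w
    (fun k hk => Fin.castLE (Finset.mem_Ioo.mp hk).2.le)
    (fun k hk i => ⟨k + i, by have := i.2; omega⟩) (fun _ _ _ => rfl) (fun _ _ _ => rfl), map_sum]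
  congr 1
  refine Finset.sum_bij (fun k _ => ⟨k.1, by rw [hIcc]; exact k.2⟩) (by simp)
    (fun _ _ _ _ h => Subtype.ext (congrArg Subtype.val h))
    (fun k _ => ⟨⟨k.1, by rw [← hIcc]; exact k.2⟩, Finset.mem_attach _ _, rfl⟩) fun k _ => ?_
  rw [map_sum]
  rfl

end Transfer

end SplitQCyclic

/-! ### DG-Lie algebras concentrated in degrees `0, …, 3` -/

lemma isInternal_of_proj {M N : Type} [AddCommGroup M] [Module K M] [AddCommGroup N] [Module K N]
    {G : ℤ → Submodule K M} (proj : ℤ → M →ₗ[K] N) (h_inj : ∀ i, ∀ x ∈ G i, proj i x = 0 → x = 0)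
    (h_ne : ∀ i j, i ≠ j → ∀ x ∈ G j, proj i x = 0) (htop : ⨆ i, G i = ⊤) :
    DirectSum.IsInternal G := by
  rw [DirectSum.isInternal_submodule_iff_iSupIndep_and_iSup_eq_top]
  refine ⟨fun i => ?_, htop⟩
  rw [Submodule.disjoint_def]
  intro x hx hx'
  have hle : ⨆ j, ⨆ (_ : j ≠ i), G j ≤ LinearMap.ker (proj i) :=
    iSup₂_le fun j hj y hy => h_ne i j hj.symm y hy
  exact h_inj i x hx (hle hx')

/-- The data of a DG-Lie algebra concentrated in degrees `0, …, 3` whose differential vanishes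
in degree `0`. -/
structure FourTerm (K g V W U : Type) [Field K] [AddCommGroup g] [Module K g]
    [AddCommGroup V] [Module K V] [AddCommGroup W] [Module K W]
    [AddCommGroup U] [Module K U] where
  brk : g →ₗ[K] g →ₗ[K] g
  aV : g →ₗ[K] V →ₗ[K] V
  aW : g →ₗ[K] W →ₗ[K] W
  aU : g →ₗ[K] U →ₗ[K] U
  VV : V →ₗ[K] V →ₗ[K] W
  VW : V →ₗ[K] W →ₗ[K] U
  d₁ : V →ₗ[K] W
  d₂ : W →ₗ[K] U
  brk_skew : ∀ a b, brk a b = -brk b a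
  brk_brk : ∀ a b c, brk a (brk b c) = brk (brk a b) c + brk b (brk a c)
  aV_brk : ∀ a b s, aV (brk a b) s = aV a (aV b s) - aV b (aV a s)
  aW_brk : ∀ a b w, aW (brk a b) w = aW a (aW b w) - aW b (aW a w)
  aU_brk : ∀ a b u, aU (brk a b) u = aU a (aU b u) - aU b (aU a u)
  VV_symm : ∀ s t, VV s t = VV t s
  aW_VV : ∀ a s t, aW a (VV s t) = VV (aV a s) t + VV s (aV a t)
  aU_VW : ∀ a s w, aU a (VW s w) = VW (aV a s) w + VW s (aW a w)
  d₁_aV : ∀ a s, d₁ (aV a s) = aW a (d₁ s)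
  d₂_aW : ∀ a w, d₂ (aW a w) = aU a (d₂ w)
  d₂_d₁ : ∀ s, d₂ (d₁ s) = 0
  VW_cyclic : ∀ s t r, VW s (VV t r) + VW t (VV r s) + VW r (VV s t) = 0
  d₂_VV : ∀ s t, d₂ (VV s t) = -VW t (d₁ s) - VW s (d₁ t)

namespace FourTerm

section

variable (K) (g V W U : Type) [AddCommGroup g] [Module K g]
  [AddCommGroup V] [Module K V] [AddCommGroup W] [Module K W] [AddCommGroup U] [Module K U]

/-- The grading on the underlying vector space. -/
def grading (i : ℤ) : Submodule K (g × V × W × U) where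
  carrier := {x | (i ≠ 0 → x.1 = 0) ∧ (i ≠ 1 → x.2.1 = 0) ∧ (i ≠ 2 → x.2.2.1 = 0) ∧
    (i ≠ 3 → x.2.2.2 = 0)}
  zero_mem' := by simp
  add_mem' := by
    rintro x y ⟨h0, h1, h2, h3⟩ ⟨h0', h1', h2', h3'⟩
    refine ⟨fun h => ?_, fun h => ?_, fun h => ?_, fun h => ?_⟩
    · simp [h0 h, h0' h]
    · simp [h1 h, h1' h]
    · simp [h2 h, h2' h]
    · simp [h3 h, h3' h]
  smul_mem' := by
    rintro c x ⟨h0, h1, h2, h3⟩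
    refine ⟨fun h => ?_, fun h => ?_, fun h => ?_, fun h => ?_⟩
    · simp [h0 h]
    · simp [h1 h]
    · simp [h2 h]
    · simp [h3 h]

variable {K g V W U}

lemma mem_grading {i : ℤ} {x : g × V × W × U} : x ∈ grading K g V W U i ↔
    (i ≠ 0 → x.1 = 0) ∧ (i ≠ 1 → x.2.1 = 0) ∧ (i ≠ 2 → x.2.2.1 = 0) ∧ (i ≠ 3 → x.2.2.2 = 0) :=
  Iff.rfl

lemma grading_cases {i : ℤ} {x : g × V × W × U} (hx : x ∈ grading K g V W U i) :
    (i = 0 ∧ ∃ a : g, x = (a, 0, 0, 0)) ∨ (i = 1 ∧ ∃ s : V, x = (0, s, 0, 0)) ∨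
    (i = 2 ∧ ∃ w : W, x = (0, 0, w, 0)) ∨ (i = 3 ∧ ∃ u : U, x = (0, 0, 0, u)) ∨ x = 0 := by
  obtain ⟨a, s, w, u⟩ := x
  obtain ⟨h0, h1, h2, h3⟩ := hx
  by_cases i0 : i = 0
  · subst i0
    exact Or.inl ⟨rfl, a, by simp_all⟩
  by_cases i1 : i = 1
  · subst i1
    exact Or.inr (Or.inl ⟨rfl, s, by simp_all⟩)
  by_cases i2 : i = 2
  · subst i2
    exact Or.inr (Or.inr (Or.inl ⟨rfl, w, by simp_all⟩))
  by_cases i3 : i = 3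
  · subst i3
    exact Or.inr (Or.inr (Or.inr (Or.inl ⟨rfl, u, by simp_all⟩)))
  · exact Or.inr (Or.inr (Or.inr (Or.inr (by simp_all))))

lemma mem_grading_zero (a : g) : ((a, 0, 0, 0) : g × V × W × U) ∈ grading K g V W U 0 := by
  simp [mem_grading]

lemma mem_grading_one (s : V) : ((0, s, 0, 0) : g × V × W × U) ∈ grading K g V W U 1 := by
  simp [mem_grading]

lemma mem_grading_two (w : W) : ((0, 0, w, 0) : g × V × W × U) ∈ grading K g V W U 2 := by
  simp [mem_grading]

lemma mem_grading_three (u : U) : ((0, 0, 0, u) : g × V × W × U) ∈ grading K g V W U 3 := by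
  simp [mem_grading]

lemma isInternal_grading : DirectSum.IsInternal (grading K g V W U) := by
  classical
  refine isInternal_of_proj (fun i =>
    (if i = 0 then LinearMap.id else 0 : g →ₗ[K] g).prodMap
      ((if i = 1 then LinearMap.id else 0 : V →ₗ[K] V).prodMap
        ((if i = 2 then LinearMap.id else 0 : W →ₗ[K] W).prodMap
          (if i = 3 then LinearMap.id else 0 : U →ₗ[K] U)))) ?_ ?_ ?_
  · intro i x hx
    rcases grading_cases hx with ⟨rfl, a, rfl⟩ | ⟨rfl, s, rfl⟩ | ⟨rfl, w, rfl⟩ | ⟨rfl, u, rfl⟩ | rfl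
      <;> simp
  · intro i j hij x hx
    rcases grading_cases hx with ⟨rfl, a, rfl⟩ | ⟨rfl, s, rfl⟩ | ⟨rfl, w, rfl⟩ | ⟨rfl, u, rfl⟩ | rfl
      <;> simp [hij]
  · rw [eq_top_iff]
    rintro ⟨a, s, w, u⟩ -
    have h : ((a, s, w, u) : g × V × W × U) =
        (a, 0, 0, 0) + (0, s, 0, 0) + (0, 0, w, 0) + (0, 0, 0, u) := by simp
    rw [h]
    have hle := le_iSup (grading K g V W U)
    exact add_mem (add_mem (add_mem (hle 0 (mem_grading_zero a)) (hle 1 (mem_grading_one s)))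
      (hle 2 (mem_grading_two w))) (hle 3 (mem_grading_three u))

end

variable {g V W U : Type} [AddCommGroup g] [Module K g]
  [AddCommGroup V] [Module K V] [AddCommGroup W] [Module K W] [AddCommGroup U] [Module K U]
  (D : FourTerm K g V W U)

/-- The bracket. -/
def br (x y : g × V × W × U) : g × V × W × U :=
  (D.brk x.1 y.1, D.aV x.1 y.2.1 - D.aV y.1 x.2.1,
    D.aW x.1 y.2.2.1 - D.aW y.1 x.2.2.1 + D.VV x.2.1 y.2.1,
    D.aU x.1 y.2.2.2 - D.aU y.1 x.2.2.2 + D.VW x.2.1 y.2.2.1 - D.VW y.2.1 x.2.2.1)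

/-- The differential. -/
def d (x : g × V × W × U) : g × V × W × U := (0, 0, D.d₁ x.2.1, D.d₂ x.2.2.1)

lemma br_lin_left (y : g × V × W × U) : IsLinearMap K fun x => D.br x y where
  map_add x x' := by simp only [br, Prod.ext_iff]; simp; refine ⟨?_, ?_, ?_⟩ <;> abel
  map_smul c x := by
    simp only [br, Prod.ext_iff]; simp [smul_sub, smul_add]

lemma br_lin_right (x : g × V × W × U) : IsLinearMap K (D.br x) where
  map_add y y' := by simp only [br, Prod.ext_iff]; simp; refine ⟨?_, ?_, ?_⟩ <;> abel
  map_smul c y := by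
    simp only [br, Prod.ext_iff]; simp [smul_sub, smul_add]

lemma br_skew {i j : ℤ} {x y : g × V × W × U} (hx : x ∈ grading K g V W U i)
    (hy : y ∈ grading K g V W U j) : D.br x y = -((-1 : K) ^ (i * j) • D.br y x) := by
  rcases grading_cases hx with ⟨rfl, a, rfl⟩ | ⟨rfl, s, rfl⟩ | ⟨rfl, w, rfl⟩ | ⟨rfl, u, rfl⟩ | rfl <;>
  rcases grading_cases hy with ⟨rfl, a', rfl⟩ | ⟨rfl, s', rfl⟩ | ⟨rfl, w', rfl⟩ | ⟨rfl, u', rfl⟩ |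
    rfl <;>
  simp [br] <;> first | exact D.brk_skew _ _ | exact D.VV_symm _ _

lemma br_jacobi {i j : ℤ} {x y : g × V × W × U} (hx : x ∈ grading K g V W U i)
    (hy : y ∈ grading K g V W U j) (z : g × V × W × U) :
    D.br x (D.br y z) = D.br (D.br x y) z + (-1 : K) ^ (i * j) • D.br y (D.br x z) := by
  obtain ⟨c, r, v, q⟩ := z
  have hcyc : ∀ s t r : V, D.VW s (D.VV t r) = -D.VW r (D.VV s t) - D.VW t (D.VV s r) := by
    intro s t r
    rw [D.VV_symm s r, ← sub_eq_zero, ← D.VW_cyclic s t r]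
    abel
  have hbrk : ∀ a b, D.brk (D.brk a b) c = D.brk a (D.brk b c) - D.brk b (D.brk a c) := by
    intro a b; rw [D.brk_brk a b c]; abel
  rcases grading_cases hx with ⟨rfl, a, rfl⟩ | ⟨rfl, s, rfl⟩ | ⟨rfl, w, rfl⟩ | ⟨rfl, u, rfl⟩ | rfl <;>
  rcases grading_cases hy with ⟨rfl, a', rfl⟩ | ⟨rfl, s', rfl⟩ | ⟨rfl, w', rfl⟩ | ⟨rfl, u', rfl⟩ |
    rfl <;>
  simp [br, D.aV_brk, D.aW_brk, D.aU_brk, D.aW_VV, D.aU_VW, hbrk] <;>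
  first
  | exact ⟨by rw [D.VV_symm s' (D.aV c s)]; abel, by rw [hcyc]; abel⟩
  | abel

lemma d_br {i : ℤ} {x : g × V × W × U} (hx : x ∈ grading K g V W U i) (y : g × V × W × U) :
    D.d (D.br x y) = D.br (D.d x) y + (-1 : K) ^ i • D.br x (D.d y) := by
  obtain ⟨c, r, v, q⟩ := y
  rcases grading_cases hx with ⟨rfl, a, rfl⟩ | ⟨rfl, s, rfl⟩ | ⟨rfl, w, rfl⟩ | ⟨rfl, u, rfl⟩ | rfl <;>
  simp [br, d, D.d₁_aV, D.d₂_aW, D.d₂_VV]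
  abel

lemma br_mem {i j : ℤ} {x y : g × V × W × U} (hx : x ∈ grading K g V W U i)
    (hy : y ∈ grading K g V W U j) : D.br x y ∈ grading K g V W U (i + j) := by
  rcases grading_cases hx with ⟨rfl, a, rfl⟩ | ⟨rfl, s, rfl⟩ | ⟨rfl, w, rfl⟩ | ⟨rfl, u, rfl⟩ | rfl <;>
  rcases grading_cases hy with ⟨rfl, a', rfl⟩ | ⟨rfl, s', rfl⟩ | ⟨rfl, w', rfl⟩ | ⟨rfl, u', rfl⟩ |
    rfl <;>
  simp [br, mem_grading]

lemma d_mem {i : ℤ} {x : g × V × W × U} (hx : x ∈ grading K g V W U i) :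
    D.d x ∈ grading K g V W U (i + 1) := by
  rcases grading_cases hx with ⟨rfl, a, rfl⟩ | ⟨rfl, s, rfl⟩ | ⟨rfl, w, rfl⟩ | ⟨rfl, u, rfl⟩ | rfl <;>
  simp [d, mem_grading]

/-- The associated DG-Lie algebra. -/
def toDGLA : DGLA K where
  carrier := g × V × W × U
  grading := grading K g V W U
  internal := isInternal_grading
  d := D.d
  d_lin := ⟨fun x y => by simp [d], fun c x => by simp [d]⟩
  d_mem _ _ := D.d_mem
  d_sq x := by simp [d, D.d₂_d₁]
  br := D.br
  br_lin₁ := D.br_lin_left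
  br_lin₂ := D.br_lin_right
  br_mem _ _ _ hx _ hy := D.br_mem hx hy
  skew _ _ _ hx _ hy := D.br_skew hx hy
  jacobi _ _ _ hx _ hy z := D.br_jacobi hx hy z
  leibniz _ _ hx y := D.d_br hx y

/-- Morphisms of four-term DG-Lie algebras. -/
structure Hom {g V W U g' V' W' U' : Type} [AddCommGroup g] [Module K g]
    [AddCommGroup V] [Module K V] [AddCommGroup W] [Module K W] [AddCommGroup U] [Module K U]
    [AddCommGroup g'] [Module K g'] [AddCommGroup V'] [Module K V'] [AddCommGroup W'] [Module K W']
    [AddCommGroup U'] [Module K U'] (D : FourTerm K g V W U) (D' : FourTerm K g' V' W' U') where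
  fg : g →ₗ[K] g'
  fV : V →ₗ[K] V'
  fW : W →ₗ[K] W'
  fU : U →ₗ[K] U'
  map_brk : ∀ a b, fg (D.brk a b) = D'.brk (fg a) (fg b)
  map_aV : ∀ a s, fV (D.aV a s) = D'.aV (fg a) (fV s)
  map_aW : ∀ a w, fW (D.aW a w) = D'.aW (fg a) (fW w)
  map_aU : ∀ a u, fU (D.aU a u) = D'.aU (fg a) (fU u)
  map_VV : ∀ s t, fW (D.VV s t) = D'.VV (fV s) (fV t)
  map_VW : ∀ s w, fU (D.VW s w) = D'.VW (fV s) (fW w)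
  map_d₁ : ∀ s, fW (D.d₁ s) = D'.d₁ (fV s)
  map_d₂ : ∀ w, fU (D.d₂ w) = D'.d₂ (fW w)

namespace Hom

variable {g' V' W' U' : Type} [AddCommGroup g'] [Module K g'] [AddCommGroup V'] [Module K V']
  [AddCommGroup W'] [Module K W'] [AddCommGroup U'] [Module K U']
  {D} {D' : FourTerm K g' V' W' U'} (F : Hom D D')

/-- The associated morphism of DG-Lie algebras. -/
def toDGLAHom : DGLAHom D.toDGLA D'.toDGLA where
  toFun x := (F.fg x.1, F.fV x.2.1, F.fW x.2.2.1, F.fU x.2.2.2)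
  lin := (F.fg.prodMap (F.fV.prodMap (F.fW.prodMap F.fU))).isLinear
  map_grading i (x : g × V × W × U) hx := by
    obtain ⟨h0, h1, h2, h3⟩ := hx
    exact ⟨fun h => by simp [h0 h], fun h => by simp [h1 h], fun h => by simp [h2 h],
      fun h => by simp [h3 h]⟩
  map_d (x : g × V × W × U) := by
    change (_, _, _, _) = D'.d _
    simp [toDGLA, d, F.map_d₁, F.map_d₂]
  map_br (x y : g × V × W × U) := by
    change (_, _, _, _) = D'.br _ _
    simp [toDGLA, br, F.map_brk, F.map_aV, F.map_aW, F.map_aU, F.map_VV, F.map_VW]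

lemma isQuasiIso (g_inj : ∀ a, F.fg a = 0 → a = 0) (g_surj : ∀ a', ∃ a, F.fg a = a')
    (V_inj : ∀ s, D.d₁ s = 0 → F.fV s = 0 → s = 0)
    (V_surj : ∀ s', D'.d₁ s' = 0 → ∃ s, D.d₁ s = 0 ∧ F.fV s = s')
    (W_inj : ∀ w s', D.d₂ w = 0 → D'.d₁ s' = F.fW w → ∃ s, D.d₁ s = w)
    (W_surj : ∀ w', D'.d₂ w' = 0 → ∃ w s', D.d₂ w = 0 ∧ D'.d₁ s' = F.fW w - w')
    (U_inj : ∀ u w', D'.d₂ w' = F.fU u → ∃ w, D.d₂ w = u)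
    (U_surj : ∀ u', ∃ u w', D'.d₂ w' = F.fU u - u') : F.toDGLAHom.IsQuasiIso := by
  refine fun i => ⟨?_, ?_⟩
  · rintro (x : g × V × W × U) ⟨hx, hdx⟩ ⟨-, (y : g' × V' × W' × U'), hy⟩
    refine ⟨hx, ?_⟩
    change D.d x = 0 at hdx
    change D'.d y = (F.fg x.1, F.fV x.2.1, F.fW x.2.2.1, F.fU x.2.2.2) at hy
    change ∃ z : g × V × W × U, D.d z = x
    rcases grading_cases hx with ⟨rfl, a, rfl⟩ | ⟨rfl, s, rfl⟩ | ⟨rfl, w, rfl⟩ | ⟨rfl, u, rfl⟩ | rfl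
    · simp only [d, map_zero, Prod.ext_iff] at hy
      exact ⟨0, by simp [d, g_inj a hy.1.symm]⟩
    · simp only [d, map_zero, Prod.ext_iff] at hy hdx
      exact ⟨0, by simp [d, V_inj s hdx.2.2.1 hy.2.1.symm]⟩
    · simp only [d, map_zero, Prod.ext_iff] at hy hdx
      obtain ⟨s, hs⟩ := W_inj w _ hdx.2.2.2 hy.2.2.1
      exact ⟨(0, s, 0, 0), by simp [d, hs]⟩
    · simp only [d, map_zero, Prod.ext_iff] at hy
      obtain ⟨w, hw⟩ := U_inj u _ hy.2.2.2
      exact ⟨(0, 0, w, 0), by simp [d, hw]⟩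
    · exact ⟨0, by simp [d]⟩
  · rintro (y : g' × V' × W' × U') ⟨hy, hdy⟩
    change D'.d y = 0 at hdy
    suffices h : ∃ x ∈ grading K g V W U i, D.d x = 0 ∧ ∃ z, D'.d z =
        ((F.fg x.1, F.fV x.2.1, F.fW x.2.2.1, F.fU x.2.2.2) : g' × V' × W' × U') - y by
      obtain ⟨x, hx, hdx, hz⟩ := h
      exact ⟨x, ⟨hx, hdx⟩, Submodule.sub_mem (p := grading K g' V' W' U' i)
        (F.toDGLAHom.map_grading i x hx) hy, hz⟩
    rcases grading_cases hy with ⟨rfl, a, rfl⟩ | ⟨rfl, s, rfl⟩ | ⟨rfl, w, rfl⟩ | ⟨rfl, u, rfl⟩ | rfl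
    · obtain ⟨a, rfl⟩ := g_surj a
      exact ⟨_, mem_grading_zero a, by simp [d], 0, by simp [d]⟩
    · simp only [d, map_zero, Prod.ext_iff] at hdy
      obtain ⟨s, hs, rfl⟩ := V_surj s hdy.2.2.1
      exact ⟨_, mem_grading_one s, by simp [d, hs], 0, by simp [d]⟩
    · simp only [d, map_zero, Prod.ext_iff] at hdy
      obtain ⟨w, s, hw, hs⟩ := W_surj w hdy.2.2.2
      exact ⟨_, mem_grading_two w, by simp [d, hw], (0, s, 0, 0), by simp [d, hs]⟩
    · obtain ⟨u, w, hw⟩ := U_surj u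
      exact ⟨_, mem_grading_three u, by simp [d], (0, 0, w, 0), by simp [d, hw]⟩
    · exact ⟨0, zero_mem _, by simp [d], 0, by simp [d]⟩

end Hom

end FourTerm

/-! ### Graded cocommutative coalgebras and their four-term DG-Lie algebras -/

open scoped TensorProduct in
/-- A reduced cocommutative coalgebra `P` with primitive elements `X`, with the formal properties
of the augmentation ideal of a polynomial bialgebra: `E` is the Euler operator, `m` is the
multiplication with a linear form, and `g` acts by derivations. -/
structure EulerCoalgebra (K g X P : Type) [Field K] [AddCommGroup g] [Module K g]
    [AddCommGroup X] [Module K X] [AddCommGroup P] [Module K P] where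
  Δ : P →ₗ[K] P ⊗[K] P
  p : P →ₗ[K] X
  i : X →ₗ[K] P
  m : X →ₗ[K] P →ₗ[K] P
  E : P →ₗ[K] P
  aX : g →ₗ[K] X →ₗ[K] X
  aP : g →ₗ[K] P →ₗ[K] P
  comm_Δ : ∀ s, TensorProduct.comm K P P (Δ s) = Δ s
  Δ_i : ∀ x, Δ (i x) = 0
  E_i : ∀ x, E (i x) = i x
  m_Δ : ∀ s, TensorProduct.lift (m ∘ₗ p) (Δ s) = E s - i (p s)
  Δ_m : ∀ x s, Δ (m x s) = (m x).rTensor P (Δ s) + (m x).lTensor P (Δ s) + i x ⊗ₜ s + s ⊗ₜ i x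
  Δ_E : ∀ s, Δ (E s) = E.rTensor P (Δ s) + E.lTensor P (Δ s)
  E_bij : Function.Bijective E
  E₂_bij : Function.Bijective (E.rTensor P + E.lTensor P)
  p_aP : ∀ a s, p (aP a s) = aX a (p s)
  m_aP : ∀ a x s, aP a (m x s) = m (aX a x) s + m x (aP a s)
  Δ_aP : ∀ a s, Δ (aP a s) = (aP a).rTensor P (Δ s) + (aP a).lTensor P (Δ s)
  E_aP : ∀ a s, E (aP a s) = aP a (E s)

namespace EulerCoalgebra

open scoped TensorProduct

variable {g X P : Type} [AddCommGroup g] [Module K g] [AddCommGroup X] [Module K X]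
  [AddCommGroup P] [Module K P] (D : EulerCoalgebra K g X P)

/-- The symmetrization `s ⊗ t ↦ s ⊗ t + t ⊗ s`. -/
noncomputable def sym (K P : Type) [Field K] [AddCommGroup P] [Module K P] :
    P ⊗[K] P →ₗ[K] P ⊗[K] P := LinearMap.id + (TensorProduct.comm K P P).toLinearMap

@[simp] lemma sym_tmul (s t : P) : sym K P (s ⊗ₜ t) = s ⊗ₜ t + t ⊗ₜ s := by simp [sym]

/-- An endomorphism acting as a derivation on the tensor square. -/
noncomputable def der₂ : (P →ₗ[K] P) →ₗ[K] P ⊗[K] P →ₗ[K] P ⊗[K] P :=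
  LinearMap.rTensorHom P + LinearMap.lTensorHom P

lemma der₂_apply (f : P →ₗ[K] P) (u : P ⊗[K] P) : der₂ f u = f.rTensor P u + f.lTensor P u := rfl

@[simp] lemma der₂_tmul (f : P →ₗ[K] P) (s t : P) : der₂ f (s ⊗ₜ[K] t) = f s ⊗ₜ t + s ⊗ₜ f t := by
  simp [der₂_apply]

/-- The bracket of `P` and `P ⊗ P`, with values in `P ⊗ P` before passing to the quotient. -/
noncomputable def preVW : P →ₗ[K] P ⊗[K] P →ₗ[K] P ⊗[K] P :=
  ((TensorProduct.mk K P P).compl₂ (TensorProduct.lift (D.m ∘ₗ D.p))).compr₂ (sym K P) -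
    (LinearMap.lTensorHom P ∘ₗ D.m ∘ₗ D.p).compr₂ (sym K P)

@[simp] lemma preVW_tmul (s y z : P) : D.preVW s (y ⊗ₜ z) =
    s ⊗ₜ D.m (D.p y) z + D.m (D.p y) z ⊗ₜ s - (y ⊗ₜ D.m (D.p s) z + D.m (D.p s) z ⊗ₜ y) := by
  simp [preVW]

lemma sym_lTensor_Δ (f : P →ₗ[K] P) (s : P) :
    sym K P (f.lTensor P (D.Δ s)) = der₂ f (D.Δ s) := by
  have h : ∀ u : P ⊗[K] P, sym K P (f.lTensor P u) =
      f.rTensor P (TensorProduct.comm K P P u) + f.lTensor P u := by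
    intro u
    induction u using TensorProduct.induction_on with
    | zero => simp
    | add x y hx hy => simp only [map_add, hx, hy]; abel
    | tmul a c => simp [add_comm]
  rw [h, D.comm_Δ, der₂_apply]

lemma preVW_Δ (s t : P) : D.preVW s (D.Δ t) =
    (s ⊗ₜ D.E t + D.E t ⊗ₜ s) - (s ⊗ₜ D.i (D.p t) + D.i (D.p t) ⊗ₜ s) +
      (D.i (D.p s) ⊗ₜ t + t ⊗ₜ D.i (D.p s)) - D.Δ (D.m (D.p s) t) := by
  have h : D.preVW s (D.Δ t) = sym K P (s ⊗ₜ TensorProduct.lift (D.m ∘ₗ D.p) (D.Δ t)) -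
    sym K P ((D.m (D.p s)).lTensor P (D.Δ t)) := rfl
  rw [h, D.m_Δ, D.sym_lTensor_Δ, D.Δ_m, der₂_apply, sym_tmul, TensorProduct.tmul_sub,
    TensorProduct.sub_tmul]
  abel

lemma preVW_aP (a : g) (s : P) (u : P ⊗[K] P) : der₂ (D.aP a) (D.preVW s u) =
    D.preVW (D.aP a s) u + D.preVW s (der₂ (D.aP a) u) := by
  induction u using TensorProduct.induction_on with
  | zero => simp
  | add x y hx hy => simp only [map_add, hx, hy]; abel
  | tmul y z =>
    simp only [preVW_tmul, der₂_tmul, map_add, map_sub, D.m_aP, D.p_aP, TensorProduct.tmul_add,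
      TensorProduct.add_tmul]
    abel

lemma preVW_cyclic (s t r : P) : D.preVW s (sym K P (t ⊗ₜ r)) + D.preVW t (sym K P (r ⊗ₜ s)) +
    D.preVW r (sym K P (s ⊗ₜ t)) = 0 := by
  simp only [sym_tmul, map_add, preVW_tmul]
  abel

/-- The quotient of the tensor square by the coproducts. -/
abbrev Quot : Type := (P ⊗[K] P) ⧸ LinearMap.range D.Δ

/-- The action on the quotient of the tensor square. -/
noncomputable def aQuot : g →ₗ[K] D.Quot →ₗ[K] D.Quot where
  toFun a := (LinearMap.range D.Δ).mapQ _ (der₂ (D.aP a)) (by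
    rintro _ ⟨s, rfl⟩
    exact ⟨D.aP a s, D.Δ_aP a s⟩)
  map_add' a a' := Submodule.linearMap_qext _ (LinearMap.ext fun u => by simp)
  map_smul' c a := Submodule.linearMap_qext _ (LinearMap.ext fun u => by simp)

lemma aQuot_mk (a : g) (u : P ⊗[K] P) : D.aQuot a (Submodule.Quotient.mk u) =
    Submodule.Quotient.mk (der₂ (D.aP a) u) := rfl

lemma der₂_brk {f f' f'' : P →ₗ[K] P} (hf : ∀ s, f s = f' (f'' s) - f'' (f' s)) (u : P ⊗[K] P) :
    der₂ f u = der₂ f' (der₂ f'' u) - der₂ f'' (der₂ f' u) := by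
  induction u using TensorProduct.induction_on with
  | zero => simp
  | add x y hx hy => simp only [map_add, hx, hy]; abel
  | tmul y z =>
    simp only [der₂_tmul, map_add, hf, TensorProduct.sub_tmul, TensorProduct.tmul_sub]
    abel

lemma der₂_comm {f f' : P →ₗ[K] P} (hf : ∀ s, f (f' s) = f' (f s)) (u : P ⊗[K] P) :
    der₂ f (der₂ f' u) = der₂ f' (der₂ f u) := by
  induction u using TensorProduct.induction_on with
  | zero => simp
  | add x y hx hy => simp only [map_add, hx, hy]
  | tmul y z =>
    simp only [der₂_tmul, map_add, hf]
    abel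

lemma mk_Δ (s : P) : (Submodule.Quotient.mk (D.Δ s) : D.Quot) = 0 :=
  (Submodule.Quotient.mk_eq_zero _).mpr ⟨s, rfl⟩

/-- A Lie bracket on `g` together with an equivariant linear map `κ` to a representation `Z`. -/
structure Twist (Z : Type) [AddCommGroup Z] [Module K Z] where
  brk : g →ₗ[K] g →ₗ[K] g
  aZ : g →ₗ[K] Z →ₗ[K] Z
  κ : P →ₗ[K] Z
  brk_skew : ∀ a b, brk a b = -brk b a
  brk_brk : ∀ a b c, brk a (brk b c) = brk (brk a b) c + brk b (brk a c)
  aP_brk : ∀ a b s, D.aP (brk a b) s = D.aP a (D.aP b s) - D.aP b (D.aP a s)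
  aZ_brk : ∀ a b w, aZ (brk a b) w = aZ a (aZ b w) - aZ b (aZ a w)
  κ_aP : ∀ a s, κ (D.aP a s) = aZ a (κ s)
  κ_i : ∀ x, κ (D.i x) = 0

variable {D} {Z : Type} [AddCommGroup Z] [Module K Z]

/-- The four-term DG-Lie algebra of a twisted Euler coalgebra. -/
noncomputable def Twist.fourTerm [CharZero K] (N : D.Twist Z) :
    FourTerm K g P ((P ⊗[K] P) × Z) D.Quot where
  brk := N.brk
  aV := D.aP
  aW := LinearMap.mk₂ K (fun a w => (der₂ (D.aP a) w.1, N.aZ a w.2)) (fun a a' w => by simp)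
    (fun c a w => by simp) (fun a w w' => by simp) (fun c a w => by simp)
  aU := D.aQuot
  VV := (2 : K)⁻¹ • (TensorProduct.mk K P P).compr₂ (LinearMap.inl K _ _ ∘ₗ sym K P)
  VW := D.preVW.compr₂ (LinearMap.range D.Δ).mkQ |>.compl₂ (LinearMap.fst K _ Z)
  d₁ := (-(2 : K)⁻¹ • D.Δ).prod N.κ
  d₂ := (LinearMap.range D.Δ).mkQ ∘ₗ der₂ D.E ∘ₗ LinearMap.fst K _ Z
  brk_skew := N.brk_skew
  brk_brk := N.brk_brk
  aV_brk := N.aP_brk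
  aW_brk a b w := Prod.ext (der₂_brk (N.aP_brk a b) w.1) (N.aZ_brk a b w.2)
  aU_brk a b u := by
    obtain ⟨u, rfl⟩ := Submodule.Quotient.mk_surjective _ u
    simp only [aQuot_mk, ← Submodule.Quotient.mk_sub, der₂_brk (N.aP_brk a b)]
  VV_symm s t := by simp [add_comm]
  aW_VV a s t := by
    simp only [LinearMap.mk₂_apply, LinearMap.smul_apply, LinearMap.compr₂_apply, LinearMap.comp_apply,
      TensorProduct.mk_apply, LinearMap.inl_apply, Prod.smul_mk, smul_zero, map_smul, map_zero,
      sym_tmul, map_add, der₂_tmul, Prod.mk_add_mk, add_zero, ← smul_add]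
    congr 2
    abel
  aU_VW a s w := by
    change D.aQuot a (Submodule.Quotient.mk _) = Submodule.Quotient.mk _ + Submodule.Quotient.mk _
    rw [aQuot_mk, preVW_aP]; rfl
  d₁_aV a s := by simp [N.κ_aP, D.Δ_aP, der₂_apply, add_comm]
  d₂_aW a w := by
    exact congrArg Submodule.Quotient.mk (der₂_comm (D.E_aP a) w.1)
  d₂_d₁ s := by
    change Submodule.Quotient.mk (der₂ D.E (-(2 : K)⁻¹ • D.Δ s)) = _
    rw [map_smul, der₂_apply, ← D.Δ_E, ← map_smul, mk_Δ]
  VW_cyclic s t r := by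
    change Submodule.Quotient.mk (D.preVW s ((2 : K)⁻¹ • sym K P (t ⊗ₜ r))) +
      Submodule.Quotient.mk (D.preVW t ((2 : K)⁻¹ • sym K P (r ⊗ₜ s))) +
      Submodule.Quotient.mk (D.preVW r ((2 : K)⁻¹ • sym K P (s ⊗ₜ t))) = (0 : D.Quot)
    rw [map_smul, map_smul, map_smul, ← Submodule.Quotient.mk_add, ← Submodule.Quotient.mk_add,
      ← smul_add, ← smul_add, preVW_cyclic, smul_zero, Submodule.Quotient.mk_zero]
  d₂_VV s t := by
    change Submodule.Quotient.mk (der₂ D.E ((2 : K)⁻¹ • sym K P (s ⊗ₜ t))) =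
      -Submodule.Quotient.mk (D.preVW t (-(2 : K)⁻¹ • D.Δ s)) -
        (Submodule.Quotient.mk (D.preVW s (-(2 : K)⁻¹ • D.Δ t)) : D.Quot)
    have h2 : (2 : K) ≠ 0 := two_ne_zero
    rw [← Submodule.Quotient.mk_neg, ← Submodule.Quotient.mk_sub, Submodule.Quotient.eq]
    refine ⟨(2 : K)⁻¹ • (D.m (D.p t) s + D.m (D.p s) t), ?_⟩
    simp only [map_smul, preVW_Δ, map_add, sym_tmul, der₂_tmul]
    module

section

variable [CharZero K] (N : D.Twist Z)

lemma Twist.eq_i_of_d₁_eq_zero {s : P} (hs : N.fourTerm.d₁ s = 0) : s = D.i (D.p s) := by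
  have h : -(2 : K)⁻¹ • D.Δ s = 0 := congrArg Prod.fst hs
  have h2 : -(2 : K)⁻¹ ≠ 0 := by simp
  have h3 := D.m_Δ s
  rw [(smul_eq_zero_iff_right h2).mp h, map_zero] at h3
  apply D.E_bij.1
  rw [D.E_i, sub_eq_zero.mp h3.symm]

lemma Twist.d₁_i (x : X) : N.fourTerm.d₁ (D.i x) = 0 := by
  change (-(2 : K)⁻¹ • D.Δ (D.i x), N.κ (D.i x)) = 0
  rw [D.Δ_i, N.κ_i, smul_zero]; rfl

lemma Twist.exists_of_d₂_eq_zero {w : (P ⊗[K] P) × Z} (hw : N.fourTerm.d₂ w = 0) :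
    ∃ s z, w = N.fourTerm.d₁ s + (0, z) := by
  obtain ⟨t, ht⟩ := (Submodule.Quotient.mk_eq_zero _).mp hw
  obtain ⟨t, rfl⟩ := D.E_bij.2 t
  have h : w.1 = D.Δ t := D.E₂_bij.1 (by
    rw [LinearMap.add_apply, LinearMap.add_apply, ← D.Δ_E]; exact ht.symm)
  refine ⟨(-2 : K) • t, w.2 - N.κ ((-2 : K) • t), Prod.ext ?_ ?_⟩
  · change w.1 = -(2 : K)⁻¹ • D.Δ ((-2 : K) • t) + 0
    rw [h, map_smul, smul_smul]; simp
  · change w.2 = N.κ _ + _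
    exact (add_sub_cancel _ _).symm

lemma Twist.d₂_surjective : Function.Surjective N.fourTerm.d₂ := by
  intro u
  obtain ⟨u, rfl⟩ := Submodule.Quotient.mk_surjective _ u
  obtain ⟨v, rfl⟩ := D.E₂_bij.2 u
  exact ⟨(v, 0), rfl⟩

lemma Twist.d₂_zero (z : Z) : N.fourTerm.d₂ (0, z) = 0 := by
  change Submodule.Quotient.mk (der₂ D.E 0) = (0 : D.Quot)
  rw [map_zero]; rfl

end

section

variable [CharZero K] (N : D.Twist Z) {V W : Type} [AddCommGroup V] [Module K V]
  [AddCommGroup W] [Module K W] (M : FourTerm K g V W PUnit) (Φ : P →ₗ[K] V) (e : Z →ₗ[K] W)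

/-- The morphism from the four-term DG-Lie algebra of an Euler coalgebra determined by a
formal solution `Φ` of a Maurer-Cartan type equation. -/
noncomputable def Twist.hom (hbrk : ∀ a b, M.brk a b = N.brk a b)
    (hΦ : ∀ a s, Φ (D.aP a s) = M.aV a (Φ s)) (he : ∀ a z, e (N.aZ a z) = M.aW a (e z))
    (hd : ∀ s, M.d₁ (Φ s) =
      -(2 : K)⁻¹ • TensorProduct.lift (M.VV.compl₁₂ Φ Φ) (D.Δ s) + e (N.κ s)) :
    FourTerm.Hom N.fourTerm M where
  fg := LinearMap.id
  fV := Φ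
  fW := (TensorProduct.lift (M.VV.compl₁₂ Φ Φ)).coprod e
  fU := 0
  map_brk a b := (hbrk a b).symm
  map_aV := hΦ
  map_aW a w := by
    change TensorProduct.lift _ (der₂ (D.aP a) w.1) + e (N.aZ a w.2) =
      M.aW a (TensorProduct.lift _ w.1 + e w.2)
    rw [map_add, he]
    congr 1
    generalize w.1 = u
    induction u using TensorProduct.induction_on with
    | zero => simp
    | add x y hx hy => simp only [map_add, hx, hy]
    | tmul y z => simp [hΦ, M.aW_VV]
  map_aU _ _ := rfl
  map_VV s t := by
    change TensorProduct.lift _ ((2 : K)⁻¹ • sym K P (s ⊗ₜ t)) + e ((2 : K)⁻¹ • 0) = _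
    rw [map_smul, sym_tmul, map_add, TensorProduct.lift.tmul, TensorProduct.lift.tmul, smul_zero,
      map_zero, add_zero, LinearMap.compl₁₂_apply, LinearMap.compl₁₂_apply, M.VV_symm (Φ t),
      ← two_smul K, smul_smul, inv_mul_cancel₀ two_ne_zero, one_smul]
  map_VW _ _ := rfl
  map_d₁ s := by
    change TensorProduct.lift _ (-(2 : K)⁻¹ • D.Δ s) + e (N.κ s) = _
    rw [hd, map_smul]
  map_d₂ _ := rfl

lemma Twist.qIso (hbrk : ∀ a b, M.brk a b = N.brk a b)
    (hΦ : ∀ a s, Φ (D.aP a s) = M.aV a (Φ s)) (he : ∀ a z, e (N.aZ a z) = M.aW a (e z))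
    (hd : ∀ s, M.d₁ (Φ s) =
      -(2 : K)⁻¹ • TensorProduct.lift (M.VV.compl₁₂ Φ Φ) (D.Δ s) + e (N.κ s))
    (hΦ_inj : ∀ x, Φ (D.i x) = 0 → x = 0) (hΦ_surj : ∀ s, M.d₁ s = 0 → ∃ x, Φ (D.i x) = s)
    (he_inj : ∀ z s, M.d₁ s = e z → z = 0) (he_surj : ∀ w, ∃ z s, M.d₁ s = e z - w) :
    QIso N.fourTerm.toDGLA M.toDGLA := by
  refine ⟨(N.hom M Φ e hbrk hΦ he hd).toDGLAHom, FourTerm.Hom.isQuasiIso _ (fun a ha => ha)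
    (fun a => ⟨a, rfl⟩) ?_ ?_ ?_ ?_ ?_ fun u => ⟨0, 0, rfl⟩⟩
  · intro s hs hs'
    rw [N.eq_i_of_d₁_eq_zero hs] at hs' ⊢
    rw [hΦ_inj _ hs', map_zero]
  · intro s hs
    obtain ⟨x, rfl⟩ := hΦ_surj s hs
    exact ⟨_, N.d₁_i x, rfl⟩
  · intro w s hw hs
    obtain ⟨t, z, rfl⟩ := N.exists_of_d₂_eq_zero hw
    rw [map_add, (N.hom M Φ e hbrk hΦ he hd).map_d₁, ← sub_eq_iff_eq_add', ← map_sub] at hs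
    have hz : z = 0 := he_inj z _ (hs.trans ((LinearMap.coprod_apply _ _ _).trans (by simp)))
    exact ⟨t, by rw [hz, Prod.mk_zero_zero, add_zero]⟩
  · intro w _
    obtain ⟨z, s, h⟩ := he_surj w
    refine ⟨(0, z), s, N.d₂_zero z, h.trans ?_⟩
    congr 1
    exact ((LinearMap.coprod_apply _ _ _).trans (by simp)).symm
  · intro u _ _
    exact N.d₂_surjective u

end

end EulerCoalgebra

lemma bijective_of_span_eigenvectors {M : Type} [AddCommGroup M] [Module K M] (f : M →ₗ[K] M)
    {S : Set M} (hS : Submodule.span K S = ⊤) (h : ∀ v ∈ S, ∃ c : K, c ≠ 0 ∧ f v = c • v) :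
    Function.Bijective f := by
  constructor
  · rw [← LinearMap.ker_eq_bot, eq_bot_iff]
    intro x hx
    have hle : (⊤ : Submodule K M) ≤ ⨆ c : K, ⨆ (_ : c ≠ 0), Module.End.eigenspace f c := by
      rw [← hS, Submodule.span_le]
      intro v hv
      obtain ⟨c, hc, hfc⟩ := h v hv
      exact le_iSup₂_of_le (f := fun (c : K) (_ : c ≠ 0) => Module.End.eigenspace f c) c hc le_rfl
        (Module.End.mem_eigenspace_iff.mpr hfc)
    have hdis := (Module.End.eigenspaces_iSupIndep f) 0
    exact Submodule.disjoint_def.mp hdis x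
      (Module.End.mem_eigenspace_iff.mpr (by simpa using hx)) (hle trivial)
  · rw [← LinearMap.range_eq_top, eq_top_iff, ← hS, Submodule.span_le]
    intro v hv
    obtain ⟨c, hc, hfc⟩ := h v hv
    exact ⟨c⁻¹ • v, by rw [map_smul, hfc, inv_smul_smul₀ hc]⟩

namespace PolyCoalg

open MvPolynomial
open scoped TensorProduct

variable {X σ : Type} [AddCommGroup X] [Module K X]

/-- The augmentation ideal. -/
abbrev AugIdeal (σ K : Type) [Field K] : Type := ↥(LinearMap.ker (aug σ K))

/-- The projection onto the augmentation ideal. -/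
noncomputable def toAug (σ K : Type) [Field K] : MvPolynomial σ K →ₗ[K] AugIdeal σ K :=
  (red σ K).codRestrict _ fun s => LinearMap.mem_ker.mpr (aug_red s)

lemma coe_toAug (s : MvPolynomial σ K) : (toAug σ K s : MvPolynomial σ K) = red σ K s := rfl

@[simp] lemma toAug_coe (s : AugIdeal σ K) : toAug σ K s = s := Subtype.ext (red_eq_self s.2)

@[simp] lemma toAug_one : toAug σ K 1 = 0 := Subtype.ext red_one

lemma toAug_surjective : Function.Surjective (toAug σ K) := fun s => ⟨s, toAug_coe s⟩

lemma der_id_vprod (b : Module.Basis σ K X) (s : Multiset X) :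
    der b LinearMap.id (vprod b s) = (s.card : K) • vprod b s := by
  induction s using Multiset.induction_on with
  | empty => simp
  | cons x s ih =>
    rw [vprod_cons, Derivation.leibniz, ih, der_lin, Multiset.card_cons]
    rw [LinearMap.id_apply, smul_eq_mul, smul_eq_mul, Nat.cast_add, Nat.cast_one, add_smul,
      one_smul, mul_smul_comm, mul_comm (vprod b s)]

lemma span_toAug_vprod (b : Module.Basis σ K X) :
    Submodule.span K (Set.range fun s : Multiset X => toAug σ K (vprod b s)) = ⊤ := by
  have h : Submodule.span K (Set.range (vprod b)) = ⊤ := by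
    rw [eq_top_iff, ← (basisMonomials σ K).span_eq, Submodule.span_le]
    rintro _ ⟨m, rfl⟩
    rw [coe_basisMonomials]
    exact Submodule.subset_span ⟨_, (monomial_eq_vprod b m).symm⟩
  rw [Set.range_comp' (toAug σ K) (vprod b), ← Submodule.map_span, h, Submodule.map_top,
    LinearMap.range_eq_top]
  exact toAug_surjective

/-- The derivation extending an endomorphism of the linear forms, on the augmentation ideal. -/
noncomputable def derAug (b : Module.Basis σ K X) (f : X →ₗ[K] X) : AugIdeal σ K →ₗ[K] AugIdeal σ K :=
  toAug σ K ∘ₗ (der b f).toLinearMap ∘ₗ Submodule.subtype _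

lemma derAug_toAug (b : Module.Basis σ K X) (f : X →ₗ[K] X) (s : MvPolynomial σ K) :
    derAug b f (toAug σ K s) = toAug σ K (der b f s) :=
  congrArg (toAug σ K) (der_red b f s)

lemma coe_derAug (b : Module.Basis σ K X) (f : X →ₗ[K] X) (s : AugIdeal σ K) :
    (derAug b f s : MvPolynomial σ K) = der b f s := red_der b f _

/-- `derAug` as a linear map. -/
noncomputable def derAugHom (b : Module.Basis σ K X) :
    (X →ₗ[K] X) →ₗ[K] AugIdeal σ K →ₗ[K] AugIdeal σ K where
  toFun := derAug b
  map_add' f f' := LinearMap.ext fun s => Subtype.ext <| by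
    rw [LinearMap.add_apply, Submodule.coe_add, coe_derAug, coe_derAug, coe_derAug, der_add]
  map_smul' c f := LinearMap.ext fun s => Subtype.ext <| by
    rw [RingHom.id_apply, LinearMap.smul_apply, Submodule.coe_smul, coe_derAug, coe_derAug,
      der_smul]

lemma derAugHom_apply (b : Module.Basis σ K X) (f : X →ₗ[K] X) : derAugHom b f = derAug b f := rfl

lemma derAug_id_eigen [CharZero K] (b : Module.Basis σ K X) (s : Multiset X) :
    derAug b LinearMap.id (toAug σ K (vprod b s)) = (s.card : K) • toAug σ K (vprod b s) := by
  rw [derAug_toAug, der_id_vprod, map_smul]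

lemma derAug_id_bijective [CharZero K] (b : Module.Basis σ K X) :
    Function.Bijective (derAug b LinearMap.id) := by
  refine bijective_of_span_eigenvectors _ (span_toAug_vprod b) ?_
  rintro _ ⟨s, rfl⟩
  dsimp only
  by_cases hs : s = 0
  · subst hs
    exact ⟨1, one_ne_zero, by simp⟩
  · exact ⟨s.card, by simpa using hs, derAug_id_eigen b s⟩

lemma derAug_id_tensor_bijective [CharZero K] (b : Module.Basis σ K X) :
    Function.Bijective ((derAug b LinearMap.id).rTensor (AugIdeal σ K) +
      (derAug b LinearMap.id).lTensor (AugIdeal σ K)) := by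
  refine bijective_of_span_eigenvectors _ (S := Set.image2 (fun s t => s ⊗ₜ[K] t)
    (Set.range fun s : Multiset X => toAug σ K (vprod b s))
    (Set.range fun s : Multiset X => toAug σ K (vprod b s))) ?_ ?_
  · rw [← TensorProduct.map₂_mk_top_top_eq_top, ← span_toAug_vprod b, Submodule.map₂_span_span]
    rfl
  · rintro _ ⟨_, ⟨s, rfl⟩, _, ⟨t, rfl⟩, rfl⟩
    dsimp only
    by_cases hs : s + t = 0
    · obtain ⟨rfl, rfl⟩ := add_eq_zero.mp hs
      exact ⟨1, one_ne_zero, by simp⟩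
    · refine ⟨(s + t).card, Nat.cast_ne_zero.mpr (mt Multiset.card_eq_zero.mp hs), ?_⟩
      rw [LinearMap.add_apply, LinearMap.rTensor_tmul, LinearMap.lTensor_tmul, derAug_id_eigen,
        derAug_id_eigen, ← TensorProduct.smul_tmul', TensorProduct.tmul_smul, ← add_smul,
        Multiset.card_add, Nat.cast_add]

/-- The reduced coproduct. -/
noncomputable def coprodAug (σ K : Type) [Field K] : AugIdeal σ K →ₗ[K] AugIdeal σ K ⊗[K] AugIdeal σ K :=
  TensorProduct.map (toAug σ K) (toAug σ K) ∘ₗ (coprod σ K).toLinearMap ∘ₗ Submodule.subtype _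

lemma coprodAug_toAug (s : MvPolynomial σ K) : coprodAug σ K (toAug σ K s) =
    TensorProduct.map (toAug σ K) (toAug σ K) (coprod σ K s) := by
  change TensorProduct.map _ _ (coprod σ K (red σ K s)) = _
  rw [red_apply, map_sub, map_smul, map_sub, map_smul, map_one, Algebra.TensorProduct.one_def,
    TensorProduct.map_tmul, toAug_one]
  simp

lemma coprodAug_derAug (b : Module.Basis σ K X) (f : X →ₗ[K] X) (s : AugIdeal σ K) :
    coprodAug σ K (derAug b f s) = (derAug b f).rTensor _ (coprodAug σ K s) +
      (derAug b f).lTensor _ (coprodAug σ K s) := by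
  obtain ⟨s, rfl⟩ := toAug_surjective s
  rw [derAug_toAug, coprodAug_toAug, coprodAug_toAug, coprod_der]
  generalize coprod σ K s = u
  induction u using TensorProduct.induction_on with
  | zero => simp
  | add x y hx hy => simp only [map_add, hx, hy]; abel
  | tmul y z => simp [derAug_toAug]

/-- Multiplication of the augmentation ideal by linear forms. -/
noncomputable def mulAug (b : Module.Basis σ K X) : X →ₗ[K] AugIdeal σ K →ₗ[K] AugIdeal σ K :=
  ((LinearMap.mul K (MvPolynomial σ K)).compl₁₂ (lin b) (Submodule.subtype _)).compr₂ (toAug σ K)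

lemma mulAug_apply (b : Module.Basis σ K X) (x : X) (s : AugIdeal σ K) :
    mulAug b x s = toAug σ K (lin b x * s) := rfl

lemma toAug_lin_mul (b : Module.Basis σ K X) (x : X) (s : MvPolynomial σ K) :
    toAug σ K (lin b x * s) = mulAug b x (toAug σ K s) + aug σ K s • toAug σ K (lin b x) := by
  rw [mulAug_apply, coe_toAug, red_apply, mul_sub, map_sub, mul_smul_comm, mul_one, map_smul,
    sub_add_cancel]

lemma coprodAug_mulAug (b : Module.Basis σ K X) (x : X) (s : AugIdeal σ K) :
    coprodAug σ K (mulAug b x s) = (mulAug b x).rTensor _ (coprodAug σ K s) +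
      (mulAug b x).lTensor _ (coprodAug σ K s) + toAug σ K (lin b x) ⊗ₜ s +
        s ⊗ₜ toAug σ K (lin b x) := by
  have key : ∀ u : MvPolynomial σ K ⊗[K] MvPolynomial σ K,
      TensorProduct.map (toAug σ K) (toAug σ K) ((lin b x ⊗ₜ 1 + 1 ⊗ₜ lin b x) * u) =
      (mulAug b x).rTensor _ (TensorProduct.map (toAug σ K) (toAug σ K) u) +
      (mulAug b x).lTensor _ (TensorProduct.map (toAug σ K) (toAug σ K) u) +
        toAug σ K (lin b x) ⊗ₜ toAug σ K (counitL σ K u) +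
        toAug σ K (counitR σ K u) ⊗ₜ toAug σ K (lin b x) := by
    intro u
    induction u using TensorProduct.induction_on with
    | zero => simp
    | add y z hy hz =>
      simp only [mul_add, map_add, hy, hz, TensorProduct.tmul_add, TensorProduct.add_tmul]
      abel
    | tmul y z =>
      simp only [add_mul, Algebra.TensorProduct.tmul_mul_tmul, one_mul, map_add,
        TensorProduct.map_tmul, toAug_lin_mul, LinearMap.rTensor_tmul, LinearMap.lTensor_tmul,
        counitL_tmul, counitR_tmul, map_smul, TensorProduct.add_tmul, TensorProduct.tmul_add,
        TensorProduct.tmul_smul, TensorProduct.smul_tmul']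
      abel
  have h := key (coprod σ K (s : MvPolynomial σ K))
  rw [counitL_coprod, counitR_coprod, toAug_coe, ← coprod_lin, ← map_mul, ← coprodAug_toAug,
    ← coprodAug_toAug, toAug_coe] at h
  exact h

variable [Fintype σ]

lemma lift_mulAug_coprodAug (b : Module.Basis σ K X) (s : AugIdeal σ K) :
    TensorProduct.lift (mulAug b ∘ₗ linPart b ∘ₗ Submodule.subtype _) (coprodAug σ K s) =
      derAug b LinearMap.id s - toAug σ K (lin b (linPart b (s : MvPolynomial σ K))) := by
  have key : ∀ u : MvPolynomial σ K ⊗[K] MvPolynomial σ K,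
      TensorProduct.lift (mulAug b ∘ₗ linPart b ∘ₗ Submodule.subtype _)
        (TensorProduct.map (toAug σ K) (toAug σ K) u) =
      toAug σ K (contract b LinearMap.id u) -
        toAug σ K (lin b (linPart b (counitR σ K u))) := by
    intro u
    induction u using TensorProduct.induction_on with
    | zero => simp
    | add y z hy hz => simp only [map_add, hy, hz]; abel
    | tmul y z =>
      simp [toAug_lin_mul, coe_toAug]
  have h := key (coprod σ K (s : MvPolynomial σ K))
  rw [← coprodAug_toAug, toAug_coe, contract_coprod, counitR_coprod, ← derAug_toAug, toAug_coe] at h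
  exact h

/-- The augmentation ideal of a polynomial bialgebra as an Euler coalgebra. -/
noncomputable def eulerCoalgebra [CharZero K] {g : Type} [AddCommGroup g] [Module K g]
    (b : Module.Basis σ K X) (aX : g →ₗ[K] X →ₗ[K] X) : EulerCoalgebra K g X (AugIdeal σ K) where
  Δ := coprodAug σ K
  p := linPart b ∘ₗ Submodule.subtype _
  i := toAug σ K ∘ₗ lin b
  m := mulAug b
  E := derAug b LinearMap.id
  aX := aX
  aP := derAugHom b ∘ₗ aX
  comm_Δ s := by
    change TensorProduct.comm K _ _ (TensorProduct.map _ _ (coprod σ K (s : MvPolynomial σ K))) =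
      TensorProduct.map _ _ (coprod σ K (s : MvPolynomial σ K))
    conv_rhs => rw [← comm_coprod]
    generalize coprod σ K (s : MvPolynomial σ K) = u
    induction u using TensorProduct.induction_on with
    | zero => simp
    | add x y hx hy => simp only [map_add, hx, hy]
    | tmul y z => simp
  Δ_i x := by
    rw [LinearMap.comp_apply, coprodAug_toAug, coprod_lin]
    simp
  E_i x := by simp [derAug_toAug]
  m_Δ := lift_mulAug_coprodAug b
  Δ_m := coprodAug_mulAug b
  Δ_E := coprodAug_derAug b LinearMap.id
  E_bij := derAug_id_bijective b
  E₂_bij := derAug_id_tensor_bijective b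
  p_aP a s := by simp [derAugHom_apply, coe_derAug, linPart_der]
  m_aP a x s := by
    rw [LinearMap.comp_apply, derAugHom_apply, mulAug_apply, mulAug_apply, mulAug_apply,
      derAug_toAug, coe_derAug, Derivation.leibniz, der_lin, smul_eq_mul, smul_eq_mul, ← map_add,
      add_comm, mul_comm (s : MvPolynomial σ K)]
  Δ_aP a s := coprodAug_derAug b (aX a) s
  E_aP a s := by
    rw [LinearMap.comp_apply, derAugHom_apply]
    apply Subtype.ext
    rw [coe_derAug, coe_derAug, coe_derAug, coe_derAug, ← sub_eq_zero, ← der_commutator]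
    rw [LinearMap.id_comp, LinearMap.comp_id, sub_self]
    simpa only [zero_smul] using der_smul b (0 : K) 0 (s : MvPolynomial σ K)

end PolyCoalg

/-! ### The comparison of the truncation with the cohomology -/

namespace SplitQCyclic

open PolyCoalg
open scoped TensorProduct

/-- The degree zero cohomology. -/
abbrev G (T : SplitQCyclic K) : Type := ↥(T.S.H 0)

variable {T : SplitQCyclic K}

/-- The adjoint action of the degree zero cohomology on an invariant subspace. -/
def act {p : Submodule K T.L} (hp : ∀ a ∈ T.S.H 0, ∀ x ∈ p, T.br a x ∈ p) :
    T.G →ₗ[K] ↥p →ₗ[K] ↥p :=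
  LinearMap.mk₂ K (fun a x => ⟨T.br (a : T.L) (x : T.L), hp a a.2 x x.2⟩)
    (fun a b x => Subtype.ext (by simp)) (fun c a x => Subtype.ext (by simp))
    (fun a x y => Subtype.ext (by simp)) (fun c a x => Subtype.ext (by simp))

@[simp] lemma coe_act {p : Submodule K T.L} (hp : ∀ a ∈ T.S.H 0, ∀ x ∈ p, T.br a x ∈ p)
    (a : T.G) (x : ↥p) : (act hp a x : T.L) = T.br (a : T.L) (x : T.L) := rfl

lemma act_act {p : Submodule K T.L} (hp : ∀ a ∈ T.S.H 0, ∀ x ∈ p, T.br a x ∈ p) (a b : T.G)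
    (x : ↥p) : act hp (act T.br_mem_H₀ a b) x = act hp a (act hp b x) - act hp b (act hp a x) :=
  Subtype.ext <| by
    change T.br (T.br (a : T.L) (b : T.L)) (x : T.L) =
      T.br (a : T.L) (T.br (b : T.L) (x : T.L)) - T.br (b : T.L) (T.br (a : T.L) (x : T.L))
    rw [ad_br (H_le a.2), add_sub_cancel_right]

lemma act_skew (a b : T.G) : act T.br_mem_H₀ a b = -act T.br_mem_H₀ b a :=
  Subtype.ext (br_skew_zero (H_le a.2) (H_le b.2))

lemma act_leibniz (a b c : T.G) : act T.br_mem_H₀ a (act T.br_mem_H₀ b c) =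
    act T.br_mem_H₀ (act T.br_mem_H₀ a b) c + act T.br_mem_H₀ b (act T.br_mem_H₀ a c) :=
  Subtype.ext (ad_br (H_le a.2) _ _)

variable (T)

/-- The projection onto `H ⊕ d(K)`. -/
def q : T.L →ₗ[K] T.L := T.pr - T.d ∘ₗ T.h

lemma q_apply (x : T.L) : T.q x = T.pr x - T.d (T.h x) := rfl

/-- The degree two cocycles, as a complement of `K²`. -/
abbrev W₂ : Submodule K T.L := T.S.H 2 ⊔ (T.S.Kc 1).map T.d

variable {T}

lemma q_mem {x : T.L} (hx : x ∈ T.A.grading 2) : T.q x ∈ T.W₂ := by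
  rw [q_apply]
  exact sub_mem (Submodule.mem_sup_left (pr_mem hx))
    (Submodule.mem_sup_right (Submodule.mem_map_of_mem (by simpa using h_mem hx)))

lemma q_ad {a : T.L} (ha : a ∈ T.S.H 0) (x : T.L) : T.q (T.br a x) = T.br a (T.q x) := by
  rw [q_apply, q_apply, pr_ad ha, h_ad ha, d_br_zero ha, map_sub]

lemma br_mem_W₂ : ∀ a ∈ T.S.H 0, ∀ x ∈ T.W₂, T.br a x ∈ T.W₂ := by
  intro a ha x hx
  obtain ⟨y, hy, z, ⟨k, hk, rfl⟩, rfl⟩ := Submodule.mem_sup.mp hx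
  rw [map_add, ← d_br_zero ha]
  exact Submodule.add_mem_sup (T.br_mem_H 2 a ha y hy)
    (Submodule.mem_map_of_mem (T.br_mem_Kc 1 a ha k hk))

lemma d_mem_W₂ {x : T.L} (hx : x ∈ T.S.H 1 ⊔ T.S.Kc 1) : T.d x ∈ T.W₂ := by
  obtain ⟨y, hy, z, hz, rfl⟩ := Submodule.mem_sup.mp hx
  rw [map_add, d_H hy, zero_add]
  exact Submodule.mem_sup_right (Submodule.mem_map_of_mem hz)

variable (T)

/-- The quotient of the truncation of `L` by an acyclic ideal. -/
def minimalQuotient : FourTerm K T.G T.V ↥T.W₂ PUnit where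
  brk := act T.br_mem_H₀
  aV := act fun _ ha _ => ad_V_mem ha
  aW := act br_mem_W₂
  aU := 0
  VV := LinearMap.mk₂ K (fun y z => ⟨T.q (T.br (y : T.L) (z : T.L)), q_mem (V_br_mem y z)⟩)
    (fun x y z => Subtype.ext (by simp)) (fun c x y => Subtype.ext (by simp))
    (fun x y z => Subtype.ext (by simp)) (fun c x y => Subtype.ext (by simp))
  VW := 0
  d₁ := T.d.restrict fun _ => d_mem_W₂
  d₂ := 0
  brk_skew := act_skew
  brk_brk := act_leibniz
  aV_brk := act_act _
  aW_brk := act_act _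
  aU_brk _ _ _ := rfl
  VV_symm s t := Subtype.ext (congrArg T.q (br_symm (V_mem s) (V_mem t)))
  aW_VV a s t := Subtype.ext <| by
    simp [← q_ad a.2, ad_br (H_le a.2)]
  aU_VW _ _ _ := rfl
  d₁_aV a s := Subtype.ext (d_br_zero a.2 _)
  d₂_aW _ _ := rfl
  d₂_d₁ _ := rfl
  VW_cyclic _ _ _ := rfl
  d₂_VV _ _ := rfl

/-- The cohomology, as a graded Lie algebra. -/
def cohomologyLie : FourTerm K T.G T.X ↥(T.S.H 2) PUnit where
  brk := act T.br_mem_H₀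
  aV := act (T.br_mem_H 1)
  aW := act (T.br_mem_H 2)
  aU := 0
  VV := T.cyclicData.pbr.compl₁₂ T.cyclicData.inc T.cyclicData.inc
  VW := 0
  d₁ := 0
  d₂ := 0
  brk_skew := act_skew
  brk_brk := act_leibniz
  aV_brk := act_act _
  aW_brk := act_act _
  aU_brk _ _ _ := rfl
  VV_symm s t := Subtype.ext (congrArg T.pr (br_symm (H_le s.2) (H_le t.2)))
  aW_VV a s t := Subtype.ext <| by
    change T.br (a : T.L) (T.pr (T.br (s : T.L) (t : T.L))) =
      T.pr (T.br (T.br (a : T.L) (s : T.L)) (t : T.L)) +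
        T.pr (T.br (s : T.L) (T.br (a : T.L) (t : T.L)))
    rw [← pr_ad a.2, ad_br (H_le a.2), map_add]
  aU_VW _ _ _ := rfl
  d₁_aV _ _ := (map_zero _).symm
  d₂_aW _ _ := rfl
  d₂_d₁ _ := rfl
  VW_cyclic _ _ _ := rfl
  d₂_VV _ _ := rfl

lemma cohomologyLie_d (x : T.cohomologyLie.toDGLA.carrier) : T.cohomologyLie.toDGLA.d x = 0 := rfl

/-- The reduced symmetric coalgebra on the first cohomology. -/
noncomputable def coalgebra [CharZero K] :
    EulerCoalgebra K T.G T.X (AugIdeal (Fin (Module.finrank K T.X)) K) :=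
  eulerCoalgebra T.basis (act (T.br_mem_H 1))

/-- The curvature `½ {F, F}₂`. -/
noncomputable def curvature : AugIdeal (Fin (Module.finrank K T.X)) K →ₗ[K] ↥(T.S.H 2) :=
  (2 : K)⁻¹ • TensorProduct.lift (T.cohomologyLie.VV.compl₁₂ (T.cyclicData.F T.basis)
    (T.cyclicData.F T.basis)) ∘ₗ (coprod _ K).toLinearMap ∘ₗ Submodule.subtype _

lemma curvature_apply (s : AugIdeal (Fin (Module.finrank K T.X)) K) : T.curvature s =
    (2 : K)⁻¹ • TensorProduct.lift (T.cohomologyLie.VV.compl₁₂ (T.cyclicData.F T.basis)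
      (T.cyclicData.F T.basis)) (coprod _ K (s : T.Poly)) := rfl

lemma lift_coprodAug {σ M N : Type} [AddCommGroup M] [Module K M] [AddCommGroup N] [Module K N]
    (β : M →ₗ[K] M →ₗ[K] N) (φ : MvPolynomial σ K →ₗ[K] M) (hφ : ∀ s, φ (red σ K s) = φ s)
    (s : AugIdeal σ K) :
    TensorProduct.lift (β.compl₁₂ (φ ∘ₗ Submodule.subtype _) (φ ∘ₗ Submodule.subtype _))
      (coprodAug σ K s) =
    TensorProduct.lift (β.compl₁₂ φ φ) (coprod σ K (s : MvPolynomial σ K)) := by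
  change TensorProduct.lift _ (TensorProduct.map _ _ (coprod σ K (s : MvPolynomial σ K))) = _
  generalize coprod σ K (s : MvPolynomial σ K) = u
  induction u using TensorProduct.induction_on with
  | zero => simp
  | add x y hx hy => simp only [map_add, hx, hy]
  | tmul y z => simp [coe_toAug, hφ]

variable {T}

lemma F_der' (a : T.G) (s : T.Poly) : T.cyclicData.F T.basis
    (der T.basis (act (T.br_mem_H 1) a) s) = act (T.br_mem_H 1) a (T.cyclicData.F T.basis s) :=
  T.cyclicData.F_der T.basis a s

lemma curvature_der [CharZero K] (a : T.G) (s : AugIdeal (Fin (Module.finrank K T.X)) K) :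
    T.curvature (T.coalgebra.aP a s) = act (T.br_mem_H 2) a (T.curvature s) := by
  have h : ((T.coalgebra.aP a s : AugIdeal _ K) : T.Poly) =
      der T.basis (act (T.br_mem_H 1) a) (s : T.Poly) := coe_derAug _ _ _
  rw [curvature_apply, curvature_apply, h, lift_coprod_der, map_smul]
  congr 1
  generalize coprod _ K (s : T.Poly) = u
  induction u using TensorProduct.induction_on with
  | zero => simp
  | add x y hx hy => simp only [map_add, hx, hy]
  | tmul y z =>
    have := T.cohomologyLie.aW_VV a (T.cyclicData.F T.basis y) (T.cyclicData.F T.basis z)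
    refine Eq.trans ?_ this.symm
    exact congrArg₂ (fun u v => T.cohomologyLie.VV u (T.cyclicData.F T.basis z) +
      T.cohomologyLie.VV (T.cyclicData.F T.basis y) v) (F_der' a y) (F_der' a z)

variable (T)

/-- The twist of the symmetric coalgebra by the curvature. -/
noncomputable def twist [CharZero K] : T.coalgebra.Twist ↥(T.S.H 2) where
  brk := act T.br_mem_H₀
  aZ := act (T.br_mem_H 2)
  κ := T.curvature
  brk_skew := act_skew
  brk_brk := act_leibniz
  aP_brk a b s := Subtype.ext <| by
    change (derAug T.basis (act (T.br_mem_H 1) (act T.br_mem_H₀ a b)) s : T.Poly) =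
      (derAug T.basis _ (derAug T.basis _ s) : T.Poly) -
        (derAug T.basis _ (derAug T.basis _ s) : T.Poly)
    rw [coe_derAug, coe_derAug, coe_derAug, coe_derAug, coe_derAug, ← der_commutator]
    exact congrArg (fun f => der T.basis f (s : T.Poly)) (LinearMap.ext (act_act _ a b))
  aZ_brk := act_act _
  κ_aP := curvature_der
  κ_i x := by
    change T.curvature (toAug _ K (lin T.basis x)) = 0
    rw [curvature_apply, coe_toAug, red_lin, coprod_lin]
    simp

lemma qIso_cohomologyLie [CharZero K] :
    QIso T.twist.fourTerm.toDGLA T.cohomologyLie.toDGLA := by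
  refine T.twist.qIso T.cohomologyLie (T.cyclicData.F T.basis ∘ₗ Submodule.subtype _)
    LinearMap.id (fun _ _ => rfl) (fun a s => ?_) (fun _ _ => rfl) (fun s => ?_) (fun x hx => ?_)
    (fun x _ => ⟨x, ?_⟩) (fun z s hz => hz.symm) fun w => ⟨w, 0, ?_⟩
  · exact (congrArg _ (coe_derAug _ _ _)).trans (F_der' a _)
  · change 0 = -(2 : K)⁻¹ • TensorProduct.lift _ (coprodAug _ K s) + T.curvature s
    rw [lift_coprodAug _ _ (T.cyclicData.F_red T.basis), curvature_apply, neg_smul,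
      neg_add_cancel]
  · change T.cyclicData.F T.basis (toAug _ K (lin T.basis x) : T.Poly) = 0 at hx
    rwa [coe_toAug, CyclicData.F_red, CyclicData.F_lin] at hx
  · change T.cyclicData.F T.basis (toAug _ K (lin T.basis x) : T.Poly) = x
    rw [coe_toAug, CyclicData.F_red, CyclicData.F_lin]
  · rw [LinearMap.id_apply, sub_self, map_zero]

lemma qIso_minimalQuotient [CharZero K] :
    QIso T.twist.fourTerm.toDGLA T.minimalQuotient.toDGLA := by
  have phi_i : ∀ x : T.X, T.cyclicData.phi T.basis (toAug _ K (lin T.basis x) : T.Poly) =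
      T.cyclicData.inc x := fun x => by
    rw [coe_toAug, CyclicData.phi_red, CyclicData.phi_lin]
  refine T.twist.qIso T.minimalQuotient (T.cyclicData.phi T.basis ∘ₗ Submodule.subtype _)
    (Submodule.inclusion le_sup_left) (fun _ _ => rfl) (fun a s => ?_) (fun _ _ => rfl)
    (fun s => ?_) (fun x hx => ?_) (fun s hs => ?_) (fun z s hz => ?_) fun w => ?_
  · exact (congrArg _ (coe_derAug _ _ _)).trans (T.cyclicData.phi_der T.basis a _)
  · change T.minimalQuotient.d₁ (T.cyclicData.phi T.basis (s : T.Poly)) =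
      -(2 : K)⁻¹ • TensorProduct.lift _ (coprodAug _ K s) + Submodule.inclusion _ (T.curvature s)
    rw [lift_coprodAug _ _ (T.cyclicData.phi_red T.basis), curvature_apply]
    have hp := T.cyclicData.pbr_phi T.basis (s : T.Poly)
    change _ = TensorProduct.lift (T.cohomologyLie.VV.compl₁₂ (T.cyclicData.F T.basis)
      (T.cyclicData.F T.basis)) _ at hp
    rw [← hp, CyclicData.phi_rec, map_add, map_smul]
    have h0 : T.minimalQuotient.d₁ (T.cyclicData.inc (linPart T.basis (s : T.Poly))) = 0 :=
      Subtype.ext (d_H (linPart T.basis (s : T.Poly)).2)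
    rw [h0, zero_add, neg_smul, map_smul, neg_add_eq_sub, ← smul_sub]
    congr 1
    generalize coprod _ K (s : T.Poly) = u
    induction u using TensorProduct.induction_on with
    | zero => simp
    | add x y hx hy =>
      simp only [map_add, hx, hy]
      abel
    | tmul y z =>
      refine Subtype.ext ?_
      set v := T.br (T.cyclicData.phi T.basis y : T.L) (T.cyclicData.phi T.basis z : T.L)
      change T.d (T.h v) = T.pr v - T.q v
      rw [q_apply, sub_sub_cancel]
  · have h0 : T.cyclicData.inc x = 0 := (phi_i x).symm.trans hx
    exact Subtype.ext (congrArg Subtype.val h0 :)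
  · obtain ⟨s, hs'⟩ := s
    obtain ⟨x, hx, k, hk, rfl⟩ := Submodule.mem_sup.mp hs'
    have hd : T.d (x + k) = 0 := congrArg Subtype.val hs
    rw [map_add, d_H hx, zero_add] at hd
    refine ⟨⟨x, hx⟩, (phi_i _).trans (Subtype.ext ?_)⟩
    change x = x + k
    rw [T.S.d_Kc_inj 1 k hk hd, add_zero]
  · have hd : T.d (s : T.L) = z := congrArg Subtype.val hz
    exact Subtype.ext (by rw [← pr_H z.2, ← hd, pr_d]; rfl)
  · obtain ⟨w, hw⟩ := w
    obtain ⟨z, hz, _, ⟨k, hk, rfl⟩, rfl⟩ := Submodule.mem_sup.mp hw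
    refine ⟨⟨z, hz⟩, ⟨-k, Submodule.mem_sup_right (Submodule.neg_mem _ hk)⟩, Subtype.ext ?_⟩
    change T.d (-k) = z - (z + T.d k)
    rw [map_neg]
    abel

end SplitQCyclic

/-! ### The truncation -/

namespace DGLA

/-- The projection onto a homogeneous component. -/
noncomputable def proj (A : DGLA K) (i : ℤ) : A.carrier →ₗ[K] A.carrier :=
  (A.grading i).subtype ∘ₗ DirectSum.component K ℤ (fun j => ↥(A.grading j)) i ∘ₗ
    (LinearEquiv.ofBijective (DirectSum.coeLinearMap A.grading) A.internal).symm.toLinearMap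

lemma symm_coe (A : DGLA K) {i : ℤ} {x : A.carrier} (hx : x ∈ A.grading i) :
    (LinearEquiv.ofBijective (DirectSum.coeLinearMap A.grading) A.internal).symm x =
      DirectSum.lof K ℤ (fun j => ↥(A.grading j)) i ⟨x, hx⟩ := by
  rw [LinearEquiv.symm_apply_eq]
  exact (DirectSum.coeLinearMap_lof A.grading i ⟨x, hx⟩).symm

lemma proj_self (A : DGLA K) {i : ℤ} {x : A.carrier} (hx : x ∈ A.grading i) : A.proj i x = x := by
  rw [proj, LinearMap.comp_apply, LinearMap.comp_apply, LinearEquiv.coe_coe, A.symm_coe hx,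
    DirectSum.component.lof_self]
  rfl

lemma proj_of_ne (A : DGLA K) {i j : ℤ} (hij : i ≠ j) {x : A.carrier} (hx : x ∈ A.grading j) :
    A.proj i x = 0 := by
  rw [proj, LinearMap.comp_apply, LinearMap.comp_apply, LinearEquiv.coe_coe, A.symm_coe hx,
    DirectSum.component.of, dif_neg hij.symm, map_zero]

/-- A graded DG-Lie subalgebra. -/
structure Sub (A : DGLA K) where
  G : ℤ → Submodule K A.carrier
  le : ∀ i, G i ≤ A.grading i
  d_mem : ∀ i, ∀ x ∈ G i, A.d x ∈ G (i + 1)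
  br_mem : ∀ i j, ∀ x ∈ G i, ∀ y ∈ G j, A.br x y ∈ G (i + j)

namespace Sub

variable {A : DGLA K} (B : A.Sub)

/-- The underlying subspace. -/
def total : Submodule K A.carrier := ⨆ i, B.G i

lemma le_total {i : ℤ} {x : A.carrier} (hx : x ∈ B.G i) : x ∈ B.total := le_iSup B.G i hx

lemma proj_mem (i : ℤ) {x : A.carrier} (hx : x ∈ B.total) : A.proj i x ∈ B.G i := by
  suffices h : B.total ≤ (B.G i).comap (A.proj i) from h hx
  refine iSup_le fun j y hy => ?_
  rw [Submodule.mem_comap]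
  by_cases hij : i = j
  · subst hij
    rwa [A.proj_self (B.le i hy)]
  · rw [A.proj_of_ne hij (B.le j hy)]
    exact zero_mem _

lemma d_mem_total {x : A.carrier} (hx : x ∈ B.total) : A.d x ∈ B.total := by
  suffices h : B.total ≤ B.total.comap A.dHom from h hx
  exact iSup_le fun j y hy => B.le_total (B.d_mem j y hy)

lemma br_mem_total {x y : A.carrier} (hx : x ∈ B.total) (hy : y ∈ B.total) :
    A.br x y ∈ B.total := by
  suffices h : B.total ≤ B.total.comap (IsLinearMap.mk' _ (A.br_lin₁ y)) from h hx
  refine iSup_le fun i x hx => ?_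
  suffices h : B.total ≤ B.total.comap (IsLinearMap.mk' _ (A.br_lin₂ x)) from h hy
  exact iSup_le fun j y hy => B.le_total (B.br_mem i j x hx y hy)

/-- A graded DG-Lie subalgebra as a DG-Lie algebra. -/
noncomputable def toDGLA : DGLA K where
  carrier := ↥B.total
  grading i := (B.G i).comap B.total.subtype
  internal := by
    refine isInternal_of_proj (fun i => A.proj i ∘ₗ B.total.subtype) (fun i x hx h => ?_)
      (fun i j hij x hx => A.proj_of_ne hij (B.le j hx)) ?_
    · exact Subtype.ext ((A.proj_self (B.le i hx)).symm.trans h)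
    · refine Submodule.map_injective_of_injective B.total.injective_subtype ?_
      rw [Submodule.map_iSup, Submodule.map_subtype_top]
      refine (iSup_congr fun i => ?_ : _ = ⨆ i, B.G i)
      rw [Submodule.map_comap_subtype, inf_eq_right]
      exact le_iSup B.G i
  d x := ⟨A.d x, B.d_mem_total x.2⟩
  d_lin := ⟨fun x y => Subtype.ext (A.d_lin.map_add _ _),
    fun c x => Subtype.ext (A.d_lin.map_smul _ _)⟩
  d_mem i x hx := B.d_mem i x hx
  d_sq x := Subtype.ext (A.d_sq x)
  br x y := ⟨A.br x y, B.br_mem_total x.2 y.2⟩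
  br_lin₁ z := ⟨fun x y => Subtype.ext ((A.br_lin₁ z).map_add _ _),
    fun c x => Subtype.ext ((A.br_lin₁ z).map_smul _ _)⟩
  br_lin₂ z := ⟨fun x y => Subtype.ext ((A.br_lin₂ z).map_add _ _),
    fun c x => Subtype.ext ((A.br_lin₂ z).map_smul _ _)⟩
  br_mem i j x hx y hy := B.br_mem i j x hx y hy
  skew i j x hx y hy := Subtype.ext (A.skew i j x (B.le i hx) y (B.le j hy))
  jacobi i j x hx y hy z := Subtype.ext (A.jacobi i j x (B.le i hx) y (B.le j hy) z)
  leibniz i x hx y := Subtype.ext (A.leibniz i x (B.le i hx) y)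

/-- The inclusion of a graded DG-Lie subalgebra. -/
noncomputable def incl : DGLAHom B.toDGLA A where
  toFun := Subtype.val
  lin := B.total.subtype.isLinear
  map_grading i _ hx := B.le i hx
  map_d _ := rfl
  map_br _ _ := rfl

end Sub

end DGLA

namespace SplitQCyclic

open scoped Classical in
/-- The graded pieces `H⁰, H¹ ⊕ K¹, L², L³, …` of the truncation. -/
def truncGrading (T : SplitQCyclic K) (i : ℤ) : Submodule K T.L :=
  if i < 0 then ⊥ else if i = 0 then T.S.H 0 else if i = 1 then T.S.H 1 ⊔ T.S.Kc 1
    else T.A.grading i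

variable {T : SplitQCyclic K}

lemma truncGrading_zero : T.truncGrading 0 = T.S.H 0 := by simp [truncGrading]

lemma truncGrading_one : T.truncGrading 1 = T.S.H 1 ⊔ T.S.Kc 1 := by simp [truncGrading]

lemma truncGrading_ge {i : ℤ} (hi : 2 ≤ i) : T.truncGrading i = T.A.grading i := by
  rw [truncGrading, if_neg (by omega), if_neg (by omega), if_neg (by omega)]

lemma truncGrading_cases {i : ℤ} {x : T.L} (hx : x ∈ T.truncGrading i) :
    x = 0 ∨ (i = 0 ∧ x ∈ T.S.H 0) ∨ (i = 1 ∧ x ∈ T.S.H 1 ⊔ T.S.Kc 1) ∨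
      (2 ≤ i ∧ x ∈ T.A.grading i) := by
  rw [truncGrading] at hx
  split_ifs at hx with h h' h''
  · exact Or.inl (by simpa using hx)
  · exact Or.inr (Or.inl ⟨h', hx⟩)
  · exact Or.inr (Or.inr (Or.inl ⟨h'', hx⟩))
  · exact Or.inr (Or.inr (Or.inr ⟨by omega, hx⟩))

lemma truncGrading_le (i : ℤ) : T.truncGrading i ≤ T.A.grading i := by
  intro x hx
  rcases truncGrading_cases hx with rfl | ⟨rfl, hx⟩ | ⟨rfl, hx⟩ | ⟨-, hx⟩
  exacts [zero_mem _, H_le hx, V_le hx, hx]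

lemma truncGrading_d_mem (i : ℤ) (x : T.L) (hx : x ∈ T.truncGrading i) :
    T.d x ∈ T.truncGrading (i + 1) := by
  rcases truncGrading_cases hx with rfl | ⟨rfl, hx⟩ | ⟨rfl, hx⟩ | ⟨hi, hx⟩
  · rw [map_zero]
    exact zero_mem _
  · rw [d_H hx]
    exact zero_mem _
  · rw [truncGrading_ge (by norm_num)]
    exact T.d_mem (V_le hx)
  · rw [truncGrading_ge (by omega)]
    exact T.d_mem hx

lemma truncGrading_br_mem (i j : ℤ) (x : T.L) (hx : x ∈ T.truncGrading i) (y : T.L)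
    (hy : y ∈ T.truncGrading j) : T.br x y ∈ T.truncGrading (i + j) := by
  have h2 : 2 ≤ i + j → T.br x y ∈ T.truncGrading (i + j) := fun h => by
    rw [truncGrading_ge h]
    exact T.br_mem (truncGrading_le i hx) (truncGrading_le j hy)
  rcases truncGrading_cases hx with rfl | ⟨rfl, hx⟩ | ⟨rfl, hx⟩ | ⟨hi, hx⟩
  · rw [map_zero, LinearMap.zero_apply]
    exact zero_mem _
  all_goals
    rcases truncGrading_cases hy with rfl | ⟨rfl, hy⟩ | ⟨rfl, hy⟩ | ⟨hj, hy⟩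
    · rw [map_zero]
      exact zero_mem _
  · rw [add_zero, truncGrading_zero]
    exact T.br_mem_H₀ x hx y hy
  · rw [zero_add, truncGrading_one]
    exact ad_V_mem hx hy
  · exact h2 (by omega)
  · rw [add_zero, truncGrading_one, ← neg_neg (T.br x y),
      ← br_skew_zero (H_le hy) (V_le hx)]
    exact neg_mem (ad_V_mem hy hx)
  all_goals exact h2 (by omega)

variable (T)

/-- The truncation `H⁰ ⊕ (H¹ ⊕ K¹) ⊕ L² ⊕ L³ ⊕ …`. -/
def trunc : T.A.toDGLA.Sub where
  G := T.truncGrading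
  le := truncGrading_le
  d_mem := truncGrading_d_mem
  br_mem := truncGrading_br_mem

variable {T}

lemma pr_mem_truncGrading {i : ℤ} {x : T.L} (hx : x ∈ T.A.grading i) :
    T.pr x ∈ T.truncGrading i := by
  have h := pr_mem hx
  rw [truncGrading]
  split_ifs with h0 h1 h2
  · rwa [T.H_neg i h0] at h
  · rwa [h1] at h
  · rw [h2] at h
    exact Submodule.mem_sup_left h
  · exact H_le h

lemma h_V {x : T.L} (hx : x ∈ T.S.H 1 ⊔ T.S.Kc 1) : T.h x = 0 := by
  obtain ⟨y, hy, z, hz, rfl⟩ := Submodule.mem_sup.mp hx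
  rw [map_add, h_H hy, h_K hz, add_zero]

lemma h_mem_truncGrading {i : ℤ} {x : T.L} (hx : x ∈ T.truncGrading i) :
    T.h x ∈ T.truncGrading (i - 1) := by
  rcases truncGrading_cases hx with rfl | ⟨rfl, hx⟩ | ⟨rfl, hx⟩ | ⟨hi, hx⟩
  · rw [map_zero]
    exact zero_mem _
  · rw [h_H hx]
    exact zero_mem _
  · rw [h_V hx]
    exact zero_mem _
  · have h := h_mem hx
    obtain rfl | hi := hi.eq_or_lt
    · exact truncGrading_one (T := T) ▸ Submodule.mem_sup_right h
    · rw [truncGrading_ge (by omega)]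
      exact Kc_le h

lemma exists_d_eq {i : ℤ} {x : T.L} (hx : x ∈ T.truncGrading i) (hd : T.d x = 0)
    (hz : T.pr x = 0) : ∃ y ∈ T.truncGrading (i - 1), T.d y = x := by
  have hxi := eq_of_d_eq_zero (truncGrading_le i hx) hd
  rw [hz, zero_sub, ← map_neg] at hxi
  exact ⟨_, neg_mem (h_mem_truncGrading hx), hxi.symm⟩

lemma trunc_incl_isQuasiIso : T.trunc.incl.IsQuasiIso := by
  refine fun i => ⟨?_, fun y hy => ?_⟩
  · rintro ⟨x, hx'⟩ ⟨hx, hdx⟩ ⟨-, z, hz⟩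
    obtain ⟨y, hy, hyx⟩ := exists_d_eq hx (congrArg Subtype.val hdx)
      ((congrArg T.pr hz).symm.trans (pr_d z))
    exact ⟨hx, ⟨y, T.trunc.le_total hy⟩, Subtype.ext hyx⟩
  · have hp : T.pr y ∈ T.trunc.G i := pr_mem_truncGrading hy.1
    refine ⟨⟨T.pr y, T.trunc.le_total hp⟩, ⟨hp, Subtype.ext (d_H (pr_mem hy.1))⟩,
      sub_mem (H_le (pr_mem hy.1)) hy.1, T.h y, ?_⟩
    have h := eq_of_d_eq_zero hy.1 hy.2
    change T.d (T.h y) = T.pr y - y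
    rw [eq_sub_iff_add_eq'] at h ⊢
    rw [← h]
    abel

lemma proj_mem_H₀ {x : T.L} (hx : x ∈ T.trunc.total) : T.A.toDGLA.proj 0 x ∈ T.S.H 0 :=
  truncGrading_zero (T := T) ▸ T.trunc.proj_mem 0 hx

lemma proj_mem_V {x : T.L} (hx : x ∈ T.trunc.total) :
    T.A.toDGLA.proj 1 x ∈ T.S.H 1 ⊔ T.S.Kc 1 :=
  truncGrading_one (T := T) ▸ T.trunc.proj_mem 1 hx

lemma q_proj_mem_W₂ {x : T.L} (hx : x ∈ T.trunc.total) : T.q (T.A.toDGLA.proj 2 x) ∈ T.W₂ :=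
  q_mem (T.trunc.le 2 (T.trunc.proj_mem 2 hx))

variable (T)

/-- The projection of the truncation onto its minimal quotient. -/
noncomputable def toMinimal : ↥T.trunc.total →ₗ[K] T.G × T.V × ↥T.W₂ × PUnit :=
  ((T.A.toDGLA.proj 0).restrict fun _ => proj_mem_H₀).prod
    (((T.A.toDGLA.proj 1).restrict fun _ => proj_mem_V).prod
      (((T.q ∘ₗ T.A.toDGLA.proj 2).restrict fun _ => q_proj_mem_W₂).prod 0))

variable {T}

lemma toMinimal_zero {x : ↥T.trunc.total} (hx : (x : T.L) ∈ T.S.H 0) :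
    T.toMinimal x = (⟨x, hx⟩, 0, 0, 0) := by
  refine Prod.ext (Subtype.ext (DGLA.proj_self _ (H_le hx))) (Prod.ext (Subtype.ext ?_)
    (Prod.ext (Subtype.ext ?_) rfl))
  · exact DGLA.proj_of_ne _ (by norm_num) (H_le hx)
  · exact (congrArg T.q (DGLA.proj_of_ne _ (by norm_num) (H_le hx))).trans (map_zero _)

lemma toMinimal_one {x : ↥T.trunc.total} (hx : (x : T.L) ∈ T.S.H 1 ⊔ T.S.Kc 1) :
    T.toMinimal x = (0, ⟨x, hx⟩, 0, 0) := by
  refine Prod.ext (Subtype.ext ?_) (Prod.ext (Subtype.ext (DGLA.proj_self _ (V_le hx)))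
    (Prod.ext (Subtype.ext ?_) rfl))
  · exact DGLA.proj_of_ne _ (by norm_num) (V_le hx)
  · exact (congrArg T.q (DGLA.proj_of_ne _ (by norm_num) (V_le hx))).trans (map_zero _)

lemma toMinimal_two {x : ↥T.trunc.total} (hx : (x : T.L) ∈ T.A.grading 2) :
    T.toMinimal x = (0, 0, ⟨T.q x, q_mem hx⟩, 0) := by
  refine Prod.ext (Subtype.ext ?_) (Prod.ext (Subtype.ext ?_) (Prod.ext (Subtype.ext ?_) rfl))
  · exact DGLA.proj_of_ne _ (by norm_num) hx
  · exact DGLA.proj_of_ne _ (by norm_num) hx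
  · exact congrArg T.q (DGLA.proj_self _ hx)

lemma toMinimal_ge {i : ℤ} (hi : 3 ≤ i) {x : ↥T.trunc.total} (hx : (x : T.L) ∈ T.A.grading i) :
    T.toMinimal x = 0 := by
  refine Prod.ext (Subtype.ext ?_) (Prod.ext (Subtype.ext ?_) (Prod.ext (Subtype.ext ?_) rfl))
  · exact DGLA.proj_of_ne _ (by omega) hx
  · exact DGLA.proj_of_ne _ (by omega) hx
  · exact (congrArg T.q (DGLA.proj_of_ne _ (by omega) hx)).trans (map_zero _)

lemma trunc_cases {i : ℤ} {x : ↥T.trunc.total} (hx : x ∈ T.trunc.toDGLA.grading i) :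
    x = 0 ∨ (i = 0 ∧ (x : T.L) ∈ T.S.H 0) ∨ (i = 1 ∧ (x : T.L) ∈ T.S.H 1 ⊔ T.S.Kc 1) ∨
      (i = 2 ∧ (x : T.L) ∈ T.A.grading 2) ∨ (3 ≤ i ∧ (x : T.L) ∈ T.A.grading i) := by
  rcases truncGrading_cases hx with h | ⟨rfl, h⟩ | ⟨rfl, h⟩ | ⟨hi, h⟩
  · exact Or.inl (Subtype.ext h)
  · exact Or.inr (Or.inl ⟨rfl, h⟩)
  · exact Or.inr (Or.inr (Or.inl ⟨rfl, h⟩))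
  · obtain rfl | hi := hi.eq_or_lt
    · exact Or.inr (Or.inr (Or.inr (Or.inl ⟨rfl, h⟩)))
    · exact Or.inr (Or.inr (Or.inr (Or.inr ⟨hi, h⟩)))

lemma q_d (x : T.L) : T.q (T.d x) = T.d x := by
  have : T.q ∘ₗ T.d = T.d := DGLA.hom_ext fun i x hx => by
    have := eq_of_d_eq_zero (T.d_mem hx) (T.d_d x)
    exact this.symm
  exact LinearMap.congr_fun this x

lemma toMinimal_d {i : ℤ} {x : ↥T.trunc.total} (hx : x ∈ T.trunc.toDGLA.grading i) :
    T.toMinimal (T.trunc.toDGLA.d x) = T.minimalQuotient.d (T.toMinimal x) := by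
  rcases trunc_cases hx with rfl | ⟨rfl, h⟩ | ⟨rfl, h⟩ | ⟨rfl, h⟩ | ⟨hi, h⟩
  · have hd : T.trunc.toDGLA.d 0 = (0 : ↥T.trunc.total) := T.trunc.toDGLA.d_lin.map_zero
    refine (congrArg T.toMinimal hd).trans ?_
    rw [map_zero]
    exact T.minimalQuotient.toDGLA.d_lin.map_zero.symm
  · have hd : T.trunc.toDGLA.d x = (0 : ↥T.trunc.total) := Subtype.ext (d_H h)
    refine (congrArg T.toMinimal hd).trans ?_
    rw [map_zero, toMinimal_zero h]
    exact (Prod.ext rfl (Prod.ext rfl (Prod.ext (map_zero _) rfl)) :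
      T.minimalQuotient.d (⟨x, h⟩, 0, 0, 0) = 0).symm
  · have hd : T.d (x : T.L) ∈ T.A.grading 2 := T.d_mem (V_le h)
    rw [toMinimal_one h, toMinimal_two (x := T.trunc.toDGLA.d x) hd]
    simp only [FourTerm.d, map_zero]
    exact Prod.ext rfl (Prod.ext rfl (Prod.ext (Subtype.ext (q_d _)) rfl))
  · have hd : T.d (x : T.L) ∈ T.A.grading 3 := T.d_mem h
    rw [toMinimal_two h, toMinimal_ge le_rfl (x := T.trunc.toDGLA.d x) hd]
    simp only [FourTerm.d, map_zero]
    rfl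
  · have hd : T.d (x : T.L) ∈ T.A.grading (i + 1) := T.d_mem h
    rw [toMinimal_ge hi h, toMinimal_ge (by omega) (x := T.trunc.toDGLA.d x) hd]
    exact T.minimalQuotient.toDGLA.d_lin.map_zero.symm

lemma toMinimal_br {i j : ℤ} {x y : ↥T.trunc.total} (hx : x ∈ T.trunc.toDGLA.grading i)
    (hy : y ∈ T.trunc.toDGLA.grading j) :
    T.toMinimal (T.trunc.toDGLA.br x y) = T.minimalQuotient.br (T.toMinimal x) (T.toMinimal y) := by
  have hz : ∀ k, 3 ≤ k → T.br (x : T.L) (y : T.L) ∈ T.A.grading k →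
      T.minimalQuotient.br (T.toMinimal x) (T.toMinimal y) = 0 →
      T.toMinimal (T.trunc.toDGLA.br x y) = T.minimalQuotient.br (T.toMinimal x) (T.toMinimal y) :=
    fun k hk hb h => (toMinimal_ge hk (x := T.trunc.toDGLA.br x y) hb).trans h.symm
  rcases trunc_cases hx with rfl | ⟨rfl, h⟩ | ⟨rfl, h⟩ | ⟨rfl, h⟩ | ⟨hi, h⟩
  · have hb : T.br ((0 : ↥T.trunc.total) : T.L) (y : T.L) = 0 := by simp
    refine hz 3 le_rfl (hb ▸ zero_mem _) ?_
    rw [map_zero]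
    exact (T.minimalQuotient.toDGLA.br_lin₁ _).map_zero
  all_goals
    rcases trunc_cases hy with rfl | ⟨rfl, h'⟩ | ⟨rfl, h'⟩ | ⟨rfl, h'⟩ | ⟨hj, h'⟩
    · have hb : T.br (x : T.L) ((0 : ↥T.trunc.total) : T.L) = 0 := by simp
      refine hz 3 le_rfl (hb ▸ zero_mem _) ?_
      rw [map_zero]
      exact (T.minimalQuotient.toDGLA.br_lin₂ _).map_zero
  · rw [toMinimal_zero h, toMinimal_zero h',
      toMinimal_zero (x := T.trunc.toDGLA.br x y) (T.br_mem_H₀ _ h _ h')]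
    simp only [FourTerm.br, map_zero, sub_zero, add_zero]
    rfl
  · rw [toMinimal_zero h, toMinimal_one h',
      toMinimal_one (x := T.trunc.toDGLA.br x y) (ad_V_mem h h')]
    simp [FourTerm.br]
    rfl
  · have hb : T.br (x : T.L) (y : T.L) ∈ T.A.grading 2 := by simpa using T.br_mem (H_le h) h'
    rw [toMinimal_zero h, toMinimal_two h', toMinimal_two (x := T.trunc.toDGLA.br x y) hb]
    simp [FourTerm.br]
    exact Subtype.ext (q_ad h _)
  · refine hz j hj (by simpa using T.br_mem (H_le h) h') ?_
    rw [toMinimal_ge hj h']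
    exact (T.minimalQuotient.toDGLA.br_lin₂ _).map_zero
  · have hb : T.br (x : T.L) (y : T.L) = -T.br (y : T.L) (x : T.L) :=
      (neg_eq_iff_eq_neg.mpr (br_skew_zero (H_le h') (V_le h))).symm
    rw [toMinimal_one h, toMinimal_zero h', toMinimal_one (x := T.trunc.toDGLA.br x y)
      (hb.symm ▸ neg_mem (ad_V_mem h' h) : T.br (x : T.L) (y : T.L) ∈ T.S.H 1 ⊔ T.S.Kc 1)]
    simp [FourTerm.br]
    exact Subtype.ext hb
  · rw [toMinimal_one h, toMinimal_one h',
      toMinimal_two (x := T.trunc.toDGLA.br x y) (T.br_mem (V_le h) (V_le h'))]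
    simp [FourTerm.br]
    rfl
  · refine hz 3 le_rfl (T.br_mem (V_le h) h') ?_
    rw [toMinimal_one h, toMinimal_two h']
    simp [FourTerm.br]
  · refine hz (1 + j) (by omega) (T.br_mem (V_le h) h') ?_
    rw [toMinimal_ge hj h']
    exact (T.minimalQuotient.toDGLA.br_lin₂ _).map_zero
  · have hb : T.br (x : T.L) (y : T.L) = -T.br (y : T.L) (x : T.L) :=
      (neg_eq_iff_eq_neg.mpr (br_skew_zero (H_le h') h)).symm
    have hb' : T.br (x : T.L) (y : T.L) ∈ T.A.grading 2 := by simpa using T.br_mem h (H_le h')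
    rw [toMinimal_two h, toMinimal_zero h', toMinimal_two (x := T.trunc.toDGLA.br x y) hb']
    simp [FourTerm.br]
    exact Subtype.ext ((congrArg T.q hb).trans ((map_neg _ _).trans (congrArg _ (q_ad h' _))))
  · refine hz 3 le_rfl (T.br_mem h (V_le h')) ?_
    rw [toMinimal_two h, toMinimal_one h']
    simp [FourTerm.br]
  · refine hz 4 (by omega) (T.br_mem h h') ?_
    rw [toMinimal_two h, toMinimal_two h']
    simp [FourTerm.br]
  · refine hz (2 + j) (by omega) (T.br_mem h h') ?_
    rw [toMinimal_ge hj h']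
    exact (T.minimalQuotient.toDGLA.br_lin₂ _).map_zero
  · refine hz i hi (by simpa using T.br_mem h (H_le h')) ?_
    rw [toMinimal_ge hi h]
    exact (T.minimalQuotient.toDGLA.br_lin₁ _).map_zero
  · refine hz (i + 1) (by omega) (T.br_mem h (V_le h')) ?_
    rw [toMinimal_ge hi h]
    exact (T.minimalQuotient.toDGLA.br_lin₁ _).map_zero
  · refine hz (i + 2) (by omega) (T.br_mem h h') ?_
    rw [toMinimal_ge hi h]
    exact (T.minimalQuotient.toDGLA.br_lin₁ _).map_zero
  · refine hz (i + j) (by omega) (T.br_mem h h') ?_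
    rw [toMinimal_ge hi h]
    exact (T.minimalQuotient.toDGLA.br_lin₁ _).map_zero

variable (T)

/-- The projection of the truncation onto its minimal quotient, as a DG-Lie morphism. -/
noncomputable def toMinimalHom : DGLAHom T.trunc.toDGLA T.minimalQuotient.toDGLA where
  toFun := T.toMinimal
  lin := T.toMinimal.isLinear
  map_grading i x hx := by
    rcases trunc_cases hx with rfl | ⟨rfl, h⟩ | ⟨rfl, h⟩ | ⟨rfl, h⟩ | ⟨hi, h⟩
    · rw [map_zero]
      exact zero_mem (T.minimalQuotient.toDGLA.grading i)
    · rw [toMinimal_zero h]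
      exact FourTerm.mem_grading_zero _
    · rw [toMinimal_one h]
      exact FourTerm.mem_grading_one _
    · rw [toMinimal_two h]
      exact FourTerm.mem_grading_two _
    · rw [toMinimal_ge hi h]
      exact zero_mem (T.minimalQuotient.toDGLA.grading i)
  map_d x := LinearMap.congr_fun (f := T.toMinimal ∘ₗ T.trunc.toDGLA.dHom)
    (g := T.minimalQuotient.toDGLA.dHom ∘ₗ T.toMinimal)
    (DGLA.hom_ext fun _ _ hx => toMinimal_d hx) x
  map_br x y := by
    have h : ∀ i, ∀ x ∈ T.trunc.toDGLA.grading i, ∀ y, T.toMinimal (T.trunc.toDGLA.br x y) =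
        T.minimalQuotient.br (T.toMinimal x) (T.toMinimal y) := fun i x hx y =>
      LinearMap.congr_fun (f := T.toMinimal ∘ₗ IsLinearMap.mk' _ (T.trunc.toDGLA.br_lin₂ x))
        (g := IsLinearMap.mk' _ (T.minimalQuotient.toDGLA.br_lin₂ (T.toMinimal x)) ∘ₗ T.toMinimal)
        (DGLA.hom_ext fun _ _ hy => toMinimal_br hx hy) y
    exact LinearMap.congr_fun (f := T.toMinimal ∘ₗ IsLinearMap.mk' _ (T.trunc.toDGLA.br_lin₁ y))
      (g := IsLinearMap.mk' _ (T.minimalQuotient.toDGLA.br_lin₁ (T.toMinimal y)) ∘ₗ T.toMinimal)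
      (DGLA.hom_ext fun i x hx => h i x hx y) x

variable {T}

lemma q_of_d_eq_zero {x : T.L} {i : ℤ} (hx : x ∈ T.A.grading i) (hd : T.d x = 0) : T.q x = x :=
  (eq_of_d_eq_zero hx hd).symm

lemma W₂_le {x : T.L} (hx : x ∈ T.W₂) : x ∈ T.A.grading 2 := by
  obtain ⟨y, hy, z, ⟨k, hk, rfl⟩, rfl⟩ := Submodule.mem_sup.mp hx
  exact add_mem (H_le hy) (T.d_mem (Kc_le hk))

lemma d_of_mem_W₂ {x : T.L} (hx : x ∈ T.W₂) : T.d x = 0 := by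
  obtain ⟨y, hy, z, ⟨k, hk, rfl⟩, rfl⟩ := Submodule.mem_sup.mp hx
  rw [map_add, d_H hy, T.d_d, add_zero]

lemma toMinimalHom_isQuasiIso : T.toMinimalHom.IsQuasiIso := by
  refine fun i => ⟨fun (x : ↥T.trunc.total) hx hb => ?_, fun y hy => ?_⟩
  · obtain ⟨-, z, hz⟩ := hb
    have hd : T.d (x : T.L) = 0 := congrArg Subtype.val hx.2
    refine ⟨hx.1, ?_⟩
    change T.minimalQuotient.d z = T.toMinimal x at hz
    rcases trunc_cases hx.1 with h | ⟨rfl, h⟩ | ⟨rfl, h⟩ | ⟨rfl, h⟩ | ⟨hi, h⟩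
    · exact h ▸ zero_mem _
    · rw [toMinimal_zero h] at hz
      have h0 : x = 0 := Subtype.ext (congrArg (fun w => (w.1 : T.L)) hz).symm
      exact h0 ▸ zero_mem _
    · rw [toMinimal_one h] at hz
      have h0 : x = 0 := Subtype.ext (congrArg (fun w => (w.2.1 : T.L)) hz).symm
      exact h0 ▸ zero_mem _
    · rw [toMinimal_two h] at hz
      have h0 : T.d (z.2.1 : T.L) = (x : T.L) :=
        (congrArg (fun w => (w.2.2.1 : T.L)) hz).trans (q_of_d_eq_zero h hd)
      have hs : (z.2.1 : T.L) ∈ T.trunc.G 1 := (truncGrading_one (T := T)).ge z.2.1.2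
      exact ⟨⟨_, T.trunc.le_total hs⟩, Subtype.ext h0⟩
    · have hp : T.pr (x : T.L) = 0 := by
        have := pr_mem h
        rwa [H_eq_bot hi, Submodule.mem_bot] at this
      obtain ⟨y, hy, hyx⟩ := exists_d_eq (hx.1 : (x : T.L) ∈ T.truncGrading i) hd hp
      exact ⟨⟨y, T.trunc.le_total hy⟩, Subtype.ext hyx⟩
  · suffices h : ∃ x ∈ T.trunc.toDGLA.cocycles i, T.toMinimal x = y by
      obtain ⟨x, hx, hxy⟩ := h
      exact ⟨x, hx, (sub_eq_zero.mpr hxy) ▸ zero_mem _⟩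
    rcases FourTerm.grading_cases hy.1 with
      ⟨rfl, a, rfl⟩ | ⟨rfl, s, rfl⟩ | ⟨rfl, w, rfl⟩ | ⟨rfl, u, rfl⟩ | rfl
    · have ha : (a : T.L) ∈ T.trunc.G 0 := (truncGrading_zero (T := T)).ge a.2
      exact ⟨⟨a, T.trunc.le_total ha⟩, ⟨ha, Subtype.ext (d_H a.2)⟩, toMinimal_zero a.2⟩
    · have hs : (s : T.L) ∈ T.trunc.G 1 := (truncGrading_one (T := T)).ge s.2
      have hd : T.d (s : T.L) = 0 := congrArg (fun w => (w.2.2.1 : T.L)) hy.2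
      exact ⟨⟨s, T.trunc.le_total hs⟩, ⟨hs, Subtype.ext hd⟩, toMinimal_one s.2⟩
    · have hw : (w : T.L) ∈ T.trunc.G 2 := (truncGrading_ge (T := T) le_rfl).ge (W₂_le w.2)
      refine ⟨⟨w, T.trunc.le_total hw⟩, ⟨hw, Subtype.ext (d_of_mem_W₂ w.2)⟩, ?_⟩
      rw [toMinimal_two (W₂_le w.2)]
      exact Prod.ext rfl (Prod.ext rfl (Prod.ext
        (Subtype.ext (q_of_d_eq_zero (W₂_le w.2) (d_of_mem_W₂ w.2))) rfl))
    all_goals exact ⟨0, zero_mem _, map_zero T.toMinimal⟩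

theorem isFormal [CharZero K] : T.A.toDGLA.IsFormal :=
  ⟨T.cohomologyLie.toDGLA, T.cohomologyLie_d,
    (ZigzagQIso.of ⟨_, trunc_incl_isQuasiIso⟩).symm.trans <|
      (ZigzagQIso.of ⟨_, toMinimalHom_isQuasiIso⟩).trans <|
        (ZigzagQIso.of T.qIso_minimalQuotient).symm.trans (.of T.qIso_cohomologyLie)⟩

end SplitQCyclic

/-- **Theorem (conclusion of the proof of the main algebraic theorem).**
In the standing setup of degree `2`, with `f` the family above: for every `p ≥ 2` and
all `ξ₁, …, ξ_{p+1} ∈ H^1`,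
`{ξ₁,…,ξ_{p+1}}_{p+1} = (1/2) Σ_{j=1}^{p} Σ_{σ ∈ S(j,p+1-j)}
  {f_j(ξ_{σ(1)},…), f_{p+1-j}(…,ξ_{σ(p+1)})}₂`.
Consequently `(f₁, 0, f₃, f₄, …)` is an `L∞` isomorphism from the transferred minimal
`L∞` structure on `H` to the graded Lie algebra `H^*(L)`, and therefore `L` is
formal. -/
theorem fFamily_is_Linfty_morphism_and_formality
    {K : Type} [Field K] [CharZero K]
    (A : QCyclicDGLA K 2) (S : GradedSplitting A.toDGLA)
    (h1 : ∀ i : ℤ, i < 0 → S.H i = ⊥)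
    (h2 : ∀ x ∈ S.H 0, ∀ y ∈ S.H 0, A.br x y ∈ S.H 0)
    (h3H : ∀ i : ℤ, ∀ g ∈ S.H 0, ∀ x ∈ S.H i, A.br g x ∈ S.H i)
    (h3K : ∀ i : ℤ, ∀ g ∈ S.H 0, ∀ x ∈ S.Kc i, A.br g x ∈ S.Kc i)
    (hperp : ∀ i j : ℤ, ∀ x ∈ S.H i, ∀ y ∈ S.Kc j, A.form x y = 0)
    (C : ContractionData A.toDGLA S)
    (ι bh : (p : ℕ) → (Fin p → A.carrier) → A.carrier)
    (hT : IsTransfer A.toDGLA S C ι bh)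
    (f : (p : ℕ) → (Fin p → A.carrier) → A.carrier)
    (hf : IsFFamily A S ι f) :
    -- the `L∞`-morphism identity expressing `{⋯}_{p+1}` through `f` and `{·,·}₂`
    (∀ (p : ℕ), 2 ≤ p → ∀ v : Fin (p + 1) → A.carrier, (∀ i, v i ∈ S.H 1) →
      bh (p + 1) v = (2 : K)⁻¹ •
        ∑ j ∈ (Finset.Icc 1 p).attach, ∑ σ ∈ shuffles (p + 1) j.1,
          C.pr (A.br
            (f j.1 (tupleTake (p + 1) j.1
              (by have := (Finset.mem_Icc.mp j.2).2; omega) (fun i => v (σ i))))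
            (f (p + 1 - j.1) (tupleDrop (p + 1) j.1
              (by have := (Finset.mem_Icc.mp j.2).2; omega) (fun i => v (σ i)))))) ∧
    -- and therefore `L` is formal
    A.toDGLA.IsFormal := by
  let T : SplitQCyclic K := ⟨A, S, C, h1, h2, h3H, h3K, hperp⟩
  exact ⟨fun p hp v hv => T.bracket_eq_sum hT hf p hp v hv, T.isFormal⟩
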